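/- arXiv:2405.16015 — 3 statements merged into one kernel-verified Lean document; each statement's English description precedes it below -/
import Mathlib

section
/- Let δ = 3/2 − (log 3)/(2·log 2) and for k ∈ ℕ let b(k) = ∑_{n=0}^{k} x n k (this sum is finite since x n k = 0 for n > k). Then there exists an infinitely differentiable function ω : (0,∞) → (0,∞) satisfying ω(4y) = ω(y) for all y > 0, such that b(k) is asymptotic to ω(k)·k^{−δ}·4^k as k → ∞, i.e. lim_{k→∞} b(k)/(ω(k)·k^{−δ}·4^k) = 1. -/
open Filter Real

/-- `xfun n k` is the multiplicity of the indecomposable tilting module `T(2n)` in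
`V^{⊗2k}`, where `V` is the natural representation of `SL₂` in characteristic 2. -/
def xfun : ℕ → ℕ → ℕ
  | 0, 0 => 1
  | 0, _ + 1 => 0
  | _ + 1, 0 => 0
  | n + 1, k + 1 =>
      xfun n k + 2 * ∑ i ∈ Finset.range ((n + 1).factorization 2 + 1), xfun (n + 2 ^ i) k

/-- `b k` is the number of indecomposable factors of `V^{⊗2k}`, counted with multiplicity. -/
def b (k : ℕ) : ℕ := ∑ n ∈ Finset.range (k + 1), xfun n k

noncomputable def δ : ℝ := 3 / 2 - Real.log 3 / (2 * Real.log 2)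

/-! ### Part A: the binomial recursion for `b` -/

lemma xfun_zero_succ (k : ℕ) : xfun 0 (k + 1) = 0 := by rw [xfun]

lemma xfun_succ_zero (n : ℕ) : xfun (n + 1) 0 = 0 := by rw [xfun]

lemma xfun_zero_zero : xfun 0 0 = 1 := by rw [xfun]

lemma xfun_succ_succ (n k : ℕ) : xfun (n + 1) (k + 1) =
    xfun n k + 2 * ∑ i ∈ Finset.range ((n + 1).factorization 2 + 1), xfun (n + 2 ^ i) k := by
  rw [xfun]

lemma xfun_eq_zero_of_lt (k : ℕ) : ∀ n, k < n → xfun n k = 0 := by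
  induction k with
  | zero =>
    intro n hn
    obtain ⟨m, rfl⟩ : ∃ m, n = m + 1 := ⟨n - 1, by omega⟩
    exact xfun_succ_zero m
  | succ k ih =>
    intro n hn
    obtain ⟨m, rfl⟩ : ∃ m, n = m + 1 := ⟨n - 1, by omega⟩
    rw [xfun_succ_succ, ih m (by omega)]
    simp only [zero_add, mul_eq_zero, OfNat.ofNat_ne_zero, false_or]
    refine Finset.sum_eq_zero fun i _ => ih _ (by have := Nat.one_le_two_pow (n := i); omega)

/-- Binomial expansion of powers of `2 + N` applied to a vector. -/
lemma two_add_pow_apply {R V : Type*} [Semiring R] [AddCommMonoid V] [Module R V]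
    (N : Module.End R V) (v : V) (k : ℕ) :
    ((2 + N) ^ k) v = ∑ j ∈ Finset.range (k + 1), (k.choose j * 2 ^ (k - j)) • (N ^ j) v := by
  have hc : Commute N (2 : Module.End R V) := Commute.ofNat_right N 2
  rw [add_comm, hc.add_pow, LinearMap.sum_apply]
  refine Finset.sum_congr rfl fun j _ => ?_
  have : N ^ j * 2 ^ (k - j) * ((k.choose j : ℕ) : Module.End R V)
      = (k.choose j * 2 ^ (k - j)) • N ^ j := by
    rw [nsmul_eq_mul]
    push_cast
    rw [mul_assoc, (Nat.cast_commute (k.choose j) ((2 : Module.End R V) ^ (k - j))).eq]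
    · have h1 : Commute (N ^ j) ((2 : Module.End R V) ^ (k - j) * (k.choose j : Module.End R V)) := by
        refine Commute.mul_right ?_ ?_
        · exact (hc.pow_left j).pow_right _
        · exact Nat.commute_cast _ _
      exact h1.eq
  rw [this]
  rfl

/-- The operator of tensoring with `V`, acting on multiplicity vectors. -/
def Nop : Module.End ℕ (ℕ → ℕ) where
  toFun u n := (if n = 0 then 0 else u (n - 1)) +
    2 * ∑ i ∈ Finset.range ((n + 1).factorization 2), u (n + 2 ^ (i + 1) - 1)
  map_add' u v := by
    funext n
    simp only [Pi.add_apply, Finset.sum_add_distrib]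
    split_ifs <;> ring
  map_smul' c u := by
    funext n
    simp only [Pi.smul_apply, smul_eq_mul, RingHom.id_apply, ← Finset.mul_sum]
    split_ifs <;> ring

lemma Nop_apply (u : ℕ → ℕ) (n : ℕ) : Nop u n = (if n = 0 then 0 else u (n - 1)) +
    2 * ∑ i ∈ Finset.range ((n + 1).factorization 2), u (n + 2 ^ (i + 1) - 1) := rfl

/-- multiplicity of `T(n)` in `V^{⊗j}`. -/
def yfun (j n : ℕ) : ℕ :=
  if n % 2 = j % 2 then xfun ((n + 1) / 2) ((j + 1) / 2) else 0

lemma fact_odd (p : ℕ) : (2 * p + 1).factorization 2 = 0 :=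
  Nat.factorization_eq_zero_of_not_dvd (by omega)

lemma fact_even (p : ℕ) : (2 * (p + 1)).factorization 2 = (p + 1).factorization 2 + 1 := by
  rw [Nat.factorization_mul (by norm_num) (by omega)]
  simp [Nat.Prime.factorization_self Nat.prime_two, add_comm]

lemma yfun_succ (j : ℕ) : yfun (j + 1) = Nop (yfun j) := by
  funext n
  rw [Nop_apply]
  rcases Nat.even_or_odd' n with ⟨p, rfl | rfl⟩
  · rw [fact_odd]
    simp only [Finset.range_zero, Finset.sum_empty, mul_zero, add_zero]
    rcases p with _ | p
    · simp only [mul_zero, if_true]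
      unfold yfun
      split_ifs with h
      · obtain ⟨i, rfl⟩ : ∃ i, j = 2 * i + 1 := ⟨j / 2, by omega⟩
        rw [show (2 * i + 1 + 1 + 1) / 2 = i + 1 by omega]
        exact xfun_zero_succ i
      · rfl
    · rw [if_neg (by omega)]
      unfold yfun
      by_cases h : j % 2 = 1
      · rw [if_pos (by omega), if_pos (by omega)]
        congr 1 <;> omega
      · rw [if_neg (by omega), if_neg (by omega)]
  · rw [if_neg (by omega), show 2 * p + 1 + 1 = 2 * (p + 1) by ring, fact_even]
    by_cases h : j % 2 = 0
    · obtain ⟨i, rfl⟩ : ∃ i, j = 2 * i := ⟨j / 2, by omega⟩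
      unfold yfun
      rw [if_pos (by omega), if_pos (by omega)]
      rw [show (2 * p + 1 + 1) / 2 = p + 1 by omega, show (2 * i + 1 + 1) / 2 = i + 1 by omega,
        xfun_succ_succ, show (2 * p + 1 - 1 + 1) / 2 = p by omega, show (2 * i + 1) / 2 = i by omega]
      congr 2
      refine Finset.sum_congr rfl fun q _ => ?_
      have hq : 2 ^ (q + 1) = 2 * 2 ^ q := by ring
      rw [hq, if_pos (by omega)]
      congr 1
      omega
    · unfold yfun
      rw [if_neg (by omega), if_neg (by omega), zero_add, eq_comm]
      simp only [mul_eq_zero, OfNat.ofNat_ne_zero, false_or]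
      refine Finset.sum_eq_zero fun q _ => ?_
      have hq : 2 ^ (q + 1) = 2 * 2 ^ q := by ring
      rw [hq, if_neg (by omega)]

lemma yfun_eq_pow (j : ℕ) : yfun j = (Nop ^ j) (yfun 0) := by
  induction j with
  | zero => rfl
  | succ j ih => rw [yfun_succ, ih, pow_succ']; rfl

lemma ufun_eq_pow (k : ℕ) : (fun n => xfun (n + 1) (k + 1)) = ((2 + Nop) ^ k) (yfun 0) := by
  induction k with
  | zero =>
    funext n
    rw [xfun_succ_succ]
    have h0 : ∑ i ∈ Finset.range ((n + 1).factorization 2 + 1), xfun (n + 2 ^ i) 0 = 0 := by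
      refine Finset.sum_eq_zero fun i _ => xfun_eq_zero_of_lt _ _ ?_
      have := Nat.one_le_two_pow (n := i); omega
    rw [h0]
    simp only [mul_zero, add_zero, pow_zero, Module.End.one_apply]
    unfold yfun
    split_ifs with h
    · rcases n with _ | n
      · rfl
      · rw [xfun_succ_zero, eq_comm]
        exact xfun_eq_zero_of_lt _ _ (by omega)
    · exact xfun_eq_zero_of_lt _ _ (by omega)
  | succ k ih =>
    rw [pow_succ', Module.End.mul_apply, ← ih]
    funext n
    rw [LinearMap.add_apply, Pi.add_apply, Nop_apply, xfun_succ_succ, Finset.sum_range_succ']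
    have h2 : ((2 : Module.End ℕ (ℕ → ℕ)) fun n => xfun (n + 1) (k + 1)) n
        = 2 * xfun (n + 1) (k + 1) := by
      rw [← one_add_one_eq_two, LinearMap.add_apply]
      simp only [Module.End.one_apply, Pi.add_apply]
      ring
    rw [h2]
    have h3 : (if n = 0 then 0 else xfun (n - 1 + 1) (k + 1)) = xfun n (k + 1) := by
      split_ifs with h
      · rw [h, xfun_zero_succ]
      · rw [show n - 1 + 1 = n by omega]
    rw [h3]
    have h4 : ∀ i, xfun (n + 2 ^ (i + 1) - 1 + 1) (k + 1) = xfun (n + 2 ^ (i + 1)) (k + 1) := by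
      intro i
      have := Nat.one_le_two_pow (n := i + 1)
      congr 1
      omega
    simp only [h4, pow_zero]
    ring

lemma yfun_sum (j M : ℕ) (hM : j < M) : ∑ n ∈ Finset.range M, yfun j n = b ((j + 1) / 2) := by
  have hz : ∀ n, j < n → yfun j n = 0 := by
    intro n hn
    unfold yfun
    split_ifs with h
    · exact xfun_eq_zero_of_lt _ _ (by omega)
    · rfl
  have h1 : ∑ n ∈ Finset.range M, yfun j n = ∑ n ∈ Finset.range (j + 1), yfun j n := by
    rw [eq_comm]
    apply Finset.sum_subset (by simpa using hM)
    intro n _ hn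
    apply hz
    rw [Finset.mem_range] at hn
    omega
  rw [h1]
  clear h1 hz hM
  rcases Nat.even_or_odd' j with ⟨i, rfl | rfl⟩
  · rw [show (2 * i + 1) / 2 = i by omega]
    unfold b
    have key : ∀ N, ∑ n ∈ Finset.range (2 * N + 1), yfun (2 * i) n
        = ∑ n ∈ Finset.range (N + 1), xfun n i := by
      intro N
      induction N with
      | zero =>
        simp [yfun]
        congr 1
        omega
      | succ N ih =>
        rw [show 2 * (N + 1) + 1 = 2 * N + 1 + 1 + 1 by ring, Finset.sum_range_succ,
          Finset.sum_range_succ, ih, Finset.sum_range_succ _ (N + 1)]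
        unfold yfun
        rw [if_neg (by omega), if_pos (by omega), add_zero]
        congr 2 <;> omega
    exact key i
  · rw [show (2 * i + 1 + 1) / 2 = i + 1 by omega]
    unfold b
    have key : ∀ N, ∑ n ∈ Finset.range (2 * N), yfun (2 * i + 1) n
        = ∑ n ∈ Finset.range (N + 1), xfun n (i + 1) := by
      intro N
      induction N with
      | zero => simp [xfun_zero_succ]
      | succ N ih =>
        rw [show 2 * (N + 1) = 2 * N + 1 + 1 by ring, Finset.sum_range_succ,
          Finset.sum_range_succ, ih, Finset.sum_range_succ _ (N + 1)]
        unfold yfun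
        rw [if_neg (by omega), if_pos (by omega), add_zero]
        congr 2 <;> omega
    rw [show 2 * i + 1 + 1 = 2 * (i + 1) by ring]
    exact key (i + 1)

theorem b_rec (k : ℕ) : b (k + 1) =
    ∑ j ∈ Finset.range (k + 1), k.choose j * 2 ^ (k - j) * b ((j + 1) / 2) := by
  have h1 : b (k + 1) = ∑ n ∈ Finset.range (k + 1), xfun (n + 1) (k + 1) := by
    unfold b
    rw [Finset.sum_range_succ', xfun_zero_succ, add_zero]
  have h2 : ∀ n, xfun (n + 1) (k + 1)
      = ∑ j ∈ Finset.range (k + 1), (k.choose j * 2 ^ (k - j)) * yfun j n := by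
    intro n
    have := congrFun (ufun_eq_pow k) n
    simp only [two_add_pow_apply, ← yfun_eq_pow] at this
    rw [this]
    simp [Finset.sum_apply]
  rw [h1]
  simp only [h2]
  rw [Finset.sum_comm]
  refine Finset.sum_congr rfl fun j hj => ?_
  rw [← Finset.mul_sum, yfun_sum j (k + 1) (by simpa using hj)]

lemma b_zero : b 0 = 1 := by simp [b, xfun_zero_zero]

lemma b_one : b 1 = 1 := by rw [b_rec 0]; simp [b_zero]

/-! ### Part B: representation of `b` via central binomials and a Stern type sequence -/

/-- A Stern type sequence. -/
def hfun (n : ℕ) : ℕ :=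
  if _hn : n < 2 then 0
  else if n % 2 = 0 then hfun (n / 2) + (n / 2) % 2 else hfun (n / 2) + hfun (n / 2 + 1)
termination_by n
decreasing_by all_goals omega

lemma hfun_zero : hfun 0 = 0 := by rw [hfun]; simp
lemma hfun_one : hfun 1 = 0 := by rw [hfun]; simp

lemma hfun_even (m : ℕ) : hfun (2 * m) = hfun m + m % 2 := by
  rcases m with _ | m
  · simp [hfun_zero]
  · rw [hfun, dif_neg (by omega), if_pos (by omega), show 2 * (m + 1) / 2 = m + 1 by omega]

lemma hfun_odd (m : ℕ) : hfun (2 * m + 1) = hfun m + hfun (m + 1) := by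
  rcases m with _ | m
  · simp [hfun_zero, hfun_one]
  · rw [hfun, dif_neg (by omega), if_neg (by omega), show (2 * (m + 1) + 1) / 2 = m + 1 by omega]

lemma hfun_le (n : ℕ) : hfun n ≤ n := by
  induction n using Nat.strong_induction_on with
  | _ n ih =>
    by_cases h : n < 2
    · rw [hfun, dif_pos h]; omega
    · rw [hfun, dif_neg h]
      have h1 := ih (n / 2) (by omega)
      split_ifs with h2
      · omega
      · have h2 := ih (n / 2 + 1) (by omega)
        omega

/-- symmetric extension of `hfun` to the integers -/
def Hz (m : ℤ) : ℤ := (hfun m.natAbs : ℤ)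

/-- indicator of odd integers -/
def oddz (m : ℤ) : ℤ := m % 2

lemma Hz_even (m : ℤ) : Hz (2 * m) = Hz m + oddz m := by
  unfold Hz oddz
  rw [Int.natAbs_mul, show (2 : ℤ).natAbs = 2 from rfl, hfun_even]
  have h : ((m.natAbs % 2 : ℕ) : ℤ) = m % 2 := by
    rcases Int.natAbs_eq m with h | h <;> omega
  rw [Nat.cast_add, h]

lemma Hz_odd (m : ℤ) : Hz (2 * m + 1) = Hz m + Hz (m + 1) := by
  unfold Hz
  rcases le_or_gt 0 m with h | h
  · rw [show (2 * m + 1).natAbs = 2 * m.natAbs + 1 by omega, hfun_odd,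
      show (m + 1).natAbs = m.natAbs + 1 by omega]
    push_cast; rfl
  · rw [show (2 * m + 1).natAbs = 2 * (m + 1).natAbs + 1 by omega, hfun_odd,
      show m.natAbs = (m + 1).natAbs + 1 by omega]
    push_cast; ring

abbrev EndZ := Module.End ℤ (ℤ → ℤ)

/-- shift operator -/
def Sop (c : ℤ) : EndZ where
  toFun f m := f (m + c)
  map_add' _ _ := rfl
  map_smul' _ _ := rfl

/-- restriction to even integers -/
def Dop : EndZ where
  toFun f m := f (2 * m)
  map_add' _ _ := rfl
  map_smul' _ _ := rfl

def Xop : EndZ := Sop 1 + Sop (-1)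

lemma Sop_apply (c : ℤ) (f : ℤ → ℤ) (m : ℤ) : Sop c f m = f (m + c) := rfl
lemma Dop_apply (f : ℤ → ℤ) (m : ℤ) : Dop f m = f (2 * m) := rfl
lemma Xop_apply (f : ℤ → ℤ) (m : ℤ) : Xop f m = f (m + 1) + f (m + -1) := rfl
lemma two_apply (f : ℤ → ℤ) (m : ℤ) : (2 : EndZ) f m = 2 * f m := by
  rw [← one_add_one_eq_two, LinearMap.add_apply]
  simp only [Module.End.one_apply, Pi.add_apply]
  ring

lemma DX2 : Dop * (Xop * Xop) = (2 + Xop) * Dop := by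
  apply LinearMap.ext
  intro f
  funext m
  simp only [Module.End.mul_apply, LinearMap.add_apply, Pi.add_apply, two_apply, Xop_apply,
    Dop_apply]
  rw [show 2 * m + 1 + 1 = 2 * (m + 1) by ring, show 2 * m + 1 + -1 = 2 * m by ring,
    show 2 * m + -1 + 1 = 2 * m by ring, show 2 * m + -1 + -1 = 2 * (m + -1) by ring]
  ring

lemma DX2pow (i : ℕ) : Dop * Xop ^ (2 * i) = (2 + Xop) ^ i * Dop := by
  induction i with
  | zero => simp
  | succ i ih =>
    rw [show 2 * (i + 1) = 2 * i + 2 by ring, pow_add, ← mul_assoc, ih, pow_succ (2 + Xop),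
      mul_assoc, mul_assoc, ← DX2, sq]

lemma D_Hz : Dop Hz = Hz + oddz := by
  funext m
  exact Hz_even m

lemma DX_Hz : Dop (Xop Hz) = (2 + Xop) Hz := by
  funext m
  simp only [LinearMap.add_apply, Pi.add_apply, two_apply, Xop_apply, Dop_apply]
  rw [Hz_odd, show 2 * m + -1 = 2 * (m + -1) + 1 by ring, Hz_odd,
    show m + -1 + 1 = m by ring]
  ring

lemma X_odd : (2 + Xop) ((Xop - 2) oddz) = 0 := by
  funext m
  simp only [LinearMap.add_apply, LinearMap.sub_apply, Pi.add_apply, Pi.sub_apply, two_apply,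
    Xop_apply, Pi.zero_apply, oddz]
  omega

/-- twice the number `b k` -/
def bp (k : ℕ) : ℤ := ((2 + Xop) ^ k) ((Xop - 2) Hz) 0

lemma bp_zero : bp 0 = 0 := by
  simp only [bp, pow_zero, Module.End.one_apply, LinearMap.sub_apply, Pi.sub_apply, two_apply,
    Xop_apply]
  simp [Hz, hfun_zero, hfun_one]

lemma comm_X (i : ℕ) : Commute ((2 + Xop) ^ i) (Xop - 2) := by
  apply Commute.pow_left
  have h : Commute Xop (2 : EndZ) := Commute.ofNat_right _ 2
  refine Commute.sub_right ?_ ?_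
  · exact (h.symm).add_left (Commute.refl _)
  · exact (Commute.refl _).add_left h

lemma DX2' (f : ℤ → ℤ) : Dop (Xop (Xop f)) = (2 + Xop) (Dop f) := by
  have := congrArg (fun T : EndZ => T f) DX2
  simpa [Module.End.mul_apply] using this

lemma DX2pow' (i : ℕ) (f : ℤ → ℤ) : Dop ((Xop ^ (2 * i)) f) = ((2 + Xop) ^ i) (Dop f) := by
  have := congrArg (fun T : EndZ => T f) (DX2pow i)
  simpa [Module.End.mul_apply] using this

lemma four_split (f : ℤ → ℤ) : (2 + Xop) ((Xop - 2) f) = Xop (Xop f) - (4 : ℤ) • f := by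
  funext m
  simp only [LinearMap.add_apply, LinearMap.sub_apply, Pi.add_apply, Pi.sub_apply, two_apply,
    Xop_apply, Pi.smul_apply, smul_eq_mul]
  ring

lemma four_split' (f : ℤ → ℤ) : (2 + Xop) f - (4 : ℤ) • f = (Xop - 2) f := by
  funext m
  simp only [LinearMap.add_apply, LinearMap.sub_apply, Pi.add_apply, Pi.sub_apply, two_apply,
    Xop_apply, Pi.smul_apply, smul_eq_mul]
  ring

lemma gam_even (i : ℕ) : (Xop ^ (2 * i)) ((2 + Xop) ((Xop - 2) Hz)) 0
    = bp i + (if i = 0 then 2 else 0) := by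
  have h0 : ∀ f : ℤ → ℤ, f 0 = Dop f 0 := fun f => by rw [Dop_apply]; simp
  rw [h0 ((Xop ^ (2 * i)) _), DX2pow', four_split, map_sub, DX2', map_smul, four_split', D_Hz, map_add, map_add,
    Pi.add_apply]
  congr 1
  rcases i with _ | i
  · simp only [pow_zero, Module.End.one_apply, if_true, LinearMap.sub_apply, Pi.sub_apply,
      two_apply, Xop_apply, oddz]
    norm_num
  · rw [pow_succ, Module.End.mul_apply, X_odd]
    simp

lemma gam_odd (i : ℕ) : (Xop ^ (2 * i + 1)) ((2 + Xop) ((Xop - 2) Hz)) 0 = bp (i + 1) := by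
  have h0 : ∀ f : ℤ → ℤ, f 0 = Dop f 0 := fun f => by rw [Dop_apply]; simp
  rw [h0 ((Xop ^ (2 * i + 1)) _), pow_succ, Module.End.mul_apply, DX2pow', four_split, map_sub, map_sub, DX2', map_smul,
    map_smul, four_split', DX_Hz]
  unfold bp
  have hc := comm_X 1
  rw [pow_one] at hc
  have := congrArg (fun T : EndZ => T Hz) hc.eq
  simp only [Module.End.mul_apply] at this
  rw [← this, pow_succ, Module.End.mul_apply]

lemma bp_succ (k : ℕ) : bp (k + 1) = ∑ j ∈ Finset.range (k + 1),
    ((k.choose j * 2 ^ (k - j) : ℕ) : ℤ) * (Xop ^ j) ((2 + Xop) ((Xop - 2) Hz)) 0 := by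
  unfold bp
  rw [pow_succ, Module.End.mul_apply, two_add_pow_apply, Finset.sum_apply]
  refine Finset.sum_congr rfl fun j _ => ?_
  rw [Pi.smul_apply, nsmul_eq_mul]

lemma bp_eq (k : ℕ) : bp k + (if k = 0 then 2 else 0) = 2 * (b k : ℤ) := by
  induction k using Nat.strong_induction_on with
  | _ k ih =>
    rcases k with _ | k
    · rw [bp_zero, b_zero]; simp
    · rw [if_neg (by omega), add_zero, bp_succ, b_rec]
      push_cast
      rw [Finset.mul_sum]
      refine Finset.sum_congr rfl fun j hj => ?_
      rw [Finset.mem_range] at hj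
      rcases Nat.even_or_odd' j with ⟨i, rfl | rfl⟩
      · rw [gam_even, show (2 * i + 1) / 2 = i by omega, ih i (by omega)]
        ring
      · have := ih (i + 1) (by omega)
        rw [if_neg (by omega), add_zero] at this
        rw [gam_odd, show (2 * i + 1 + 1) / 2 = i + 1 by omega, this]
        ring

/-- `U K` -/
def Ufun (K : ℕ) : ℤ := ((2 + Xop) ^ K) Hz 0

lemma bp_U (k : ℕ) : bp k = Ufun (k + 1) - 4 * Ufun k := by
  unfold bp Ufun
  rw [← four_split', map_sub, map_smul, pow_succ, Module.End.mul_apply]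
  simp

lemma one_add_S_pow (n : ℕ) (f : ℤ → ℤ) (m : ℤ) : ((1 + Sop 1) ^ n) f m
    = ∑ j ∈ Finset.range (n + 1), (n.choose j : ℤ) * f (m + j) := by
  induction n generalizing m with
  | zero => simp
  | succ n ih =>
    rw [pow_succ', Module.End.mul_apply, LinearMap.add_apply, Pi.add_apply, Sop_apply,
      Module.End.one_apply, ih, ih]
    rw [Finset.sum_range_succ' _ (n + 1)]
    have hp : ∀ x : ℕ, ((n + 1).choose (x + 1) : ℤ) * f (m + ((x + 1 : ℕ) : ℤ))
        = (n.choose x : ℤ) * f (m + ((x + 1 : ℕ) : ℤ))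
          + (n.choose (x + 1) : ℤ) * f (m + ((x + 1 : ℕ) : ℤ)) := by
      intro x
      rw [Nat.choose_succ_succ']
      push_cast
      ring
    simp only [hp, Finset.sum_add_distrib]
    rw [Finset.sum_range_succ' (fun j => (n.choose j : ℤ) * f (m + j)),
      Finset.sum_range_succ (fun x => (n.choose (x + 1) : ℤ) * f (m + ((x + 1 : ℕ) : ℤ)))]
    simp only [Nat.choose_zero_right, Nat.choose_succ_self]
    have : ∀ j : ℕ, f (m + 1 + j) = f (m + ((j + 1 : ℕ) : ℤ)) := by
      intro j; congr 1; push_cast; ring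
    simp only [this]
    push_cast
    ring

lemma two_add_X : (2 + Xop : EndZ) = Sop (-1) * (1 + Sop 1) ^ 2 := by
  apply LinearMap.ext
  intro f
  funext m
  rw [Module.End.mul_apply, Sop_apply, one_add_S_pow]
  simp only [LinearMap.add_apply, Pi.add_apply, two_apply, Xop_apply, Finset.sum_range_succ,
    Finset.sum_range_zero]
  norm_num
  rw [show m + -1 + 2 = m + 1 by ring]
  ring

lemma two_add_X_pow (K : ℕ) (f : ℤ → ℤ) (m : ℤ) : ((2 + Xop) ^ K) f m
    = ∑ j ∈ Finset.range (2 * K + 1), ((2 * K).choose j : ℤ) * f (m + j - K) := by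
  have hc : Commute (Sop (-1)) ((1 + Sop 1) ^ 2) := by
    apply Commute.pow_right
    apply Commute.add_right (Commute.one_right _)
    apply LinearMap.ext
    intro f
    funext m
    simp only [Module.End.mul_apply, Sop_apply]
    congr 1
    ring
  rw [two_add_X, hc.mul_pow, ← pow_mul, Module.End.mul_apply]
  have h : ∀ (n : ℕ) (g : ℤ → ℤ) (m : ℤ), (Sop (-1) ^ n) g m = g (m - n) := by
    intro n
    induction n with
    | zero => simp
    | succ n ih =>
      intro g m
      rw [pow_succ, Module.End.mul_apply, ih, Sop_apply]
      congr 1; push_cast; ring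
  rw [h, one_add_S_pow]
  refine Finset.sum_congr rfl fun j _ => ?_
  congr 2
  ring

/-- half of `U` -/
def Bfun (K : ℕ) : ℕ := ∑ m ∈ Finset.range (K + 1), hfun m * (2 * K).choose (K + m)

lemma U_eq_B (K : ℕ) : Ufun K = 2 * (Bfun K : ℤ) := by
  unfold Ufun Bfun
  rw [two_add_X_pow, show 2 * K + 1 = K + (K + 1) by ring, Finset.sum_range_add,
    two_mul (((∑ m ∈ Finset.range (K + 1), hfun m * (2 * K).choose (K + m) : ℕ)) : ℤ)]
  congr 1
  · rw [← Finset.sum_range_reflect, Finset.sum_range_succ' _ K]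
    push_cast
    rw [hfun_zero]
    simp only [Nat.cast_zero, zero_mul, add_zero]
    refine Finset.sum_congr rfl fun j hj => ?_
    rw [Finset.mem_range] at hj
    rw [mul_comm]
    congr 1
    · unfold Hz
      congr 2
      omega
    · rw [← Nat.choose_symm (by omega)]
      congr 2
      omega
  · push_cast
    refine Finset.sum_congr rfl fun j _ => ?_
    rw [mul_comm]
    congr 1
    unfold Hz
    congr 2
    omega

theorem b_eq_B (k : ℕ) (hk : 1 ≤ k) : (b k : ℤ) = Bfun (k + 1) - 4 * Bfun k := by
  have h1 := bp_eq k
  rw [if_neg (by omega), add_zero, bp_U, U_eq_B, U_eq_B] at h1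
  linarith

/-- rescaled binomials -/
noncomputable def pfun (K m : ℕ) : ℝ := ((2 * K).choose (K + m) : ℝ) / 4 ^ K

lemma choose_rel (k m : ℕ) (hm : m ≤ k + 1) :
    ((k + 1 : ℝ) ^ 2 - m ^ 2) * ((2 * (k + 1)).choose (k + 1 + m) : ℝ)
      = (2 * k + 2) * (2 * k + 1) * ((2 * k).choose (k + m) : ℝ) := by
  have h1 := Nat.add_one_mul_choose_eq (2 * k + 1) (k + m)
  have h2 := Nat.choose_mul_succ_eq (2 * k) (k + m)
  rw [show 2 * k + 1 - (k + m) = k + 1 - m by omega] at h2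
  rw [show 2 * k + 1 + 1 = 2 * (k + 1) by ring, show k + m + 1 = k + 1 + m by ring] at h1
  have h1' : ((2 * (k + 1) : ℕ) : ℝ) * ((2 * k + 1).choose (k + m) : ℝ)
      = ((2 * (k + 1)).choose (k + 1 + m) : ℝ) * ((k + 1 + m : ℕ) : ℝ) := by exact_mod_cast h1
  have h2' : ((2 * k).choose (k + m) : ℝ) * ((2 * k + 1 : ℕ) : ℝ)
      = ((2 * k + 1).choose (k + m) : ℝ) * ((k + 1 - m : ℕ) : ℝ) := by exact_mod_cast h2
  rw [Nat.cast_sub hm] at h2'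
  push_cast at h1' h2'
  linear_combination (-(k + 1 - m : ℝ)) * h1' - (2 * k + 2 : ℝ) * h2'

theorem b_repr (k : ℕ) (hk : 1 ≤ k) : (b k : ℝ) / 4 ^ (k + 1)
    = (∑ m ∈ Finset.range (k + 2), (hfun m : ℝ) * pfun (k + 1) m * ((m : ℝ) ^ 2 - (k + 1) / 2))
      / ((k + 1) * (k + 1 / 2)) := by
  have h1 : (b k : ℝ) = Bfun (k + 1) - 4 * Bfun k := by exact_mod_cast b_eq_B k hk
  have h2 : (Bfun k : ℝ) = ∑ m ∈ Finset.range (k + 2), (hfun m : ℝ) * ((2 * k).choose (k + m) : ℝ) := by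
    rw [Finset.sum_range_succ, Nat.choose_eq_zero_of_lt (show 2 * k < k + (k + 1) by omega)]
    unfold Bfun
    push_cast
    ring
  have h3 : (Bfun (k + 1) : ℝ) = ∑ m ∈ Finset.range (k + 2),
      (hfun m : ℝ) * ((2 * (k + 1)).choose (k + 1 + m) : ℝ) := by
    unfold Bfun
    push_cast
    rfl
  rw [h1, h2, h3, Finset.mul_sum, ← Finset.sum_sub_distrib, Finset.sum_div, Finset.sum_div]
  refine Finset.sum_congr rfl fun m hm => ?_
  rw [Finset.mem_range] at hm
  have h4 := choose_rel k m (by omega)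
  unfold pfun
  field_simp
  linear_combination (2 * (hfun m : ℝ)) * h4

/-! ### Part C: local limit estimates -/

lemma pfun_nonneg (K m : ℕ) : 0 ≤ pfun K m := by unfold pfun; positivity

lemma pfun_zero_pos (K : ℕ) : 0 < pfun K 0 := by
  unfold pfun
  have : 0 < (2 * K).choose (K + 0) := Nat.choose_pos (by omega)
  positivity

lemma pfun_eq_zero (K m : ℕ) (h : K < m) : pfun K m = 0 := by
  unfold pfun
  rw [Nat.choose_eq_zero_of_lt (by omega)]
  simp

lemma pfun_succ (K m : ℕ) (h : m ≤ K) :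
    pfun K (m + 1) * (K + m + 1) = pfun K m * (K - m) := by
  unfold pfun
  have h1 := Nat.choose_succ_right_eq (2 * K) (K + m)
  rw [show 2 * K - (K + m) = K - m by omega] at h1
  have h2 : ((2 * K).choose (K + m + 1) : ℝ) * ((K + m + 1 : ℕ) : ℝ)
      = ((2 * K).choose (K + m) : ℝ) * ((K - m : ℕ) : ℝ) := by exact_mod_cast h1
  rw [Nat.cast_sub h] at h2
  push_cast at h2
  rw [← add_assoc]
  field_simp
  linear_combination h2

lemma ratio_bounds (K m : ℕ) (h : m < K) :
    (K - m : ℝ) / (K + m + 1) ≤ Real.exp (-((2 * m + 1) / (K + 1 / 2))) := by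
  have hmK : (m : ℝ) + 1 ≤ K := by exact_mod_cast h
  have hm0 : (0 : ℝ) ≤ m := Nat.cast_nonneg m
  set v : ℝ := (2 * m + 1) / (2 * K + 1) with hv
  have hv0 : 0 ≤ v := by positivity
  have hv1 : v < 1 := by rw [hv, div_lt_one (by positivity)]; linarith
  have h1 := Real.sum_range_le_log_div hv0 hv1 1
  simp only [Finset.range_one, Finset.sum_singleton, mul_zero, zero_add, pow_one, Nat.cast_zero,
    div_one] at h1
  have h2 : (K - m : ℝ) / (K + m + 1) = ((1 + v) / (1 - v))⁻¹ := by
    have : (2 * K + 1 : ℝ) ≠ 0 := by positivity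
    have h3 : 1 - v = (2 * K - 2 * m) / (2 * K + 1) := by rw [hv]; field_simp; ring
    have h4 : 1 + v = (2 * K + 2 * m + 2) / (2 * K + 1) := by rw [hv]; field_simp; ring
    have h5 : (K - m : ℝ) ≠ 0 := by linarith
    have h6 : (2 * K - 2 * m : ℝ) ≠ 0 := by linarith
    rw [h3, h4]
    field_simp
  have hpos : 0 < (1 + v) / (1 - v) := by
    apply div_pos <;> linarith
  rw [h2, ← Real.exp_log hpos, ← Real.exp_neg]
  apply Real.exp_le_exp.mpr
  have h7 : (2 * m + 1 : ℝ) / (K + 1 / 2) = 2 * v := by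
    rw [hv]; field_simp
  rw [h7]
  linarith

lemma ratio_bounds' (K m : ℕ) (h : 2 * (m + 1) ≤ K) :
    Real.exp (-((2 * m + 1) / (K + 1 / 2)) - ((m + 1) ^ 4 - m ^ 4) / K ^ 3)
      ≤ (K - m : ℝ) / (K + m + 1) := by
  have hmK : 2 * ((m : ℝ) + 1) ≤ K := by exact_mod_cast h
  have hm0 : (0 : ℝ) ≤ m := Nat.cast_nonneg m
  have hK0 : (0 : ℝ) < K := by linarith
  set v : ℝ := (2 * m + 1) / (2 * K + 1) with hv
  have hv0 : 0 ≤ v := by positivity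
  have hv1 : v ≤ 1 / 2 := by rw [hv, div_le_iff₀ (by positivity)]; linarith
  have h1 := Real.log_div_le_sum_range_add hv0 (by linarith) 1
  simp only [Finset.range_one, Finset.sum_singleton, mul_zero, zero_add, pow_one, Nat.cast_zero,
    div_one, mul_one] at h1
  have h2 : (K - m : ℝ) / (K + m + 1) = ((1 + v) / (1 - v))⁻¹ := by
    have : (2 * K + 1 : ℝ) ≠ 0 := by positivity
    have h3 : 1 - v = (2 * K - 2 * m) / (2 * K + 1) := by rw [hv]; field_simp; ring
    have h4 : 1 + v = (2 * K + 2 * m + 2) / (2 * K + 1) := by rw [hv]; field_simp; ring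
    have h5 : (K - m : ℝ) ≠ 0 := by linarith
    have h6 : (2 * K - 2 * m : ℝ) ≠ 0 := by linarith
    rw [h3, h4]
    field_simp
  have hpos : 0 < (1 + v) / (1 - v) := by
    apply div_pos <;> linarith
  rw [h2, ← Real.exp_log hpos, ← Real.exp_neg]
  apply Real.exp_le_exp.mpr
  have h7 : (2 * m + 1 : ℝ) / (K + 1 / 2) = 2 * v := by
    rw [hv]; field_simp
  rw [h7]
  have h8 : v ^ (2 + 1) / (1 - v ^ 2) ≤ (4 / 3) * v ^ 3 := by
    rw [div_le_iff₀ (by nlinarith)]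
    have h81 : v ^ 2 ≤ 1 / 4 := by nlinarith
    have h82 : 0 ≤ v ^ 3 * (1 / 4 - v ^ 2) := mul_nonneg (by positivity) (by linarith)
    have h83 : v ^ (2 + 1) = v ^ 3 := rfl
    linarith
  have h9 : v ^ 3 ≤ (2 * m + 1) ^ 3 / (8 * K ^ 3) := by
    have : v ≤ (2 * m + 1) / (2 * K) := by
      rw [hv]
      apply div_le_div_of_nonneg_left <;> linarith
    calc v ^ 3 ≤ ((2 * m + 1) / (2 * K)) ^ 3 := by gcongr
      _ = _ := by rw [div_pow, mul_pow]; norm_num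
  have h10 : (8 / 3 : ℝ) * ((2 * m + 1) ^ 3 / (8 * K ^ 3)) ≤ ((m + 1) ^ 4 - m ^ 4) / K ^ 3 := by
    rw [show (8 / 3 : ℝ) * ((2 * m + 1) ^ 3 / (8 * K ^ 3)) = ((2 * m + 1) ^ 3 / 3) / K ^ 3 by
      field_simp]
    gcongr
    have : 0 ≤ (m : ℝ) ^ 2 := by positivity
    have : 0 ≤ (m : ℝ) ^ 3 := by positivity
    nlinarith
  linarith

lemma pfun_upper (K m : ℕ) (h : m ≤ K) :
    pfun K m ≤ pfun K 0 * Real.exp (-(m ^ 2 / (K + 1 / 2))) := by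
  induction m with
  | zero => simp
  | succ m ih =>
    have h1 := pfun_succ K m (by omega)
    have h2 := ratio_bounds K m (by omega)
    have h3 : pfun K (m + 1) = pfun K m * ((K - m : ℝ) / (K + m + 1)) := by
      field_simp
      linear_combination h1
    have h4 : Real.exp (-(((m + 1 : ℕ) : ℝ) ^ 2 / (K + 1 / 2)))
        = Real.exp (-(m ^ 2 / (K + 1 / 2))) * Real.exp (-((2 * m + 1) / (K + 1 / 2))) := by
      rw [← Real.exp_add]
      congr 1
      push_cast
      ring
    rw [h3, h4, ← mul_assoc]
    have h5 : (0 : ℝ) ≤ (K - m : ℝ) / (K + m + 1) := by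
      have : (m : ℝ) + 1 ≤ K := by exact_mod_cast h
      apply div_nonneg <;> linarith
    have := pfun_nonneg K 0
    exact mul_le_mul (ih (by omega)) h2 h5 (by positivity)

lemma pfun_lower (K m : ℕ) (h : 2 * m ≤ K) :
    pfun K 0 * Real.exp (-(m ^ 2 / (K + 1 / 2)) - m ^ 4 / K ^ 3) ≤ pfun K m := by
  induction m with
  | zero => simp
  | succ m ih =>
    have h1 := pfun_succ K m (by omega)
    have h2 := ratio_bounds' K m h
    have h3 : pfun K (m + 1) = pfun K m * ((K - m : ℝ) / (K + m + 1)) := by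
      field_simp
      linear_combination h1
    have h4 : Real.exp (-(((m + 1 : ℕ) : ℝ) ^ 2 / (K + 1 / 2)) - ((m + 1 : ℕ) : ℝ) ^ 4 / K ^ 3)
        = Real.exp (-(m ^ 2 / (K + 1 / 2)) - m ^ 4 / K ^ 3)
          * Real.exp (-((2 * m + 1) / (K + 1 / 2)) - ((m + 1) ^ 4 - m ^ 4) / K ^ 3) := by
      rw [← Real.exp_add]
      congr 1
      push_cast
      ring
    rw [h3, h4, ← mul_assoc]
    exact mul_le_mul (ih (by omega)) h2 (Real.exp_nonneg _) (pfun_nonneg _ _)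

lemma lclt (K m : ℕ) (hK : 1 ≤ K) :
    |pfun K m - pfun K 0 * Real.exp (-(m ^ 2 / (K + 1 / 2)))|
      ≤ pfun K 0 * Real.exp (-(m ^ 2 / (K + 1 / 2))) * (16 * m ^ 4 / K ^ 3) := by
  have hp := pfun_zero_pos K
  have hK' : (1 : ℝ) ≤ K := by exact_mod_cast hK
  set E := Real.exp (-((m : ℝ) ^ 2 / (K + 1 / 2))) with hE
  have hE0 : 0 < E := Real.exp_pos _
  have hup : pfun K m ≤ pfun K 0 * E := by
    rcases le_or_gt m K with h | h
    · exact pfun_upper K m h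
    · rw [pfun_eq_zero K m h]; positivity
  rw [abs_sub_comm, abs_of_nonneg (by linarith)]
  rcases le_or_gt (2 * m) K with h | h
  · have hlow := pfun_lower K m h
    rw [sub_eq_add_neg, Real.exp_add, ← hE] at hlow
    have h1 := Real.add_one_le_exp (-((m : ℝ) ^ 4 / K ^ 3))
    have h2 : pfun K 0 * E * (-((m : ℝ) ^ 4 / K ^ 3) + 1) ≤ pfun K m := by
      refine le_trans ?_ hlow
      rw [← mul_assoc]
      gcongr
    have h3 : (0 : ℝ) ≤ m ^ 4 / K ^ 3 := by positivity
    have h4 : 16 * (m : ℝ) ^ 4 / K ^ 3 = 16 * (m ^ 4 / K ^ 3) := by ring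
    rw [h4]
    have h5 : 0 ≤ pfun K 0 * E * (m ^ 4 / K ^ 3) := by positivity
    nlinarith
  · have h1 : (K : ℝ) ≤ 2 * m := by exact_mod_cast h.le
    have h2 : 1 ≤ 16 * (m : ℝ) ^ 4 / K ^ 3 := by
      rw [le_div_iff₀ (by positivity), one_mul]
      calc (K : ℝ) ^ 3 ≤ K ^ 4 := pow_le_pow_right₀ hK' (by norm_num)
        _ ≤ (2 * m) ^ 4 := by gcongr
        _ = _ := by ring
    have h3 : 0 ≤ pfun K 0 * E := by positivity
    have := pfun_nonneg K m
    nlinarith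

lemma gauss_bound : ∃ C : ℝ, 0 < C ∧ ∀ w : ℝ, 0 < w →
    (1 + w) ^ 5 * Real.exp (-(w / 4)) ≤ C * w ^ (-(3 / 4) : ℝ) := by
  refine ⟨720 * 4 ^ 6 * Real.exp (1 / 4), by positivity, fun w hw => ?_⟩
  have h1 := Real.pow_div_factorial_le_exp ((1 + w) / 4) (by positivity) 6
  have h2 : w ^ (3 / 4 : ℝ) ≤ 1 + w := by
    rcases le_or_gt w 1 with h | h
    · have := Real.rpow_le_one hw.le h (show (0 : ℝ) ≤ 3 / 4 by norm_num)
      linarith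
    · have := Real.rpow_le_rpow_of_exponent_le h.le (show (3 / 4 : ℝ) ≤ 1 by norm_num)
      rw [Real.rpow_one] at this
      linarith
  rw [Real.rpow_neg hw.le, ← div_eq_mul_inv, le_div_iff₀ (by positivity)]
  have h3 : Real.exp ((1 + w) / 4) = Real.exp (1 / 4) * Real.exp (w / 4) := by
    rw [← Real.exp_add]; ring_nf
  rw [h3, show (Nat.factorial 6 : ℝ) = 720 by norm_num [Nat.factorial]] at h1
  calc (1 + w) ^ 5 * Real.exp (-(w / 4)) * w ^ (3 / 4 : ℝ)
      ≤ (1 + w) ^ 5 * Real.exp (-(w / 4)) * (1 + w) := by gcongr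
    _ = (720 * 4 ^ 6 * (((1 + w) / 4) ^ 6 / 720)) * Real.exp (-(w / 4)) := by ring
    _ ≤ (720 * 4 ^ 6 * (Real.exp (1 / 4) * Real.exp (w / 4))) * Real.exp (-(w / 4)) := by gcongr
    _ = 720 * 4 ^ 6 * Real.exp (1 / 4) * (Real.exp (w / 4) * Real.exp (-(w / 4))) := by ring
    _ = _ := by rw [← Real.exp_add]; simp

lemma rpow_w (m : ℕ) (σ : ℝ) (hσ : 0 < σ) :
    ((m : ℝ) ^ 2 * σ) ^ (-(3 / 4) : ℝ) = σ ^ (-(3 / 4) : ℝ) * (m : ℝ) ^ (-(3 / 2) : ℝ) := by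
  rw [Real.mul_rpow (by positivity) hσ.le, mul_comm, ← Real.rpow_natCast, ← Real.rpow_mul (by positivity)]
  norm_num

lemma summable_m : Summable fun m : ℕ => (m : ℝ) ^ (-(3 / 2) : ℝ) := by
  apply Real.summable_nat_rpow.mpr
  norm_num

/-- real version of the theta-like series -/
noncomputable def Xr (s : ℝ) : ℝ :=
  ∑' m : ℕ, (hfun m : ℝ) * (Real.exp (-(m ^ 2 * s)) * (m ^ 2 * s - 1 / 2))

lemma sqrt_w_le (w : ℝ) (hw : 0 ≤ w) : Real.sqrt w ≤ 1 + w := by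
  have h1 := Real.sq_sqrt hw
  nlinarith [sq_nonneg (Real.sqrt w - 1), Real.sqrt_nonneg w]

lemma m_le (m : ℕ) (s : ℝ) (hs : 0 < s) : (m : ℝ) ≤ (1 + m ^ 2 * s) * s ^ (-(1 / 2) : ℝ) := by
  have h1 := sqrt_w_le ((m : ℝ) ^ 2 * s) (by positivity)
  rw [Real.sqrt_mul (by positivity), Real.sqrt_sq (by positivity)] at h1
  rw [Real.rpow_neg hs.le, ← Real.sqrt_eq_rpow, ← div_eq_mul_inv, le_div_iff₀ (by positivity)]
  exact h1

lemma hfun_zero_real : (hfun 0 : ℝ) = 0 := by rw [hfun_zero]; simp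

lemma exp_w_le (w : ℝ) (hw : 0 ≤ w) : Real.exp (-w) ≤ Real.exp (-(w / 4)) :=
  Real.exp_le_exp.mpr (by linarith)

lemma term_bound : ∃ C : ℝ, 0 < C ∧ ∀ s : ℝ, 0 < s → ∀ m : ℕ,
    (hfun m : ℝ) * (Real.exp (-(m ^ 2 * s)) * (1 + m ^ 2 * s) ^ 4)
      ≤ C * s ^ (-(5 / 4) : ℝ) * (m : ℝ) ^ (-(3 / 2) : ℝ) := by
  obtain ⟨C, hC, h⟩ := gauss_bound
  refine ⟨C, hC, fun s hs m => ?_⟩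
  rcases Nat.eq_zero_or_pos m with rfl | hm
  · rw [hfun_zero_real]
    simp only [zero_mul]
    positivity
  · have hm' : (0 : ℝ) < m := by exact_mod_cast hm
    have h1 : (hfun m : ℝ) ≤ m := by exact_mod_cast hfun_le m
    have h2 := m_le m s hs
    have h3 := h (m ^ 2 * s) (by positivity)
    rw [rpow_w m s hs] at h3
    have h4 := exp_w_le (m ^ 2 * s) (by positivity)
    calc (hfun m : ℝ) * (Real.exp (-(m ^ 2 * s)) * (1 + m ^ 2 * s) ^ 4)
        ≤ ((1 + m ^ 2 * s) * s ^ (-(1 / 2) : ℝ)) *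
          (Real.exp (-(m ^ 2 * s / 4)) * (1 + m ^ 2 * s) ^ 4) := by
          gcongr
          exact h1.trans h2
      _ = s ^ (-(1 / 2) : ℝ) * ((1 + m ^ 2 * s) ^ 5 * Real.exp (-(m ^ 2 * s / 4))) := by ring
      _ ≤ s ^ (-(1 / 2) : ℝ) * (C * (s ^ (-(3 / 4) : ℝ) * (m : ℝ) ^ (-(3 / 2) : ℝ))) := by gcongr
      _ = C * (s ^ (-(1 / 2) : ℝ) * s ^ (-(3 / 4) : ℝ)) * (m : ℝ) ^ (-(3 / 2) : ℝ) := by ring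
      _ = _ := by rw [← Real.rpow_add hs]; norm_num

lemma abs_w_le (w : ℝ) (hw : 0 ≤ w) : |w - 1 / 2| ≤ (1 + w) ^ 4 := by
  have h : 1 + w ≤ (1 + w) ^ 4 := by
    calc 1 + w = (1 + w) ^ 1 := (pow_one _).symm
      _ ≤ (1 + w) ^ 4 := pow_le_pow_right₀ (by linarith) (by norm_num)
  rw [abs_le]
  constructor <;> linarith

lemma Xr_summable (s : ℝ) (hs : 0 < s) :
    Summable fun m : ℕ => (hfun m : ℝ) * (Real.exp (-(m ^ 2 * s)) * (m ^ 2 * s - 1 / 2)) := by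
  obtain ⟨C, hC, h⟩ := term_bound
  refine Summable.of_norm_bounded (summable_m.mul_left (C * s ^ (-(5 / 4) : ℝ))) fun m => ?_
  refine le_trans ?_ (h s hs m)
  rw [norm_mul, norm_mul, Real.norm_of_nonneg (Nat.cast_nonneg _),
    Real.norm_of_nonneg (Real.exp_nonneg _)]
  have := abs_w_le ((m : ℝ) ^ 2 * s) (by positivity)
  gcongr
  exact this

theorem main_kernel : ∃ C : ℝ, 0 < C ∧ ∀ K : ℕ, 1 ≤ K →
    |∑ m ∈ Finset.range (K + 1), (hfun m : ℝ) * pfun K m * ((m : ℝ) ^ 2 - K / 2)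
      - pfun K 0 * ((K + 1 / 2) * Xr (1 / (K + 1 / 2)))|
      ≤ C * pfun K 0 * ((K : ℝ) + 1 / 2) ^ (5 / 4 : ℝ) := by
  obtain ⟨C, hC, h⟩ := term_bound
  refine ⟨55 * C * ∑' m : ℕ, (m : ℝ) ^ (-(3 / 2) : ℝ) + 1, ?_, fun K hK => ?_⟩
  · have : 0 ≤ ∑' m : ℕ, (m : ℝ) ^ (-(3 / 2) : ℝ) := tsum_nonneg fun m => by positivity
    positivity
  have hK' : (1 : ℝ) ≤ K := by exact_mod_cast hK
  set T : ℝ := K + 1 / 2 with hT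
  have hT0 : 0 < T := by positivity
  set s : ℝ := 1 / T with hs
  have hs0 : 0 < s := by positivity
  have hTs : T * s = 1 := by rw [hs]; field_simp
  have hp := pfun_zero_pos K
  have e1 : ∑ m ∈ Finset.range (K + 1), (hfun m : ℝ) * pfun K m * ((m : ℝ) ^ 2 - K / 2)
      = ∑' m : ℕ, (hfun m : ℝ) * pfun K m * ((m : ℝ) ^ 2 - K / 2) := by
    rw [tsum_eq_sum]
    intro m hm
    rw [Finset.mem_range] at hm
    rw [pfun_eq_zero K m (by omega)]
    ring
  have s1 : Summable fun m : ℕ => (hfun m : ℝ) * pfun K m * ((m : ℝ) ^ 2 - K / 2) := by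
    apply summable_of_ne_finset_zero (s := Finset.range (K + 1))
    intro m hm
    rw [Finset.mem_range] at hm
    rw [pfun_eq_zero K m (by omega)]
    ring
  have s2 := (Xr_summable s hs0).mul_left (pfun K 0 * T)
  rw [e1, ← mul_assoc, Xr, ← tsum_mul_left, ← s1.tsum_sub s2, ← Real.norm_eq_abs]
  have hterm : ∀ m : ℕ, ‖(hfun m : ℝ) * pfun K m * ((m : ℝ) ^ 2 - K / 2) - pfun K 0 * T *
      ((hfun m : ℝ) * (Real.exp (-(m ^ 2 * s)) * (m ^ 2 * s - 1 / 2)))‖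
      ≤ (55 * C * pfun K 0 * T ^ (5 / 4 : ℝ)) * (m : ℝ) ^ (-(3 / 2) : ℝ) := by
    intro m
    have hl := lclt K m hK
    rw [← hT] at hl
    have hws : (m : ℝ) ^ 2 / T = m ^ 2 * s := by rw [hs]; ring
    rw [hws] at hl
    have ht := h s hs0 m
    have hsT : s ^ (-(5 / 4) : ℝ) = T ^ (5 / 4 : ℝ) := by
      rw [hs, one_div, Real.inv_rpow hT0.le, Real.rpow_neg hT0.le, inv_inv]
    rw [hsT] at ht
    set E := Real.exp (-((m : ℝ) ^ 2 * s)) with hE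
    have hE0 : 0 < E := Real.exp_pos _
    set w : ℝ := (m : ℝ) ^ 2 * s with hw
    have hw0 : 0 ≤ w := by positivity
    have e2 : (hfun m : ℝ) * pfun K m * ((m : ℝ) ^ 2 - K / 2) - pfun K 0 * T *
      ((hfun m : ℝ) * (E * (w - 1 / 2)))
      = (hfun m : ℝ) * ((pfun K m - pfun K 0 * E) * ((m : ℝ) ^ 2 - K / 2) + pfun K 0 * E / 4) := by
      have : T * w = (m : ℝ) ^ 2 := by rw [hw]; linear_combination (m : ℝ) ^ 2 * hTs
      have hKT : (K : ℝ) = T - 1 / 2 := by rw [hT]; ring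
      rw [hKT]
      linear_combination (-(pfun K 0 * hfun m * E)) * this
    rw [e2, norm_mul, Real.norm_of_nonneg (Nat.cast_nonneg _)]
    have hb : ‖(pfun K m - pfun K 0 * E) * ((m : ℝ) ^ 2 - K / 2) + pfun K 0 * E / 4‖
        ≤ 55 * pfun K 0 * (E * (1 + w) ^ 4) := by
      have hq : |(m : ℝ) ^ 2 - K / 2| ≤ m ^ 2 + T := by
        rw [abs_le]
        have : (0 : ℝ) ≤ (m : ℝ) ^ 2 := by positivity
        constructor <;> rw [hT] <;> linarith
      have hk3 : 16 * (m : ℝ) ^ 4 / K ^ 3 * (m ^ 2 + T) ≤ 54 * (w ^ 3 + w ^ 2) := by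
        have h1 : (1 : ℝ) / K ≤ 3 / 2 * s := by
          rw [hs, div_le_iff₀ (by positivity)]
          have : T ≤ 3 / 2 * K := by rw [hT]; linarith
          field_simp
          linarith
        have h2 : ((1 : ℝ) / K) ^ 3 ≤ (3 / 2 * s) ^ 3 := by gcongr
        calc 16 * (m : ℝ) ^ 4 / K ^ 3 * (m ^ 2 + T)
            = 16 * (m : ℝ) ^ 4 * (m ^ 2 + T) * (1 / K) ^ 3 := by ring
          _ ≤ 16 * (m : ℝ) ^ 4 * (m ^ 2 + T) * (3 / 2 * s) ^ 3 := by gcongr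
          _ = 54 * (w ^ 3 + w ^ 2 * (T * s)) := by rw [hw]; ring
          _ = _ := by rw [hTs]; ring
      have h5 : w ^ 3 + w ^ 2 ≤ (1 + w) ^ 4 := by
        have : 0 ≤ w ^ 2 := by positivity
        have : 0 ≤ w ^ 3 := by positivity
        have : 0 ≤ w ^ 4 := by positivity
        nlinarith
      have h6 : 1 ≤ (1 + w) ^ 4 := one_le_pow₀ (by linarith)
      calc ‖(pfun K m - pfun K 0 * E) * ((m : ℝ) ^ 2 - K / 2) + pfun K 0 * E / 4‖
          ≤ |pfun K m - pfun K 0 * E| * |(m : ℝ) ^ 2 - K / 2| + pfun K 0 * E / 4 := by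
            refine (norm_add_le _ _).trans ?_
            rw [norm_mul, Real.norm_eq_abs, Real.norm_eq_abs,
              Real.norm_of_nonneg (show 0 ≤ pfun K 0 * E / 4 by positivity)]
        _ ≤ (pfun K 0 * E * (16 * m ^ 4 / K ^ 3)) * (m ^ 2 + T) + pfun K 0 * E / 4 := by gcongr
        _ = pfun K 0 * E * (16 * m ^ 4 / K ^ 3 * (m ^ 2 + T)) + pfun K 0 * E / 4 := by ring
        _ ≤ pfun K 0 * E * (54 * (1 + w) ^ 4) + pfun K 0 * E * (1 + w) ^ 4 := by
            have hpE : 0 ≤ pfun K 0 * E := by positivity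
            have := mul_le_mul_of_nonneg_left (hk3.trans
              (mul_le_mul_of_nonneg_left h5 (by norm_num))) hpE
            nlinarith
        _ = _ := by ring
    calc (hfun m : ℝ) * ‖(pfun K m - pfun K 0 * E) * ((m : ℝ) ^ 2 - K / 2) + pfun K 0 * E / 4‖
        ≤ hfun m * (55 * pfun K 0 * (E * (1 + w) ^ 4)) := by gcongr
      _ = 55 * pfun K 0 * (hfun m * (E * (1 + w) ^ 4)) := by ring
      _ ≤ 55 * pfun K 0 * (C * T ^ (5 / 4 : ℝ) * (m : ℝ) ^ (-(3 / 2) : ℝ)) := by gcongr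
      _ = _ := by ring
  have hbd := tsum_of_norm_bounded
    ((summable_m.mul_left (55 * C * pfun K 0 * T ^ (5 / 4 : ℝ))).hasSum) hterm
  refine hbd.trans ?_
  rw [tsum_mul_left]
  have : 0 ≤ pfun K 0 * T ^ (5 / 4 : ℝ) := by positivity
  nlinarith


/-- the kernel -/
noncomputable def ff (x : ℝ) (s : ℂ) : ℂ :=
  Complex.exp (-((x : ℂ) ^ 2 * s)) * ((x : ℂ) ^ 2 * s - 1 / 2)

noncomputable def Xc (s : ℂ) : ℂ := ∑' m : ℕ, (hfun m : ℂ) * ff m s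

lemma Xc_ofReal (s : ℝ) : Xc (s : ℂ) = ((Xr s : ℝ) : ℂ) := by
  rw [Xc, Xr, Complex.ofReal_tsum]
  congr 1
  ext m
  simp only [ff]
  push_cast
  rfl

lemma norm_exp_x (x : ℝ) (s : ℂ) :
    ‖Complex.exp (-((x : ℂ) ^ 2 * s))‖ = Real.exp (-(x ^ 2 * s.re)) := by
  rw [Complex.norm_exp]
  congr 1
  rw [← Complex.ofReal_pow, Complex.neg_re, Complex.re_ofReal_mul]

lemma ff_bound (L : ℝ) (hL : 1 ≤ L) (s : ℂ) (hs : 0 < s.re) (hsL : ‖s‖ ≤ L * s.re)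
    (m : ℝ) (hm : 0 ≤ m) (x : ℝ) (hx1 : m / 2 ≤ x) (hx2 : x ≤ 3 * m / 2) :
    ‖ff x s‖ ≤ 3 * L * ((1 + m ^ 2 * s.re) * Real.exp (-(m ^ 2 * s.re / 4))) := by
  have h1 : m ^ 2 / 4 ≤ x ^ 2 := by nlinarith
  have h2 : x ^ 2 ≤ 9 / 4 * m ^ 2 := by nlinarith
  rw [ff, norm_mul, norm_exp_x]
  have h3 : Real.exp (-(x ^ 2 * s.re)) ≤ Real.exp (-(m ^ 2 * s.re / 4)) := by
    apply Real.exp_le_exp.mpr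
    nlinarith
  have h4 : ‖(x : ℂ) ^ 2 * s - 1 / 2‖ ≤ 3 * L * (1 + m ^ 2 * s.re) := by
    calc ‖(x : ℂ) ^ 2 * s - 1 / 2‖ ≤ ‖(x : ℂ) ^ 2 * s‖ + ‖(1 / 2 : ℂ)‖ := norm_sub_le _ _
      _ = x ^ 2 * ‖s‖ + 1 / 2 := by simp
      _ ≤ (9 / 4 * m ^ 2) * (L * s.re) + 1 / 2 := by gcongr
      _ ≤ _ := by
        have : 0 ≤ L * (m ^ 2 * s.re) := by positivity
        nlinarith
  calc _ ≤ Real.exp (-(m ^ 2 * s.re / 4)) * (3 * L * (1 + m ^ 2 * s.re)) := by gcongr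
    _ = _ := by ring

lemma ff_hasDeriv (s : ℂ) (x : ℝ) : HasDerivAt (fun x : ℝ => ff x s)
    ((x : ℂ) * s * Complex.exp (-((x : ℂ) ^ 2 * s)) * (3 - 2 * ((x : ℂ) ^ 2 * s))) x := by
  have h0 : HasDerivAt (fun x : ℝ => (x : ℂ)) 1 x := Complex.ofRealCLM.hasDerivAt
  have h1 : HasDerivAt (fun x : ℝ => (x : ℂ) ^ 2 * s) (2 * (x : ℂ) * s) x := by
    have := (h0.pow 2).mul_const s
    exact this.congr_deriv (by simp)
  have h2 := (h1.neg.cexp).mul (h1.sub_const (1 / 2 : ℂ))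
  exact h2.congr_deriv (by simp; ring)

lemma ff_diff (L : ℝ) (hL : 1 ≤ L) (s : ℂ) (hs : 0 < s.re) (hsL : ‖s‖ ≤ L * s.re)
    (m : ℝ) (hm : 1 ≤ m) (x : ℝ) (hx : |x - m| ≤ 1 / 2) :
    ‖ff x s - ff m s‖ ≤ 5 * L ^ 2 * (m * s.re) *
      ((1 + m ^ 2 * s.re) * Real.exp (-(m ^ 2 * s.re / 4))) := by
  set B := 10 * L ^ 2 * (m * s.re) *
      ((1 + m ^ 2 * s.re) * Real.exp (-(m ^ 2 * s.re / 4))) with hB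
  have hB0 : 0 ≤ B := by positivity
  have key : ∀ y ∈ Set.Icc (m - 1 / 2) (m + 1 / 2),
      ‖(y : ℂ) * s * Complex.exp (-((y : ℂ) ^ 2 * s)) * (3 - 2 * ((y : ℂ) ^ 2 * s))‖ ≤ B := by
    intro y hy
    have hy1 : m / 2 ≤ y := by linarith [hy.1]
    have hy2 : y ≤ 3 * m / 2 := by linarith [hy.2]
    have hy0 : 0 ≤ y := by linarith
    have h2 : y ^ 2 ≤ 9 / 4 * m ^ 2 := by nlinarith
    have h3 : Real.exp (-(y ^ 2 * s.re)) ≤ Real.exp (-(m ^ 2 * s.re / 4)) := by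
      apply Real.exp_le_exp.mpr
      have : m ^ 2 / 4 ≤ y ^ 2 := by nlinarith
      nlinarith
    have h4 : ‖(3 : ℂ) - 2 * ((y : ℂ) ^ 2 * s)‖ ≤ 5 * L * (1 + m ^ 2 * s.re) := by
      calc ‖(3 : ℂ) - 2 * ((y : ℂ) ^ 2 * s)‖ ≤ ‖(3 : ℂ)‖ + ‖2 * ((y : ℂ) ^ 2 * s)‖ := norm_sub_le _ _
        _ = 3 + 2 * (y ^ 2 * ‖s‖) := by simp
        _ ≤ 3 + 2 * ((9 / 4 * m ^ 2) * (L * s.re)) := by gcongr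
        _ ≤ _ := by
          have : 0 ≤ L * (m ^ 2 * s.re) := by positivity
          nlinarith
    rw [norm_mul, norm_mul, norm_mul, norm_exp_x, Complex.norm_real, Real.norm_of_nonneg hy0]
    calc y * ‖s‖ * Real.exp (-(y ^ 2 * s.re)) * ‖(3 : ℂ) - 2 * ((y : ℂ) ^ 2 * s)‖
        ≤ (3 * m / 2) * (L * s.re) * Real.exp (-(m ^ 2 * s.re / 4)) *
          (5 * L * (1 + m ^ 2 * s.re)) := by gcongr
      _ = 3 / 4 * B := by rw [hB]; ring
      _ ≤ B := by linarith
  have hx' := abs_le.mp hx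
  have := (convex_Icc (m - 1 / 2) (m + 1 / 2)).norm_image_sub_le_of_norm_hasDerivWithin_le
    (f := fun x : ℝ => ff x s) (x := m) (y := x)
    (fun y _ => (ff_hasDeriv s y).hasDerivWithinAt) key
    ⟨by linarith, by linarith⟩ ⟨by linarith, by linarith⟩
  refine this.trans ?_
  calc B * ‖x - m‖ ≤ B * (1 / 2) := by gcongr; exact hx
    _ = _ := by rw [hB]; ring

lemma one_add_pow_mono (w : ℝ) (hw : 0 ≤ w) (i : ℕ) (hi : i ≤ 5) : (1 + w) ^ i ≤ (1 + w) ^ 5 :=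
  pow_le_pow_right₀ (by linarith) hi

lemma hff_bound : ∃ C : ℝ, 0 < C ∧ ∀ L : ℝ, 1 ≤ L → ∀ s : ℂ, 0 < s.re → ‖s‖ ≤ L * s.re →
    ∀ m : ℕ, ∀ x : ℝ, |x - m| ≤ 1 / 2 →
    ‖(hfun m : ℂ) * ff x s‖ ≤ C * L * s.re ^ (-(5 / 4) : ℝ) * (m : ℝ) ^ (-(3 / 2) : ℝ) := by
  obtain ⟨C, hC, h⟩ := gauss_bound
  refine ⟨3 * C, by positivity, fun L hL s hs hsL m x hx => ?_⟩
  rcases Nat.eq_zero_or_pos m with rfl | hm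
  · rw [hfun_zero]
    simp only [Nat.cast_zero, zero_mul, norm_zero]
    positivity
  have hm' : (1 : ℝ) ≤ m := by exact_mod_cast hm
  have hx' := abs_le.mp hx
  have h1 : (hfun m : ℝ) ≤ m := by exact_mod_cast hfun_le m
  have h2 := m_le m s.re hs
  have h3 := h (m ^ 2 * s.re) (by positivity)
  rw [rpow_w m s.re hs] at h3
  have h4 := ff_bound L hL s hs hsL m (by linarith) x (by linarith) (by linarith)
  have h5 := one_add_pow_mono ((m : ℝ) ^ 2 * s.re) (by positivity) 2 (by norm_num)
  rw [norm_mul, Complex.norm_natCast]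
  calc (hfun m : ℝ) * ‖ff x s‖
      ≤ ((1 + m ^ 2 * s.re) * s.re ^ (-(1 / 2) : ℝ)) *
        (3 * L * ((1 + m ^ 2 * s.re) * Real.exp (-(m ^ 2 * s.re / 4)))) := by
        gcongr
        exact h1.trans h2
    _ = 3 * L * s.re ^ (-(1 / 2) : ℝ) * ((1 + m ^ 2 * s.re) ^ 2 * Real.exp (-(m ^ 2 * s.re / 4))) := by
        ring
    _ ≤ 3 * L * s.re ^ (-(1 / 2) : ℝ) *
          ((1 + m ^ 2 * s.re) ^ 5 * Real.exp (-(m ^ 2 * s.re / 4))) := by gcongr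
    _ ≤ 3 * L * s.re ^ (-(1 / 2) : ℝ) * (C * (s.re ^ (-(3 / 4) : ℝ) * (m : ℝ) ^ (-(3 / 2) : ℝ))) := by
        gcongr
    _ = 3 * C * L * (s.re ^ (-(1 / 2) : ℝ) * s.re ^ (-(3 / 4) : ℝ)) * (m : ℝ) ^ (-(3 / 2) : ℝ) := by
        ring
    _ = _ := by rw [← Real.rpow_add hs]; norm_num

lemma exists_L (s : ℂ) (hs : 0 < s.re) : ∃ L : ℝ, 1 ≤ L ∧ ‖s‖ < L * s.re ∧ 1 / L < s.re := by
  refine ⟨1 + ‖s‖ / s.re + 1 / s.re, ?_, ?_, ?_⟩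
  · have : 0 ≤ ‖s‖ / s.re := by positivity
    have : 0 ≤ 1 / s.re := by positivity
    linarith
  · have : (1 + ‖s‖ / s.re + 1 / s.re) * s.re = s.re + ‖s‖ + 1 := by field_simp
    rw [this]; linarith
  · have h0 : 0 ≤ ‖s‖ / s.re := by positivity
    have h1 : 0 < 1 / s.re := by positivity
    rw [div_lt_iff₀ (by positivity)]
    have : s.re * (1 + ‖s‖ / s.re + 1 / s.re) = s.re + ‖s‖ + 1 := by field_simp
    rw [this]
    have := norm_nonneg s
    linarith

lemma hff_summable (s : ℂ) (hs : 0 < s.re) (θ : ℝ) (hθ : |θ| ≤ 1 / 2) :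
    Summable fun m : ℕ => (hfun m : ℂ) * ff (m + θ) s := by
  obtain ⟨C, hC, h⟩ := hff_bound
  obtain ⟨L, hL, h1, h2⟩ := exists_L s hs
  exact Summable.of_norm_bounded (summable_m.mul_left (C * L * s.re ^ (-(5 / 4) : ℝ)))
    fun m => h L hL s hs h1.le m _ (by simpa using hθ)

lemma par_bound : ∃ C : ℝ, 0 < C ∧ ∀ L : ℝ, 1 ≤ L → ∀ s : ℂ, 0 < s.re → ‖s‖ ≤ L * s.re →
    ∀ m : ℕ, ‖((m % 2 : ℕ) : ℂ) * ff m s‖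
      ≤ C * L * s.re ^ (-(3 / 4) : ℝ) * (m : ℝ) ^ (-(3 / 2) : ℝ) := by
  obtain ⟨C, hC, h⟩ := gauss_bound
  refine ⟨3 * C, by positivity, fun L hL s hs hsL m => ?_⟩
  rcases Nat.eq_zero_or_pos m with rfl | hm
  · simp only [Nat.zero_mod, Nat.cast_zero, zero_mul, norm_zero]
    positivity
  have hm' : (1 : ℝ) ≤ m := by exact_mod_cast hm
  have h1 : ((m % 2 : ℕ) : ℝ) ≤ 1 := by
    have : m % 2 ≤ 1 := by omega
    exact_mod_cast this
  have h3 := h (m ^ 2 * s.re) (by positivity)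
  rw [rpow_w m s.re hs] at h3
  have h4 := ff_bound L hL s hs hsL m (by linarith) m (by linarith) (by linarith)
  have h5 := one_add_pow_mono ((m : ℝ) ^ 2 * s.re) (by positivity) 1 (by norm_num)
  rw [pow_one] at h5
  rw [norm_mul, Complex.norm_natCast]
  calc ((m % 2 : ℕ) : ℝ) * ‖ff m s‖
      ≤ 1 * (3 * L * ((1 + m ^ 2 * s.re) * Real.exp (-(m ^ 2 * s.re / 4)))) := by
        gcongr
    _ ≤ 1 * (3 * L * ((1 + m ^ 2 * s.re) ^ 5 * Real.exp (-(m ^ 2 * s.re / 4)))) := by gcongr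
    _ ≤ 1 * (3 * L * (C * (s.re ^ (-(3 / 4) : ℝ) * (m : ℝ) ^ (-(3 / 2) : ℝ)))) := by
        gcongr
    _ = _ := by ring

lemma par_summable (s : ℂ) (hs : 0 < s.re) :
    Summable fun m : ℕ => ((m % 2 : ℕ) : ℂ) * ff m s := by
  obtain ⟨C, hC, h⟩ := par_bound
  obtain ⟨L, hL, h1, h2⟩ := exists_L s hs
  exact Summable.of_norm_bounded (summable_m.mul_left (C * L * s.re ^ (-(3 / 4) : ℝ)))
    fun m => h L hL s hs h1.le m

lemma second_bound : ∃ C : ℝ, 0 < C ∧ ∀ L : ℝ, 1 ≤ L → ∀ s : ℂ, 0 < s.re → ‖s‖ ≤ L * s.re →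
    ∀ m : ℕ, ‖(hfun m : ℂ) * ff (m + 1 / 2) s + (hfun m : ℂ) * ff (m + (-(1 / 2))) s
        - 2 * ((hfun m : ℂ) * ff m s)‖
      ≤ C * L ^ 2 * s.re ^ (-(3 / 4) : ℝ) * (m : ℝ) ^ (-(3 / 2) : ℝ) := by
  obtain ⟨C, hC, h⟩ := gauss_bound
  refine ⟨10 * C, by positivity, fun L hL s hs hsL m => ?_⟩
  rcases Nat.eq_zero_or_pos m with rfl | hm
  · rw [hfun_zero]
    simp only [Nat.cast_zero, zero_mul, mul_zero, add_zero, sub_zero, norm_zero]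
    positivity
  have hm' : (1 : ℝ) ≤ m := by exact_mod_cast hm
  have h1 : (hfun m : ℝ) ≤ m := by exact_mod_cast hfun_le m
  have h3 := h (m ^ 2 * s.re) (by positivity)
  rw [rpow_w m s.re hs] at h3
  have h4 := ff_diff L hL s hs hsL m hm' (m + 1 / 2) (by norm_num)
  have h4' := ff_diff L hL s hs hsL m hm' (m + (-(1 / 2))) (by norm_num [abs_of_neg])
  set w := (m : ℝ) ^ 2 * s.re with hw
  have hw0 : 0 ≤ w := by positivity
  have h5 : w * (1 + w) ≤ (1 + w) ^ 5 := by
    refine le_trans ?_ (one_add_pow_mono w hw0 2 (by norm_num))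
    nlinarith
  have e : (hfun m : ℂ) * ff (m + 1 / 2) s + (hfun m : ℂ) * ff (m + (-(1 / 2))) s
        - 2 * ((hfun m : ℂ) * ff m s)
      = (hfun m : ℂ) * ((ff (m + 1 / 2) s - ff m s) + (ff (m + (-(1 / 2))) s - ff m s)) := by ring
  rw [e, norm_mul, Complex.norm_natCast]
  calc (hfun m : ℝ) * ‖(ff (m + 1 / 2) s - ff m s) + (ff (m + (-(1 / 2))) s - ff m s)‖
      ≤ m * (2 * (5 * L ^ 2 * (m * s.re) * ((1 + w) * Real.exp (-(w / 4))))) := by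
        gcongr
        refine (norm_add_le _ _).trans ?_
        linarith
    _ = 10 * L ^ 2 * (w * (1 + w) * Real.exp (-(w / 4))) := by rw [hw]; ring
    _ ≤ 10 * L ^ 2 * ((1 + w) ^ 5 * Real.exp (-(w / 4))) := by gcongr
    _ ≤ 10 * L ^ 2 * (C * (s.re ^ (-(3 / 4) : ℝ) * (m : ℝ) ^ (-(3 / 2) : ℝ))) := by gcongr
    _ = _ := by ring

lemma ff_scale (x : ℝ) (s : ℂ) : ff (2 * x) (s / 4) = ff x s := by
  simp only [ff]
  push_cast
  ring_nf

noncomputable def Rc (s : ℂ) : ℂ := Xc (s / 4) - 3 * Xc s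

lemma re_div4 (s : ℂ) : (s / 4).re = s.re / 4 := by
  rw [show (4 : ℂ) = ((4 : ℝ) : ℂ) by norm_num, Complex.div_ofReal_re]

lemma Rc_eq (s : ℂ) (hs : 0 < s.re) : Rc s = ∑' m : ℕ, (((m % 2 : ℕ) : ℂ) * ff m s +
    ((hfun m : ℂ) * ff (m + 1 / 2) s + (hfun m : ℂ) * ff (m + (-(1 / 2))) s
        - 2 * ((hfun m : ℂ) * ff m s))) := by
  have s0 : Summable fun m : ℕ => (hfun m : ℂ) * ff m s := by
    have := hff_summable s hs 0 (by norm_num)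
    simpa using this
  have s1 := hff_summable s hs (1 / 2) (by norm_num [abs_of_pos])
  have s2 := hff_summable s hs (-(1 / 2)) (by norm_num [abs_of_neg])
  have sp := par_summable s hs
  have hev : HasSum (fun m : ℕ => (hfun (2 * m) : ℂ) * ff ((2 * m : ℕ) : ℝ) (s / 4))
      (∑' m : ℕ, (hfun m : ℂ) * ff m s + ∑' m : ℕ, ((m % 2 : ℕ) : ℂ) * ff m s) := by
    convert s0.hasSum.add sp.hasSum using 1
    ext m
    rw [hfun_even]
    push_cast
    rw [ff_scale]
    ring
  have s2' : HasSum (fun m : ℕ => (hfun (m + 1) : ℂ) * ff ((m + 1 : ℕ) + (-(1 / 2))) s)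
      (∑' m : ℕ, (hfun m : ℂ) * ff (m + (-(1 / 2))) s) := by
    have := (hasSum_nat_add_iff' (f := fun m : ℕ => (hfun m : ℂ) * ff (m + (-(1 / 2))) s) 1).mpr
      s2.hasSum
    rwa [Finset.sum_range_one, hfun_zero, Nat.cast_zero, zero_mul, sub_zero] at this
  have hod : HasSum (fun m : ℕ => (hfun (2 * m + 1) : ℂ) * ff ((2 * m + 1 : ℕ) : ℝ) (s / 4))
      (∑' m : ℕ, (hfun m : ℂ) * ff (m + 1 / 2) s + ∑' m : ℕ, (hfun m : ℂ) * ff (m + (-(1 / 2))) s) := by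
    convert s1.hasSum.add s2' using 1
    ext m
    rw [hfun_odd]
    have : ((2 * m + 1 : ℕ) : ℝ) = 2 * (m + 1 / 2) := by push_cast; ring
    rw [this, ff_scale]
    have : ((m + 1 : ℕ) : ℝ) + (-(1 / 2)) = m + 1 / 2 := by push_cast; ring
    rw [this]
    push_cast
    ring
  have htot := (hev.even_add_odd (f := fun n : ℕ => (hfun n : ℂ) * ff n (s / 4)) hod).tsum_eq
  rw [Rc, Xc, htot, Xc]
  rw [sp.tsum_add ((s1.add s2).sub (s0.mul_left 2)), (s1.add s2).tsum_sub (s0.mul_left 2),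
    s1.tsum_add s2, tsum_mul_left]
  ring

lemma Rc_bound : ∃ C : ℝ, 0 < C ∧ ∀ L : ℝ, 1 ≤ L → ∀ s : ℂ, 0 < s.re → ‖s‖ ≤ L * s.re →
    ‖Rc s‖ ≤ C * L ^ 2 * s.re ^ (-(3 / 4) : ℝ) := by
  obtain ⟨C₁, hC₁, h₁⟩ := par_bound
  obtain ⟨C₂, hC₂, h₂⟩ := second_bound
  have hS : 0 ≤ ∑' m : ℕ, (m : ℝ) ^ (-(3 / 2) : ℝ) := tsum_nonneg fun m => by positivity
  refine ⟨(C₁ + C₂) * ((∑' m : ℕ, (m : ℝ) ^ (-(3 / 2) : ℝ)) + 1), by positivity,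
    fun L hL s hs hsL => ?_⟩
  rw [Rc_eq s hs]
  have := tsum_of_norm_bounded
    ((summable_m.mul_left ((C₁ + C₂) * L ^ 2 * s.re ^ (-(3 / 4) : ℝ))).hasSum)
    (f := fun m : ℕ => (((m % 2 : ℕ) : ℂ) * ff m s +
    ((hfun m : ℂ) * ff (m + 1 / 2) s + (hfun m : ℂ) * ff (m + (-(1 / 2))) s
        - 2 * ((hfun m : ℂ) * ff m s)))) (fun m => by
      refine (norm_add_le _ _).trans ?_
      have a := h₁ L hL s hs hsL m
      have b := h₂ L hL s hs hsL m
      have c : C₁ * L * s.re ^ (-(3 / 4) : ℝ) * (m : ℝ) ^ (-(3 / 2) : ℝ) ≤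
        C₁ * L ^ 2 * s.re ^ (-(3 / 4) : ℝ) * (m : ℝ) ^ (-(3 / 2) : ℝ) := by
        gcongr
        nlinarith
      linarith)
  refine this.trans ?_
  rw [tsum_mul_left]
  have : 0 ≤ (C₁ + C₂) * L ^ 2 * s.re ^ (-(3 / 4) : ℝ) := by positivity
  nlinarith


lemma ff_differentiable (x : ℝ) : Differentiable ℂ (fun s : ℂ => ff x s) := by
  unfold ff
  fun_prop

def ULset (L : ℝ) : Set ℂ := {s : ℂ | ‖s‖ < L * s.re ∧ 1 / L < s.re}

lemma ULset_open (L : ℝ) : IsOpen (ULset L) := by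
  apply IsOpen.inter
  · exact isOpen_lt continuous_norm (continuous_const.mul Complex.continuous_re)
  · exact isOpen_lt continuous_const Complex.continuous_re

lemma differentiableAt_of_UL (F : ℂ → ℂ) (h : ∀ L : ℝ, 1 ≤ L → DifferentiableOn ℂ F (ULset L))
    (s : ℂ) (hs : 0 < s.re) : DifferentiableAt ℂ F s := by
  obtain ⟨L, hL, h1, h2⟩ := exists_L s hs
  exact (h L hL).differentiableAt ((ULset_open L).mem_nhds ⟨h1, h2⟩)

lemma Xc_differentiableAt (s : ℂ) (hs : 0 < s.re) : DifferentiableAt ℂ Xc s := by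
  apply differentiableAt_of_UL _ _ s hs
  intro L hL
  obtain ⟨C, hC, h⟩ := hff_bound
  refine Complex.differentiableOn_tsum_of_summable_norm
    (u := fun m : ℕ => C * L * (1 / L) ^ (-(5 / 4) : ℝ) * (m : ℝ) ^ (-(3 / 2) : ℝ))
    (summable_m.mul_left _) (fun m => ?_) (ULset_open L) (fun m w hw => ?_)
  · exact ((ff_differentiable m).const_mul _).differentiableOn
  · have h0 : 0 < 1 / L := by positivity
    have hw0 : 0 < w.re := h0.trans hw.2
    refine (h L hL w hw0 hw.1.le m m (by simp)).trans ?_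
    have := Real.rpow_le_rpow_of_nonpos h0 hw.2.le (show (-(5 / 4) : ℝ) ≤ 0 by norm_num)
    gcongr

lemma Rc_differentiableAt (s : ℂ) (hs : 0 < s.re) : DifferentiableAt ℂ Rc s := by
  have h1 : DifferentiableAt ℂ (fun s : ℂ => Xc (s / 4)) s := by
    have h2 := Xc_differentiableAt (s / 4) (by rw [re_div4]; positivity)
    have h3 : DifferentiableAt ℂ (fun s : ℂ => s / 4) s := by fun_prop
    exact DifferentiableAt.fun_comp' s h2 h3
  exact h1.sub ((Xc_differentiableAt s hs).const_mul 3)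

lemma re_div4pow (s : ℂ) (n : ℕ) : (s / 4 ^ n).re = s.re / 4 ^ n := by
  rw [show (4 : ℂ) ^ n = (((4 : ℝ) ^ n : ℝ) : ℂ) by push_cast; rfl, Complex.div_ofReal_re]

noncomputable def qq : ℝ := (4 : ℝ) ^ (3 / 4 : ℝ) / 3

lemma qq_pos : 0 < qq := by unfold qq; positivity

lemma qq_lt_one : qq < 1 := by
  rw [qq, div_lt_one (by norm_num)]
  have h : ((4 : ℝ) ^ (3 / 4 : ℝ)) ^ 4 = 64 := by
    rw [← Real.rpow_natCast, ← Real.rpow_mul (by norm_num)]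
    norm_num
  by_contra hc
  push Not at hc
  have : (3 : ℝ) ^ 4 ≤ ((4 : ℝ) ^ (3 / 4 : ℝ)) ^ 4 := by gcongr
  rw [h] at this
  norm_num at this

noncomputable def Sterm (n : ℕ) (s : ℂ) : ℂ := (3⁻¹ : ℂ) ^ (n + 1) * Rc (s / 4 ^ n)

lemma Sterm_bound : ∃ C : ℝ, 0 < C ∧ ∀ L : ℝ, 1 ≤ L → ∀ s : ℂ, 0 < s.re → ‖s‖ ≤ L * s.re →
    ∀ n : ℕ, ‖Sterm n s‖ ≤ C * L ^ 2 * s.re ^ (-(3 / 4) : ℝ) * qq ^ n := by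
  obtain ⟨C, hC, h⟩ := Rc_bound
  refine ⟨C, hC, fun L hL s hs hsL n => ?_⟩
  have h1 := h L hL (s / 4 ^ n) (by rw [re_div4pow]; positivity) (by
    rw [re_div4pow, norm_div, norm_pow, ← mul_div_assoc]
    simp only [Complex.norm_ofNat]
    gcongr)
  rw [re_div4pow] at h1
  have h2 : (s.re / 4 ^ n) ^ (-(3 / 4) : ℝ) = s.re ^ (-(3 / 4) : ℝ) * ((4 : ℝ) ^ (3 / 4 : ℝ)) ^ n := by
    rw [Real.div_rpow hs.le (by positivity), Real.rpow_neg (x := (4 : ℝ) ^ n) (by positivity),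
      div_inv_eq_mul, ← Real.rpow_natCast, ← Real.rpow_natCast, ← Real.rpow_mul (by norm_num),
      ← Real.rpow_mul (by norm_num), mul_comm (n : ℝ)]
  rw [h2] at h1
  rw [Sterm, norm_mul, norm_pow, norm_inv]
  simp only [Complex.norm_ofNat]
  rw [qq, div_pow]
  calc (3⁻¹ : ℝ) ^ (n + 1) * ‖Rc (s / 4 ^ n)‖
      ≤ (3⁻¹ : ℝ) ^ n * (C * L ^ 2 * (s.re ^ (-(3 / 4) : ℝ) * ((4 : ℝ) ^ (3 / 4 : ℝ)) ^ n)) := by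
        gcongr ?_ * ?_
        exact pow_le_pow_of_le_one (by norm_num) (by norm_num) (by omega)
    _ = _ := by
        rw [inv_pow]
        field_simp

lemma qq_summable : Summable fun n : ℕ => qq ^ n :=
  summable_geometric_of_lt_one qq_pos.le qq_lt_one

lemma Sterm_summable (s : ℂ) (hs : 0 < s.re) : Summable fun n => Sterm n s := by
  obtain ⟨C, hC, h⟩ := Sterm_bound
  obtain ⟨L, hL, h1, h2⟩ := exists_L s hs
  exact Summable.of_norm_bounded (qq_summable.mul_left (C * L ^ 2 * s.re ^ (-(3 / 4) : ℝ)))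
    fun m => h L hL s hs h1.le m

noncomputable def Xs (s : ℂ) : ℂ := Xc s + ∑' n : ℕ, Sterm n s

lemma Xs_differentiableAt (s : ℂ) (hs : 0 < s.re) : DifferentiableAt ℂ Xs s := by
  refine (Xc_differentiableAt s hs).add ?_
  apply differentiableAt_of_UL _ _ s hs
  intro L hL
  obtain ⟨C, hC, h⟩ := Sterm_bound
  refine Complex.differentiableOn_tsum_of_summable_norm
    (u := fun n : ℕ => C * L ^ 2 * (1 / L) ^ (-(3 / 4) : ℝ) * qq ^ n)
    (qq_summable.mul_left _) (fun n => ?_) (ULset_open L) (fun n w hw => ?_)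
  · intro w hw
    have h0 : 0 < 1 / L := by positivity
    have hw0 : 0 < w.re := h0.trans hw.2
    have h2 := Rc_differentiableAt (w / 4 ^ n) (by rw [re_div4pow]; positivity)
    have h4 : DifferentiableAt ℂ (fun s : ℂ => s / 4 ^ n) w := by fun_prop
    have h3 : DifferentiableAt ℂ (fun s : ℂ => Rc (s / 4 ^ n)) w :=
      DifferentiableAt.fun_comp' w h2 h4
    exact (h3.const_mul _).differentiableWithinAt
  · have h0 : 0 < 1 / L := by positivity
    have hw0 : 0 < w.re := h0.trans hw.2
    refine (h L hL w hw0 hw.1.le n).trans ?_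
    have := Real.rpow_le_rpow_of_nonpos h0 hw.2.le (show (-(3 / 4) : ℝ) ≤ 0 by norm_num)
    have := qq_pos
    gcongr

lemma Xs_scale (s : ℂ) (hs : 0 < s.re) : Xs (s / 4) = 3 * Xs s := by
  have h1 := (Sterm_summable s hs).tsum_eq_zero_add
  have h2 : ∀ n, Sterm (n + 1) s = 3⁻¹ * Sterm n (s / 4) := by
    intro n
    simp only [Sterm]
    rw [show s / 4 ^ (n + 1) = s / 4 / 4 ^ n by rw [pow_succ]; field_simp]
    ring
  simp only [h2] at h1
  rw [tsum_mul_left] at h1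
  have h3 : Sterm 0 s = 3⁻¹ * Rc s := by simp [Sterm]
  rw [Xs, Xs, h1, h3, Rc]
  ring

lemma Xs_sub_Xc : ∃ C : ℝ, 0 < C ∧ ∀ s : ℝ, 0 < s →
    |(Xs s).re - Xr s| ≤ C * s ^ (-(3 / 4) : ℝ) := by
  obtain ⟨C, hC, h⟩ := Sterm_bound
  have hS : 0 ≤ ∑' n : ℕ, qq ^ n := tsum_nonneg fun m => pow_nonneg qq_pos.le _
  refine ⟨C * (∑' n : ℕ, qq ^ n) + 1, by positivity, fun s hs => ?_⟩
  have h1 := tsum_of_norm_bounded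
    ((qq_summable.mul_left (C * 1 ^ 2 * s ^ (-(3 / 4) : ℝ))).hasSum)
    (fun n => h 1 le_rfl (s : ℂ) (by simpa using hs) (by simp [abs_of_pos hs]) n)
  have h2 : (Xs s).re - Xr s = (∑' n : ℕ, Sterm n (s : ℂ)).re := by
    rw [Xs, Xc_ofReal]
    simp
  rw [h2]
  refine (Complex.abs_re_le_norm _).trans (h1.trans ?_)
  rw [tsum_mul_left]
  have : 0 ≤ s ^ (-(3 / 4) : ℝ) := by positivity
  nlinarith

/-- exponent -/
noncomputable def αα : ℝ := Real.log 3 / (2 * Real.log 2)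

lemma four_rpow_α : (4 : ℝ) ^ αα = 3 := by
  have h2 : 0 < Real.log 2 := Real.log_pos (by norm_num)
  rw [Real.rpow_def_of_pos (by norm_num), show (4 : ℝ) = 2 ^ 2 by norm_num, Real.log_pow, αα]
  rw [show ((2 : ℕ) : ℝ) * Real.log 2 * (Real.log 3 / (2 * Real.log 2)) = Real.log 3 by
    push_cast; field_simp]
  exact Real.exp_log (by norm_num)

lemma αα_gt : 3 / 4 < αα := by
  have h : (4 : ℝ) ^ (3 / 4 : ℝ) < 4 ^ αα := by
    rw [four_rpow_α]
    have := qq_lt_one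
    rwa [qq, div_lt_one (by norm_num)] at this
  exact (Real.rpow_lt_rpow_left_iff (by norm_num)).mp h

lemma αα_lt : αα < 1 := by
  have h : (4 : ℝ) ^ αα < 4 ^ (1 : ℝ) := by
    rw [four_rpow_α]; norm_num
  exact (Real.rpow_lt_rpow_left_iff (by norm_num)).mp h

noncomputable def om0 (y : ℝ) : ℝ := (Xs ((1 / y : ℝ) : ℂ)).re * y ^ (-αα)

lemma om0_scale (y : ℝ) (hy : 0 < y) : om0 (4 * y) = om0 y := by
  have h1 : ((1 / (4 * y) : ℝ) : ℂ) = ((1 / y : ℝ) : ℂ) / 4 := by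
    push_cast
    have : (y : ℂ) ≠ 0 := by exact_mod_cast hy.ne'
    field_simp
  rw [om0, h1, Xs_scale _ (by simpa using hy), om0, Real.mul_rpow (by norm_num) hy.le,
    Real.rpow_neg (by norm_num), four_rpow_α]
  rw [show (3 * Xs ((1 / y : ℝ) : ℂ)).re = 3 * (Xs ((1 / y : ℝ) : ℂ)).re by
    rw [show (3 : ℂ) = ((3 : ℝ) : ℂ) by norm_num, Complex.re_ofReal_mul]]
  ring

lemma om0_smooth : ContDiffOn ℝ (⊤ : ℕ∞) om0 (Set.Ioi 0) := by
  have ho : IsOpen {s : ℂ | 0 < s.re} := isOpen_lt continuous_const Complex.continuous_re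
  have h1 : ContDiffOn ℂ (⊤ : ℕ∞) Xs {s : ℂ | 0 < s.re} :=
    DifferentiableOn.contDiffOn (fun s hs => (Xs_differentiableAt s hs).differentiableWithinAt) ho
  have h2 : ContDiffOn ℝ (⊤ : ℕ∞) Xs {s : ℂ | 0 < s.re} := h1.restrict_scalars ℝ
  have h3 : ContDiffOn ℝ (⊤ : ℕ∞) (fun y : ℝ => ((1 / y : ℝ) : ℂ)) (Set.Ioi 0) := by
    refine Complex.ofRealCLM.contDiff.comp_contDiffOn ?_
    exact contDiffOn_const.div contDiffOn_id fun y hy => (ne_of_gt hy)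
  have h4 : ContDiffOn ℝ (⊤ : ℕ∞) (fun y : ℝ => Xs ((1 / y : ℝ) : ℂ)) (Set.Ioi 0) :=
    h2.comp h3 fun y hy => by
      have : (0 : ℝ) < y := hy
      simpa using this
  have h5 : ContDiffOn ℝ (⊤ : ℕ∞) (fun y : ℝ => (Xs ((1 / y : ℝ) : ℂ)).re) (Set.Ioi 0) :=
    Complex.reCLM.contDiff.comp_contDiffOn h4
  refine h5.mul ?_
  exact contDiffOn_id.rpow_const_of_ne fun y hy => ne_of_gt hy


section periodic
variable (f : ℝ → ℝ)

lemma scale_pow (hs : ∀ y : ℝ, 0 < y → f (4 * y) = f y) (n : ℕ) (y : ℝ) (hy : 0 < y) :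
    f (4 ^ n * y) = f y := by
  induction n with
  | zero => simp
  | succ n ih =>
    rw [pow_succ', mul_assoc, hs _ (by positivity), ih]

lemma periodic_near (hc : ContinuousOn f (Set.Ioi 0)) (hs : ∀ y : ℝ, 0 < y → f (4 * y) = f y)
    (ε : ℝ) (hε : 0 < ε) :
    ∃ T0 : ℝ, 2 < T0 ∧ ∀ x : ℝ, T0 ≤ x → ∀ y : ℝ, |x - y| ≤ 2 → |f x - f y| < ε := by
  have hu : UniformContinuousOn f (Set.Icc (1 / 2) 6) :=
    isCompact_Icc.uniformContinuousOn_of_continuous (hc.mono fun y hy => by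
      have := hy.1
      show (0 : ℝ) < y
      linarith)
  rw [Metric.uniformContinuousOn_iff] at hu
  obtain ⟨d, hd, h⟩ := hu ε hε
  refine ⟨16 + 16 / d, by have : 0 < 16 / d := by positivity
                          linarith, fun x hx y hxy => ?_⟩
  have hd0 : 0 < 16 / d := by positivity
  obtain ⟨n, hn1, hn2⟩ := exists_nat_pow_near (show (1 : ℝ) ≤ x by linarith) (show (1 : ℝ) < 4 by norm_num)
  have hn0 : (0 : ℝ) < 4 ^ n := by positivity
  have hxd : 16 < x * d := by
    have : 16 / d < x := by linarith
    rwa [div_lt_iff₀ hd] at this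
  rw [pow_succ] at hn2
  have hxy' := abs_le.mp hxy
  have e1 : f (x / 4 ^ n) = f x := by
    rw [← scale_pow f hs n (x / 4 ^ n) (div_pos (by linarith) hn0)]
    congr 1; field_simp
  have e2 : f (y / 4 ^ n) = f y := by
    rw [← scale_pow f hs n (y / 4 ^ n) (div_pos (by linarith) hn0)]
    congr 1; field_simp
  rw [← e1, ← e2, ← Real.dist_eq]
  apply h
  · constructor
    · rw [le_div_iff₀ hn0]; linarith
    · rw [div_le_iff₀ hn0]; linarith
  · constructor
    · rw [le_div_iff₀ hn0]; linarith
    · rw [div_le_iff₀ hn0]; linarith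
  · rw [Real.dist_eq, ← sub_div, abs_div, abs_of_pos hn0, div_lt_iff₀ hn0]
    nlinarith

lemma periodic_bdd (hc : ContinuousOn f (Set.Ioi 0)) (hs : ∀ y : ℝ, 0 < y → f (4 * y) = f y) :
    ∃ M : ℝ, 0 < M ∧ ∀ y : ℝ, 1 ≤ y → |f y| ≤ M := by
  obtain ⟨M, hM⟩ := (isCompact_Icc (a := (1 : ℝ)) (b := 4)).exists_bound_of_continuousOn
    (hc.mono fun y hy => by
      have := hy.1
      show (0 : ℝ) < y
      linarith)
  refine ⟨|M| + 1, by positivity, fun y hy => ?_⟩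
  obtain ⟨n, hn1, hn2⟩ := exists_nat_pow_near hy (show (1 : ℝ) < 4 by norm_num)
  have hn0 : (0 : ℝ) < 4 ^ n := by positivity
  rw [pow_succ] at hn2
  have e1 : f (y / 4 ^ n) = f y := by
    rw [← scale_pow f hs n (y / 4 ^ n) (div_pos (by linarith) hn0)]
    congr 1; field_simp
  rw [← e1]
  have := hM (y / 4 ^ n) ⟨by rw [le_div_iff₀ hn0]; linarith, by rw [div_le_iff₀ hn0]; linarith⟩
  rw [Real.norm_eq_abs] at this
  have := le_abs_self M
  linarith

end periodic

lemma pfun_zero_sq (K : ℕ) : pfun K 0 ^ 2 * (2 * K + 1) = (Real.Wallis.W K)⁻¹ := by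
  rw [Real.Wallis.W_eq_factorial_ratio, pfun, add_zero, inv_div]
  have h := Nat.choose_mul_factorial_mul_factorial (show K ≤ 2 * K by omega)
  rw [show 2 * K - K = K by omega] at h
  have h' : ((2 * K).choose K : ℝ) * K.factorial * K.factorial = (2 * K).factorial := by exact_mod_cast h
  have hK : (K.factorial : ℝ) ≠ 0 := by exact_mod_cast K.factorial_ne_zero
  rw [← h', show (2 : ℝ) ^ (4 * K) = (4 ^ K) ^ 2 by
    rw [pow_mul, ← pow_mul (4 : ℝ) K 2, mul_comm K 2, pow_mul (4 : ℝ) 2 K]; norm_num]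
  field_simp

lemma pfun_tendsto : Tendsto (fun K : ℕ => pfun K 0 * Real.sqrt (K + 1 / 2)) atTop
    (nhds (1 / Real.sqrt π)) := by
  have h1 := Real.Wallis.tendsto_W_nhds_pi_div_two
  have h2 : Tendsto (fun K : ℕ => Real.sqrt ((Real.Wallis.W K)⁻¹ / 2)) atTop
      (nhds (Real.sqrt ((π / 2)⁻¹ / 2))) :=
    ((h1.inv₀ (by positivity)).div_const 2).sqrt
  have e : Real.sqrt ((π / 2)⁻¹ / 2) = 1 / Real.sqrt π := by
    rw [show (π / 2)⁻¹ / 2 = 1 / π by field_simp, Real.sqrt_div (by norm_num), Real.sqrt_one]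
  rw [e] at h2
  refine h2.congr fun K => ?_
  rw [← pfun_zero_sq, show pfun K 0 ^ 2 * (2 * K + 1) / 2 = pfun K 0 ^ 2 * (K + 1 / 2) by ring,
    Real.sqrt_mul (by positivity), Real.sqrt_sq (pfun_nonneg K 0)]

lemma δ_eq : δ = 3 / 2 - αα := rfl

noncomputable def AA (k : ℕ) : ℝ :=
  4 * (k : ℝ) ^ δ * pfun (k + 1) 0 * ((k : ℝ) + 3 / 2) ^ (1 + αα) / ((k + 1) * (k + 1 / 2))

lemma AA_eq (k : ℕ) : AA k = 4 * ((k : ℝ) / (k + 3 / 2)) ^ δ *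
    (pfun (k + 1) 0 * Real.sqrt ((k + 1 : ℕ) + 1 / 2)) *
    (((k + 3 / 2) / (k + 1)) * (((k : ℝ) + 3 / 2) / (k + 1 / 2))) := by
  have hT : (0 : ℝ) < k + 3 / 2 := by positivity
  rw [AA, Real.div_rpow (by positivity) hT.le, Real.sqrt_eq_rpow,
    show (((k + 1 : ℕ) : ℝ) + 1 / 2) = k + 3 / 2 by push_cast; ring]
  have h : ((k : ℝ) + 3 / 2) ^ (1 + αα) * (k + 3 / 2) ^ δ =
      (k + 3 / 2) ^ (1 / 2 : ℝ) * (k + 3 / 2) ^ 2 := by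
    rw [← Real.rpow_add hT, ← Real.rpow_natCast _ 2, ← Real.rpow_add hT, δ_eq]
    congr 1
    push_cast
    ring
  generalize hTT : (k : ℝ) + 3 / 2 = T at *
  have h1 : T ^ (1 + αα) = T ^ (1 / 2 : ℝ) * T ^ 2 / T ^ δ := by
    rw [eq_div_iff (by positivity), h]
  rw [h1, div_mul_div_comm T, div_eq_mul_inv _ (((k : ℝ) + 1) * (k + 1 / 2)),
    div_eq_mul_inv (T * T)]
  ring

lemma ratio_tendsto (a b : ℝ) : Tendsto (fun k : ℕ => ((k : ℝ) + a) / (k + b)) atTop (nhds 1) := by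
  have h1 : Tendsto (fun k : ℕ => 1 + (a - b) / ((k : ℝ) + b)) atTop (nhds (1 + 0)) := by
    refine tendsto_const_nhds.add (Tendsto.div_atTop tendsto_const_nhds ?_)
    exact tendsto_atTop_add_const_right _ _ tendsto_natCast_atTop_atTop
  rw [add_zero] at h1
  refine h1.congr' ?_
  filter_upwards [tendsto_natCast_atTop_atTop.eventually (eventually_gt_atTop (-b))] with k hk
  have : (k : ℝ) + b ≠ 0 := by
    have : (0 : ℝ) < k + b := by linarith
    exact this.ne'
  field_simp
  ring

lemma AA_tendsto : Tendsto AA atTop (nhds (4 / Real.sqrt π)) := by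
  have h1 : Tendsto (fun k : ℕ => ((k : ℝ) / (k + 3 / 2)) ^ δ) atTop (nhds (1 ^ δ)) := by
    have := ratio_tendsto 0 (3 / 2)
    simp only [add_zero] at this
    exact this.rpow_const (Or.inl one_ne_zero)
  rw [Real.one_rpow] at h1
  have h2 := pfun_tendsto.comp (tendsto_add_atTop_nat 1)
  have h3 := (ratio_tendsto (3 / 2) 1).mul (ratio_tendsto (3 / 2) (1 / 2))
  have h4 := ((h1.const_mul 4).mul h2).mul h3
  have e : (4 / Real.sqrt π) = 4 * 1 * (1 / Real.sqrt π) * (1 * 1) := by ring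
  rw [e]
  exact h4.congr fun k => (AA_eq k).symm

noncomputable def cc (k : ℕ) : ℝ := (b k : ℝ) / 4 ^ k * (k : ℝ) ^ δ

lemma cc_near : ∃ C : ℝ, 0 < C ∧ ∀ k : ℕ, 1 ≤ k →
    |cc k - AA k * om0 (k + 3 / 2)| ≤ C * (AA k * ((k : ℝ) + 3 / 2) ^ (3 / 4 - αα)) := by
  obtain ⟨C₁, hC₁, h₁⟩ := main_kernel
  obtain ⟨C₂, hC₂, h₂⟩ := Xs_sub_Xc
  refine ⟨C₁ + C₂, by positivity, fun k hk => ?_⟩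
  have hr := b_repr k hk
  have hm := h₁ (k + 1) (by omega)
  rw [show (((k + 1 : ℕ) : ℝ) + 1 / 2) = k + 3 / 2 by push_cast; ring] at hm
  rw [show (((k + 1 : ℕ) : ℝ) / 2) = (k + 1) / 2 by push_cast; ring] at hm
  set T : ℝ := (k : ℝ) + 3 / 2 with hT
  have hT0 : 0 < T := by positivity
  have hT1 : 1 ≤ T := by rw [hT]; have : (0 : ℝ) ≤ k := Nat.cast_nonneg k
                         linarith
  have hx := h₂ (1 / T) (by positivity)
  have hsT : (1 / T) ^ (-(3 / 4) : ℝ) = T ^ (3 / 4 : ℝ) := by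
    rw [one_div, Real.inv_rpow hT0.le, Real.rpow_neg hT0.le, inv_inv]
  rw [hsT] at hx
  have hom : (Xs ((1 / T : ℝ) : ℂ)).re = om0 T * T ^ αα := by
    rw [om0, mul_assoc, ← Real.rpow_add hT0]; simp
  rw [hom] at hx
  set p := pfun (k + 1) 0 with hp
  have hp0 : 0 < p := pfun_zero_pos _
  set S := ∑ m ∈ Finset.range (k + 2), (hfun m : ℝ) * pfun (k + 1) m * ((m : ℝ) ^ 2 - (k + 1) / 2) with hS
  have hm' : |S - p * (T * Xr (1 / T))| ≤ C₁ * p * T ^ (5 / 4 : ℝ) := hm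
  have hcc : cc k = 4 * (k : ℝ) ^ δ / ((k + 1) * (k + 1 / 2)) * S := by
    rw [cc]
    have : (b k : ℝ) / 4 ^ k = 4 * ((b k : ℝ) / 4 ^ (k + 1)) := by
      rw [pow_succ]; field_simp
    rw [this, hr]; ring
  set D : ℝ := 4 * (k : ℝ) ^ δ / ((k + 1) * (k + 1 / 2)) with hD
  have hD0 : 0 ≤ D := by positivity
  have hAA : AA k = D * p * T ^ (1 + αα) := by rw [AA, hD]; ring
  have hTa : T ^ (1 + αα) = T * T ^ αα := by rw [Real.rpow_add hT0, Real.rpow_one]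
  have e1 : cc k - AA k * om0 T = D * ((S - p * (T * Xr (1 / T))) - p * T * (om0 T * T ^ αα - Xr (1 / T))) := by
    rw [hcc, hAA, hTa]; ring
  have e2 : AA k * T ^ (3 / 4 - αα) = D * p * T ^ (7 / 4 : ℝ) := by
    rw [hAA, mul_assoc, ← Real.rpow_add hT0]; ring_nf
  rw [e1, e2, abs_mul, abs_of_nonneg hD0]
  have e3 : T ^ (7 / 4 : ℝ) = T * T ^ (3 / 4 : ℝ) := by
    rw [show (7 / 4 : ℝ) = 1 + 3 / 4 by norm_num, Real.rpow_add hT0, Real.rpow_one]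
  have e4 : T ^ (5 / 4 : ℝ) ≤ T ^ (7 / 4 : ℝ) := Real.rpow_le_rpow_of_exponent_le hT1 (by norm_num)
  have e5 : |(S - p * (T * Xr (1 / T))) - p * T * (om0 T * T ^ αα - Xr (1 / T))|
      ≤ C₁ * p * T ^ (7 / 4 : ℝ) + p * T * (C₂ * T ^ (3 / 4 : ℝ)) := by
    refine (abs_sub _ _).trans ?_
    rw [abs_mul (p * T), abs_of_nonneg (show 0 ≤ p * T by positivity)]
    gcongr
    exact hm'.trans (by gcongr)
  calc _ ≤ D * (C₁ * p * T ^ (7 / 4 : ℝ) + p * T * (C₂ * T ^ (3 / 4 : ℝ))) := by gcongr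
    _ = _ := by rw [e3]; ring

noncomputable def omega (y : ℝ) : ℝ := 4 / Real.sqrt π * om0 y

lemma omega_scale (y : ℝ) (hy : 0 < y) : omega (4 * y) = omega y := by
  rw [omega, om0_scale y hy, omega]

lemma omega_smooth : ContDiffOn ℝ (⊤ : ℕ∞) omega (Set.Ioi 0) :=
  contDiffOn_const.mul om0_smooth

lemma cc_sub_omega : Tendsto (fun k : ℕ => cc k - omega k) atTop (nhds 0) := by
  obtain ⟨C, hC, h⟩ := cc_near
  have t1 : Tendsto (fun k : ℕ => cc k - AA k * om0 (k + 3 / 2)) atTop (nhds 0) := by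
    have hlim : Tendsto (fun k : ℕ => C * (AA k * ((k : ℝ) + 3 / 2) ^ (3 / 4 - αα))) atTop
        (nhds (C * (4 / Real.sqrt π * 0))) := by
      refine (AA_tendsto.mul ?_).const_mul C
      have h1 := tendsto_rpow_neg_atTop (show 0 < αα - 3 / 4 by linarith [αα_gt])
      rw [neg_sub] at h1
      exact h1.comp (tendsto_atTop_add_const_right _ _ tendsto_natCast_atTop_atTop)
    rw [mul_zero, mul_zero] at hlim
    refine squeeze_zero_norm' ?_ hlim
    filter_upwards [eventually_ge_atTop 1] with k hk
    exact h k hk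
  have t2 : Tendsto (fun k : ℕ => (AA k - 4 / Real.sqrt π) * om0 (k + 3 / 2)) atTop (nhds 0) := by
    obtain ⟨M, hM, hb⟩ := periodic_bdd om0 om0_smooth.continuousOn om0_scale
    have : Tendsto (fun k : ℕ => |AA k - 4 / Real.sqrt π| * M) atTop (nhds 0) := by
      have := ((AA_tendsto.sub_const (4 / Real.sqrt π)).abs).mul_const M
      simpa using this
    refine squeeze_zero_norm (fun k => ?_) this
    rw [norm_mul, Real.norm_eq_abs, Real.norm_eq_abs]
    have := hb (k + 3 / 2) (by have : (0 : ℝ) ≤ k := Nat.cast_nonneg k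
                               linarith)
    gcongr
  have t3 : Tendsto (fun k : ℕ => 4 / Real.sqrt π * (om0 (k + 3 / 2) - om0 k)) atTop (nhds 0) := by
    rw [← mul_zero (4 / Real.sqrt π)]
    refine Tendsto.const_mul _ ?_
    rw [Metric.tendsto_atTop]
    intro ε hε
    obtain ⟨T0, hT0, h0⟩ := periodic_near om0 om0_smooth.continuousOn om0_scale ε hε
    refine ⟨⌈T0⌉₊, fun k hk => ?_⟩
    have hk' : T0 ≤ k := (Nat.le_ceil T0).trans (by exact_mod_cast hk)
    rw [Real.dist_eq, sub_zero]
    exact h0 _ (by linarith) _ (by norm_num [abs_of_pos])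
  have := (t1.add t2).add t3
  rw [add_zero, add_zero] at this
  refine this.congr fun k => ?_
  rw [omega]
  ring


lemma sum_choose_pow (k : ℕ) (x : ℝ) :
    ∑ j ∈ Finset.range (k + 1), (k.choose j : ℝ) * x ^ j = (1 + x) ^ k := by
  rw [add_comm 1 x, add_pow]
  refine Finset.sum_congr rfl fun j _ => ?_
  ring

lemma sum_choose_mul_pow (k : ℕ) (x : ℝ) :
    ∑ j ∈ Finset.range (k + 2), ((k + 1).choose j : ℝ) * (j * x ^ j) = (k + 1) * x * (1 + x) ^ k := by
  rw [Finset.sum_range_succ', ← sum_choose_pow, Finset.mul_sum]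
  simp only [Nat.cast_zero, zero_mul, mul_zero, add_zero]
  refine Finset.sum_congr rfl fun j _ => ?_
  have h := Nat.add_one_mul_choose_eq k j
  have h' : ((k : ℝ) + 1) * k.choose j = (k + 1).choose (j + 1) * (j + 1) := by exact_mod_cast h
  push_cast
  rw [pow_succ]
  linear_combination (-(x ^ j * x)) * h'

lemma δ_lt : δ < 3 / 4 := by rw [δ_eq]; linarith [αα_gt]
lemma δ_gt : 1 / 2 < δ := by rw [δ_eq]; linarith [αα_lt]

lemma four_rpow_δ : (4 : ℝ) ^ δ = 8 / 3 := by
  rw [δ_eq, Real.rpow_sub (by norm_num), four_rpow_α,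
    show (4 : ℝ) = 2 ^ (2 : ℝ) by norm_num, ← Real.rpow_mul (by norm_num)]
  norm_num

lemma rpow_tangent (x : ℝ) (hx : 0 < x) : 1 - δ * (x - 1) ≤ x ^ (-δ) := by
  rw [Real.rpow_def_of_pos hx]
  have h1 := Real.add_one_le_exp (Real.log x * -δ)
  have h2 := Real.log_le_sub_one_of_pos hx
  have := δ_gt
  nlinarith

lemma rpow_tangent' (x y : ℝ) (hx : 0 < x) (hy : 0 < y) :
    y ^ (-δ) * (1 - δ * (x / y - 1)) ≤ x ^ (-δ) := by
  have h := rpow_tangent (x / y) (by positivity)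
  rw [Real.div_rpow hx.le hy.le] at h
  have hp : 0 < y ^ (-δ) := by positivity
  calc y ^ (-δ) * (1 - δ * (x / y - 1)) ≤ y ^ (-δ) * (x ^ (-δ) / y ^ (-δ)) := by gcongr
    _ = _ := by field_simp

noncomputable def aa (k : ℕ) : ℝ := (b (k + 1) : ℝ) / 4 ^ k

noncomputable def gg (j : ℕ) : ℝ := (b ((j + 1) / 2) : ℝ) / 2 ^ j

lemma aa_rec (k : ℕ) : aa k * 2 ^ k = ∑ j ∈ Finset.range (k + 1), (k.choose j : ℝ) * gg j := by
  rw [aa, b_rec]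
  push_cast
  rw [Finset.sum_div, Finset.sum_mul]
  refine Finset.sum_congr rfl fun j hj => ?_
  have hjk : j ≤ k := by rw [Finset.mem_range] at hj; omega
  rw [gg, show (4 : ℝ) ^ k = 2 ^ k * 2 ^ k by rw [← mul_pow]; norm_num]
  have : (2 : ℝ) ^ k = 2 ^ (k - j) * 2 ^ j := by rw [← pow_add]; congr 1; omega
  rw [this]
  field_simp

lemma gg_zero : gg 0 = 1 := by simp [gg, b_zero]

lemma gg_odd (i : ℕ) : gg (2 * i + 1) = aa i / 2 := by
  rw [gg, aa, show (2 * i + 1 + 1) / 2 = i + 1 by omega, pow_succ, pow_mul]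
  norm_num
  ring

lemma gg_even (i : ℕ) : gg (2 * i + 2) = aa i / 4 := by
  rw [gg, aa, show (2 * i + 2 + 1) / 2 = i + 1 by omega, pow_add, pow_mul]
  norm_num
  ring

lemma aa_zero : aa 0 = 1 := by simp [aa, b_one]

lemma aa_one : aa 1 = 3 / 4 := by
  have h := aa_rec 1
  rw [Finset.sum_range_succ, Finset.sum_range_one, gg_zero] at h
  have h1 := gg_odd 0
  rw [aa_zero] at h1
  simp only [mul_zero, zero_add] at h1
  rw [h1] at h
  norm_num at h
  linarith

lemma aa_lower (k : ℕ) : 1 / 4 * ((k : ℝ) + 1 / 2) ^ (-δ) ≤ aa k := by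
  have hd1 := δ_gt
  have hd2 := δ_lt
  induction k using Nat.strong_induction_on with
  | _ k ih =>
  have h2pow : (1 / 2 : ℝ) ^ (-δ) ≤ 2 := by
    rw [one_div, Real.inv_rpow (by norm_num), Real.rpow_neg (by norm_num), inv_inv]
    calc (2 : ℝ) ^ δ ≤ 2 ^ (1 : ℝ) := Real.rpow_le_rpow_of_exponent_le (by norm_num) (by linarith)
      _ = 2 := by norm_num
  have hle2 : ∀ z : ℝ, 1 / 2 ≤ z → z ^ (-δ) ≤ 2 := fun z hz =>
    (Real.rpow_le_rpow_of_nonpos (by norm_num) hz (by linarith)).trans h2pow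
  match k, ih with
  | 0, _ =>
    rw [aa_zero]
    have := hle2 ((0 : ℕ) + 1 / 2) (by norm_num)
    linarith
  | 1, _ =>
    rw [aa_one]
    have := hle2 ((1 : ℕ) + 1 / 2) (by norm_num)
    linarith
  | n + 2, ih =>
    set κ : ℝ := ((n + 2 : ℕ) : ℝ) with hκ
    have hκn : κ = n + 2 := by rw [hκ]; push_cast; ring
    have hn0 : (0 : ℝ) ≤ n := Nat.cast_nonneg n
    set x0 : ℝ := (κ + 1 / 2) / 4 with hx0
    have hx0l : 5 / 8 ≤ x0 := by rw [hx0, hκn]; linarith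
    have hx0p : 0 < x0 := by linarith
    set P : ℝ := x0 ^ (-δ) with hP
    have hP0 : 0 < P := by positivity
    have hP2 : P ≤ 2 := hle2 x0 (by linarith)
    set B : ℝ := δ / x0 with hB
    have hB0 : 0 < B := by positivity
    have hBx : B * x0 = δ := by rw [hB]; field_simp
    set A : ℝ := 1 + δ - B / 2 with hA
    -- tangent bound
    have htan : ∀ i : ℕ, i < n + 2 → 1 / 4 * (P * (A - B * i)) ≤ aa i := by
      intro i hi
      refine le_trans ?_ (ih i hi)
      have := rpow_tangent' ((i : ℝ) + 1 / 2) x0 (by positivity) hx0p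
      have e : 1 - δ * (((i : ℝ) + 1 / 2) / x0 - 1) = A - B * i := by
        rw [hA, hB]; ring
      rw [e] at this
      gcongr
    have hg : ∀ j ∈ Finset.range (n + 2 + 1), ((n + 2).choose j : ℝ) * (1 / 4 * P *
        (A * (3 / 8 - (-1) ^ j / 8) - B * (3 * j / 16 - 1 / 4 - j * (-1) ^ j / 16)))
        ≤ ((n + 2).choose j : ℝ) * gg j := by
      intro j hj
      rw [Finset.mem_range] at hj
      refine mul_le_mul_of_nonneg_left ?_ (Nat.cast_nonneg _)
      rcases Nat.eq_zero_or_pos j with rfl | hj0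
      · rw [gg_zero]
        have hB1 : B ≤ 6 / 5 := by
          rw [hB, div_le_iff₀ hx0p]; linarith
        have : A + B ≤ 3 := by rw [hA]; linarith
        have h3 : 0 ≤ A + B := by rw [hA]; linarith
        norm_num
        have h4 : P * (A + B) ≤ 2 * 3 := by gcongr
        nlinarith
      · rcases Nat.even_or_odd' j with ⟨i, rfl | rfl⟩
        · obtain ⟨i, rfl⟩ : ∃ i', i = i' + 1 := ⟨i - 1, by omega⟩
          have h := htan i (by omega)
          rw [show 2 * (i + 1) = 2 * i + 2 by ring, gg_even]
          have e : (-1 : ℝ) ^ (2 * i + 2) = 1 := by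
            rw [show 2 * i + 2 = 2 * (i + 1) by ring, pow_mul]; norm_num
          rw [e]
          push_cast
          linarith
        · have h := htan i (by omega)
          rw [gg_odd]
          have e : (-1 : ℝ) ^ (2 * i + 1) = -1 := by
            rw [pow_succ, pow_mul]; norm_num
          rw [e]
          push_cast
          linarith
    have hsum := Finset.sum_le_sum hg
    rw [← aa_rec] at hsum
    have s1 := sum_choose_pow (n + 2) 1
    have s2 := sum_choose_pow (n + 2) (-1)
    have s3 := sum_choose_mul_pow (n + 1) 1
    have s4 := sum_choose_mul_pow (n + 1) (-1)
    simp only [one_pow, mul_one] at s1 s3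
    norm_num at s2 s4
    have e : ∑ j ∈ Finset.range (n + 2 + 1), ((n + 2).choose j : ℝ) * (1 / 4 * P *
        (A * (3 / 8 - (-1) ^ j / 8) - B * (3 * j / 16 - 1 / 4 - j * (-1) ^ j / 16)))
        = 1 / 4 * P * ((A * (3 / 8) + B / 4) * ∑ j ∈ Finset.range (n + 2 + 1), ((n + 2).choose j : ℝ)
          - A / 8 * ∑ j ∈ Finset.range (n + 2 + 1), ((n + 2).choose j : ℝ) * (-1) ^ j
          - B * (3 / 16) * ∑ j ∈ Finset.range (n + 2 + 1), ((n + 2).choose j : ℝ) * j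
          + B / 16 * ∑ j ∈ Finset.range (n + 2 + 1), ((n + 2).choose j : ℝ) * (j * (-1) ^ j)) := by
      simp only [Finset.mul_sum, ← Finset.sum_add_distrib, ← Finset.sum_sub_distrib]
      refine Finset.sum_congr rfl fun j _ => ?_
      ring
    have s3' : ∑ j ∈ Finset.range (n + 2 + 1), ((n + 2).choose j : ℝ) * j = κ / 2 * 2 ^ (n + 2) := by
      have : ∑ j ∈ Finset.range (n + 2 + 1), ((n + 2).choose j : ℝ) * j
        = ((n + 1 : ℕ) + 1) * (1 + 1) ^ (n + 1) := s3
      rw [this, hκn, pow_succ 2 (n + 1)]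
      push_cast
      norm_num
      ring
    have s4' : ∑ j ∈ Finset.range (n + 2 + 1), ((n + 2).choose j : ℝ) * (j * (-1) ^ j) = 0 := s4
    have s1' : ∑ j ∈ Finset.range (n + 2 + 1), ((n + 2).choose j : ℝ) = 2 ^ (n + 2) := by
      rw [s1]; norm_num
    rw [e, s1', s3', s4', s2] at hsum
    have h2p : (0 : ℝ) < 2 ^ (n + 2) := by positivity
    have hfin : 1 / 4 * P * (A * (3 / 8) + B / 4 - B * (3 / 16) * (κ / 2)) ≤ aa (n + 2) := by
      refine le_of_mul_le_mul_right ?_ h2p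
      refine le_trans (le_of_eq ?_) hsum
      ring
    have hκx : κ = 4 * x0 - 1 / 2 := by rw [hx0]; ring
    have hPk : (κ + 1 / 2) ^ (-δ) = 3 / 8 * P := by
      rw [show κ + 1 / 2 = 4 * x0 by rw [hx0]; ring, Real.mul_rpow (by norm_num) hx0p.le,
        Real.rpow_neg (by norm_num), four_rpow_δ, hP]
      norm_num
    rw [hPk]
    refine le_trans ?_ hfin
    have h38 : 3 / 8 ≤ A * (3 / 8) + B / 4 - B * (3 / 16) * (κ / 2) := by
      rw [hκx, hA]
      nlinarith
    have := mul_le_mul_of_nonneg_left h38 (show 0 ≤ 1 / 4 * P by positivity)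
    linarith

lemma cc_lower (k : ℕ) (hk : 1 ≤ k) : 1 / 16 ≤ cc k := by
  obtain ⟨n, rfl⟩ : ∃ n, k = n + 1 := ⟨k - 1, by omega⟩
  have h := aa_lower n
  have hd1 := δ_gt
  have h1 : (((n + 1 : ℕ) : ℝ)) ^ (-δ) ≤ ((n : ℝ) + 1 / 2) ^ (-δ) :=
    Real.rpow_le_rpow_of_nonpos (by positivity) (by push_cast; linarith) (by linarith)
  have e : cc (n + 1) = aa n / 4 * ((n + 1 : ℕ) : ℝ) ^ δ := by
    rw [cc, aa, pow_succ]; field_simp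
  rw [e]
  have hp : 0 < ((n + 1 : ℕ) : ℝ) ^ δ := by positivity
  have e2 : ((n + 1 : ℕ) : ℝ) ^ (-δ) * ((n + 1 : ℕ) : ℝ) ^ δ = 1 := by
    rw [← Real.rpow_add (by positivity)]; simp
  calc (1 / 16 : ℝ) = 1 / 4 * (((n + 1 : ℕ) : ℝ) ^ (-δ)) / 4 * ((n + 1 : ℕ) : ℝ) ^ δ := by
        linear_combination (-(1 / 16)) * e2
    _ ≤ aa n / 4 * ((n + 1 : ℕ) : ℝ) ^ δ := by
        gcongr
        linarith

lemma omega_lower : ∃ N : ℕ, ∀ k : ℕ, N ≤ k → 1 / 32 ≤ omega k := by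
  have h := cc_sub_omega
  rw [Metric.tendsto_atTop] at h
  obtain ⟨N, hN⟩ := h (1 / 32) (by norm_num)
  refine ⟨N + 1, fun k hk => ?_⟩
  have h1 := hN k (by omega)
  rw [Real.dist_eq, sub_zero] at h1
  have h2 := cc_lower k (by omega)
  have h3 := (abs_lt.mp h1).2
  linarith

lemma omega_pos (y : ℝ) (hy : 0 < y) : 0 < omega y := by
  obtain ⟨N, hN⟩ := omega_lower
  obtain ⟨T0, hT0, h0⟩ := periodic_near omega omega_smooth.continuousOn omega_scale (1 / 64) (by norm_num)
  obtain ⟨n, hn⟩ := pow_unbounded_of_one_lt ((T0 + N) / y) (show (1 : ℝ) < 4 by norm_num)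
  rw [div_lt_iff₀ hy] at hn
  rw [← scale_pow omega omega_scale n y hy]
  set x : ℝ := 4 ^ n * y with hx
  have hNn : (0 : ℝ) ≤ N := Nat.cast_nonneg N
  have h1 := Nat.floor_le (show 0 ≤ x by positivity)
  have h2 := Nat.lt_floor_add_one x
  have h3 := hN ⌊x⌋₊ (Nat.le_floor (by linarith))
  have h4 := h0 x (by linarith) ⌊x⌋₊ (by rw [abs_le]; constructor <;> linarith)
  have h5 := (abs_lt.mp h4).1
  linarith

theorem main_asymptotic :
    ∃ ω : ℝ → ℝ, (∀ y : ℝ, 0 < y → 0 < ω y) ∧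
      ContDiffOn ℝ (⊤ : ℕ∞) ω (Set.Ioi 0) ∧
      (∀ y : ℝ, 0 < y → ω (4 * y) = ω y) ∧
      Tendsto (fun k : ℕ => (b k : ℝ) / (ω k * (k : ℝ) ^ (-δ) * 4 ^ k))
        atTop (nhds 1) := by
  refine ⟨omega, omega_pos, omega_smooth, omega_scale, ?_⟩
  obtain ⟨N, hN⟩ := omega_lower
  have h1 : Tendsto (fun k : ℕ => (cc k - omega k) / omega k) atTop (nhds 0) := by
    have h2 : Tendsto (fun k : ℕ => |cc k - omega k| * 32) atTop (nhds 0) := by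
      have := cc_sub_omega.abs.mul_const 32
      simpa using this
    refine squeeze_zero_norm' ?_ h2
    filter_upwards [eventually_ge_atTop N] with k hk
    have h3 := hN k hk
    have h4 : 0 < omega k := by linarith
    rw [Real.norm_eq_abs, abs_div, abs_of_pos h4, div_le_iff₀ h4]
    have := abs_nonneg (cc k - omega k)
    nlinarith
  have h5 := h1.const_add 1
  rw [add_zero] at h5
  refine h5.congr' ?_
  filter_upwards [eventually_ge_atTop N, eventually_ge_atTop 1] with k hk hk1
  have h3 := hN k hk
  have h4 : omega k ≠ 0 := by linarith
  have hk0 : (0 : ℝ) < k := by exact_mod_cast hk1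
  have hp : (0 : ℝ) < (k : ℝ) ^ δ := by positivity
  rw [cc, Real.rpow_neg hk0.le]
  field_simp
  ring
end

section
/- There exists a constant C' > 0 such that for every s ∈ ℕ, every finite non-empty set S of natural numbers all strictly greater than s, every integer n ≥ s, and every integer k with 4^n ≤ k < 4^{n+1}: |A_{{s}∪S}(k) − (1/2)·A_S(k)| ≤ C'·2^{−|S|}·2^{−(max(max S + n, 2n) + (3/5)·(n − s))}. -/
/-- Discrete convolution of functions on `ℤ`. -/
noncomputable def zconv (A B : ℤ → ℝ) : ℤ → ℝ := fun n => ∑' p : ℤ, A p * B (n - p)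

/-- Convolution of the family `A s`, `s` in a list (the empty convolution is the
Kronecker delta at `0`, the identity for convolution). -/
noncomputable def convList (A : ℕ → ℤ → ℝ) : List ℕ → ℤ → ℝ
  | [] => fun n => if n = 0 then 1 else 0
  | s :: l => zconv (A s) (convList A l)

/-- `A_S`: the convolution of the functions `A s` for `s ∈ S`. -/
noncomputable def AconvS (A : ℕ → ℤ → ℝ) (S : Finset ℕ) : ℤ → ℝ :=
  convList A (S.sort (· ≤ ·))

lemma conv_hasSum (f g : ℤ → ℝ) (a b : ℝ) (hf : ∀ k, 0 ≤ f k) (hg : ∀ k, 0 ≤ g k)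
    (ha : HasSum f a) (hb : HasSum g b) : HasSum (zconv f g) (a * b) := by
  have hs : Summable (fun x : ℤ × ℤ => f x.1 * g x.2) :=
    ha.summable.mul_of_nonneg hb.summable hf hg
  have h1 : HasSum (fun x : ℤ × ℤ => f x.1 * g x.2) (a * b) := ha.mul hb hs
  let e : ℤ × ℤ ≃ ℤ × ℤ :=
    { toFun := fun x => (x.2, x.1 - x.2)
      invFun := fun x => (x.1 + x.2, x.1)
      left_inv := fun x => by ext <;> simp
      right_inv := fun x => by ext <;> simp }
  have h2 : HasSum ((fun x : ℤ × ℤ => f x.1 * g x.2) ∘ e) (a * b) := (e.hasSum_iff).2 h1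
  exact h2.prod_fiberwise (fun n => (h2.summable.prod_factor n).hasSum)

lemma convList_nonneg (A : ℕ → ℤ → ℝ) (h0 : ∀ s k, 0 ≤ A s k) (l : List ℕ) (k : ℤ) :
    0 ≤ convList A l k := by
  induction l generalizing k with
  | nil => simp only [convList]; split_ifs <;> norm_num
  | cons s l ih => exact tsum_nonneg fun p => mul_nonneg (h0 _ _) (ih _)

lemma convList_hasSum (A : ℕ → ℤ → ℝ) (h0 : ∀ s k, 0 ≤ A s k)
    (hs : ∀ s, HasSum (A s) (1 / 2)) (l : List ℕ) :
    HasSum (convList A l) ((1 / 2) ^ l.length) := by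
  induction l with
  | nil => simpa [convList] using hasSum_ite_eq (0 : ℤ) (1 : ℝ)
  | cons s l ih =>
    have := conv_hasSum _ _ _ _ (h0 s) (convList_nonneg A h0 l) (hs s) ih
    rw [List.length_cons, pow_succ']
    exact this

lemma shift_hasSum (g : ℤ → ℝ) (b : ℝ) (hb : HasSum g b) (k : ℤ) :
    HasSum (fun p => g (k - p)) b :=
  (Equiv.hasSum_iff (Equiv.subLeft k)).2 hb

lemma conv_summable (f g : ℤ → ℝ) (a b : ℝ) (hf : ∀ k, 0 ≤ f k) (hg : ∀ k, 0 ≤ g k)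
    (ha : HasSum f a) (hb : HasSum g b) (k : ℤ) : Summable (fun p => f p * g (k - p)) := by
  refine Summable.of_nonneg_of_le (fun p => mul_nonneg (hf _) (hg _)) (fun p => ?_)
    (ha.summable.mul_right b)
  exact mul_le_mul_of_nonneg_left (le_hasSum hb _ fun j _ => hg j) (hf _)

lemma conv_comm' (f g : ℤ → ℝ) (k : ℤ) : zconv f g k = zconv g f k := by
  unfold zconv
  rw [← (Equiv.subLeft k).tsum_eq]
  simp [mul_comm]

/-- Convolution preserves a modulus bound. -/
lemma conv_lip (f g : ℤ → ℝ) (a b : ℝ) (hf : ∀ k, 0 ≤ f k) (hg : ∀ k, 0 ≤ g k)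
    (ha : HasSum f a) (hb : HasSum g b) (k₁ k₂ : ℤ) (B : ℝ)
    (hB : ∀ p, |g (k₁ - p) - g (k₂ - p)| ≤ B) : |zconv f g k₁ - zconv f g k₂| ≤ a * B := by
  have s1 := conv_summable f g a b hf hg ha hb k₁
  have s2 := conv_summable f g a b hf hg ha hb k₂
  unfold zconv
  rw [← s1.tsum_sub s2]
  have h := ha.mul_right B
  have := tsum_of_norm_bounded (f := fun p => f p * g (k₁ - p) - f p * g (k₂ - p)) h (fun p => by
    rw [Real.norm_eq_abs, ← mul_sub, abs_mul, abs_of_nonneg (hf p)]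
    exact mul_le_mul_of_nonneg_left (hB p) (hf p))
  simpa using this

lemma convList_lip (A : ℕ → ℤ → ℝ) (h0 : ∀ s k, 0 ≤ A s k)
    (hs : ∀ s, HasSum (A s) (1 / 2)) (M : ℕ) (d : ℤ) (B : ℝ)
    (hB : ∀ k, |A M (k - d) - A M k| ≤ B) (l : List ℕ) (hM : M ∈ l) (k : ℤ) :
    |convList A l (k - d) - convList A l k| ≤ 2 * (1 / 2) ^ l.length * B := by
  induction l generalizing k with
  | nil => simp at hM
  | cons s l ih =>
    have hl := convList_hasSum A h0 hs l
    have hn := convList_nonneg A h0 l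
    rcases List.mem_cons.1 hM with rfl | h
    · simp only [convList]
      rw [conv_comm' _ _ (k - d), conv_comm' _ _ k]
      have := conv_lip _ (A M) _ _ hn (h0 M) hl (hs M) (k - d) k B (fun p => by
        have := hB (k - p)
        rwa [show k - p - d = k - d - p by ring] at this)
      refine this.trans (le_of_eq ?_)
      rw [List.length_cons, pow_succ]; ring
    · have := conv_lip (A s) _ _ _ (h0 s) hn (hs s) hl (k - d) k
        (2 * (1 / 2) ^ l.length * B) (fun p => by
        have := ih h (k - p)
        rwa [show k - p - d = k - d - p by ring] at this)
      refine this.trans (le_of_eq ?_)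
      rw [List.length_cons, pow_succ]; ring

lemma convList_tail (A : ℕ → ℤ → ℝ) (h0 : ∀ s k, 0 ≤ A s k)
    (hs : ∀ s, HasSum (A s) (1 / 2)) (y a : ℕ → ℝ) (ha0 : ∀ i, 0 ≤ a i)
    (ha : ∀ i (p : ℤ), y i ≤ p → A i p ≤ a i) (l : List ℕ) (k : ℤ)
    (hk : (l.map y).sum < k) :
    convList A l k ≤ 2 * (1 / 2) ^ l.length * (l.map a).sum := by
  induction l generalizing k with
  | nil =>
    have : k ≠ 0 := by rintro rfl; simp at hk
    simp [convList, this]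
  | cons s l ih =>
    have hl := convList_hasSum A h0 hs l
    have hn := convList_nonneg A h0 l
    have hsum0 : 0 ≤ (l.map a).sum := List.sum_nonneg (by simp; intros; exact ha0 _)
    have h1 : HasSum (fun p => A s p * (2 * (1 / 2) ^ l.length * (l.map a).sum)
        + a s * convList A l (k - p))
        (1 / 2 * (2 * (1 / 2) ^ l.length * (l.map a).sum) + a s * (1 / 2) ^ l.length) :=
      ((hs s).mul_right _).add ((shift_hasSum _ _ hl k).mul_left _)
    have h2 : convList A (s :: l) k ≤
        ∑' p : ℤ, (A s p * (2 * (1 / 2) ^ l.length * (l.map a).sum)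
          + a s * convList A l (k - p)) := by
      refine Summable.tsum_le_tsum (fun p => ?_)
        (conv_summable (A s) _ _ _ (h0 s) hn (hs s) hl k) h1.summable
      by_cases hp : y s ≤ p
      · have := mul_le_mul_of_nonneg_right (ha s p hp) (hn (k - p))
        have h3 : 0 ≤ A s p * (2 * (1 / 2) ^ l.length * (l.map a).sum) := by
          have := h0 s p
          positivity
        linarith
      · have := ih (k - p) (by
          simp only [List.map_cons, List.sum_cons] at hk
          push_cast; push Not at hp; linarith)
        have := mul_le_mul_of_nonneg_left this (h0 s p)
        have h3 := mul_nonneg (ha0 s) (hn (k - p))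
        linarith
    rw [h1.tsum_eq] at h2
    refine h2.trans (le_of_eq ?_)
    rw [List.length_cons, pow_succ, List.map_cons, List.sum_cons]; ring

lemma moment (A : ℕ → ℤ → ℝ) (h0 : ∀ s k, 0 ≤ A s k)
    (hsupp : ∀ s : ℕ, ∀ k : ℤ, k < 0 → A s k = 0)
    (hs : ∀ s, HasSum (A s) (1 / 2)) (C : ℝ) (hC : 0 ≤ C)
    (hII : ∀ s : ℕ, ∀ k : ℤ, 0 < k →
      A s k ≤ C * 4 ^ (-(s : ℝ)) * ((4 : ℝ) ^ (s : ℕ) / (k : ℝ)) ^ 3) (s : ℕ) (T : Finset ℤ) :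
    ∑ p ∈ T, A s p * |(p : ℝ)| ≤ (1 / 2 + C) * 4 ^ s := by
  have hN : (0 : ℝ) < 4 ^ s := by positivity
  rw [← Finset.sum_filter_add_sum_filter_not T (fun p => p ≤ 4 ^ s)]
  have hA : ∑ p ∈ T with p ≤ 4 ^ s, A s p * |(p : ℝ)| ≤ 1 / 2 * 4 ^ s := by
    calc _ ≤ ∑ p ∈ T with p ≤ 4 ^ s, A s p * 4 ^ s := by
          refine Finset.sum_le_sum fun p hp => ?_
          rcases lt_or_ge p 0 with h | h
          · simp [hsupp s p h]
          · refine mul_le_mul_of_nonneg_left ?_ (h0 _ _)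
            rw [abs_of_nonneg (by exact_mod_cast h)]
            exact_mod_cast (Finset.mem_filter.1 hp).2
      _ = (∑ p ∈ T with p ≤ 4 ^ s, A s p) * 4 ^ s := by rw [Finset.sum_mul]
      _ ≤ _ := by
          refine mul_le_mul_of_nonneg_right ?_ hN.le
          exact sum_le_hasSum _ (fun i _ => h0 s i) (hs s)
  have hB : ∑ p ∈ T with ¬ p ≤ 4 ^ s, A s p * |(p : ℝ)| ≤ C * 4 ^ s := by
    set U := T.filter (fun p => ¬ p ≤ 4 ^ s) with hU
    have hUp : ∀ p ∈ U, (4 : ℤ) ^ s < p := fun p hp => by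
      have := (Finset.mem_filter.1 hp).2; omega
    have hpos : (0 : ℤ) < 4 ^ s := by positivity
    have h1 : ∀ p ∈ U, A s p * |(p : ℝ)| ≤ C * (4 ^ s) ^ 2 * (((p.toNat : ℕ) : ℝ) ^ 2)⁻¹ := by
      intro p hp
      have hp' := hUp p hp
      have hp0 : 0 < p := hpos.trans hp'
      have hpr : (0 : ℝ) < p := by exact_mod_cast hp0
      have e : ((p.toNat : ℕ) : ℝ) = p := by
        have : ((p.toNat : ℕ) : ℤ) = p := Int.toNat_of_nonneg hp0.le
        exact_mod_cast this
      rw [e, abs_of_pos hpr]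
      have := mul_le_mul_of_nonneg_right (hII s p hp0) hpr.le
      refine this.trans (le_of_eq ?_)
      rw [Real.rpow_neg (by norm_num), Real.rpow_natCast]
      field_simp
    obtain ⟨m, hm⟩ : ∃ m : ℕ, 4 ^ s ≤ m ∧ ∀ p ∈ U, p.toNat ≤ m :=
      ⟨4 ^ s + U.sup Int.toNat, Nat.le_add_right _ _, fun p hp =>
        (Finset.le_sup (f := Int.toNat) hp).trans (Nat.le_add_left _ _)⟩
    have hinj : Set.InjOn Int.toNat (U : Set ℤ) := by
      intro x hx y hy h
      have := hUp x hx
      have := hUp y hy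
      omega
    calc _ ≤ ∑ p ∈ U, C * (4 ^ s) ^ 2 * (((p.toNat : ℕ) : ℝ) ^ 2)⁻¹ := Finset.sum_le_sum h1
      _ = C * (4 ^ s) ^ 2 * ∑ j ∈ U.image Int.toNat, ((j : ℝ) ^ 2)⁻¹ := by
          rw [← Finset.mul_sum, Finset.sum_image hinj]
      _ ≤ C * (4 ^ s) ^ 2 * ∑ j ∈ Finset.Ioc (4 ^ s) m, ((j : ℝ) ^ 2)⁻¹ := by
          refine mul_le_mul_of_nonneg_left ?_ (by positivity)
          refine Finset.sum_le_sum_of_subset_of_nonneg ?_ (fun _ _ _ => by positivity)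
          intro j hj
          obtain ⟨p, hp, rfl⟩ := Finset.mem_image.1 hj
          refine Finset.mem_Ioc.2 ⟨?_, hm.2 p hp⟩
          have := hUp p hp
          zify
          rw [Int.toNat_of_nonneg (hpos.trans this).le]
          exact this
      _ ≤ C * (4 ^ s) ^ 2 * (4 ^ s)⁻¹ := by
          refine mul_le_mul_of_nonneg_left ?_ (by positivity)
          have := sum_Ioc_inv_sq_le_sub (α := ℝ) (k := 4 ^ s) (n := m) (by positivity) hm.1
          push_cast at this
          have h : (0 : ℝ) ≤ (m : ℝ)⁻¹ := by positivity
          linarith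
      _ = C * 4 ^ s := by field_simp
  linarith

lemma smoothing (A : ℕ → ℤ → ℝ) (h0 : ∀ s k, 0 ≤ A s k)
    (hsupp : ∀ s : ℕ, ∀ k : ℤ, k < 0 → A s k = 0)
    (hs : ∀ s, HasSum (A s) (1 / 2)) (C : ℝ) (hC : 0 ≤ C)
    (hII : ∀ s : ℕ, ∀ k : ℤ, 0 < k →
      A s k ≤ C * 4 ^ (-(s : ℝ)) * ((4 : ℝ) ^ (s : ℕ) / (k : ℝ)) ^ 3)
    (D : ℝ) (hD : 0 ≤ D) (hIII : ∀ s : ℕ, ∀ k₁ k₂ : ℤ,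
      |A s k₁ - A s k₂| ≤ D * (|(k₁ : ℝ) - (k₂ : ℝ)| * 16 ^ (-(s : ℝ)) + 8 ^ (-(s : ℝ))))
    (s M : ℕ) (l : List ℕ) (hM : M ∈ l) (k : ℤ) :
    |convList A (s :: l) k - 1 / 2 * convList A l k| ≤
      (1 / 2) ^ l.length * (2 * D * (1 + C)) *
        (4 ^ s * 16 ^ (-(M : ℝ)) + 8 ^ (-(M : ℝ))) := by
  have hl := convList_hasSum A h0 hs l
  have hn := convList_nonneg A h0 l
  have hsm : Summable (fun p : ℤ => A s p * |(p : ℝ)|) :=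
    summable_of_sum_le (fun p => mul_nonneg (h0 _ _) (abs_nonneg _))
      (moment A h0 hsupp hs C hC hII s)
  have hle : ∑' p : ℤ, A s p * |(p : ℝ)| ≤ (1 / 2 + C) * 4 ^ s :=
    hsm.tsum_le_of_sum_le (moment A h0 hsupp hs C hC hII s)
  have hb := ((hsm.hasSum.mul_left (2 * (1 / 2) ^ l.length * D * 16 ^ (-(M : ℝ)))).add
    ((hs s).mul_left (2 * (1 / 2) ^ l.length * D * 8 ^ (-(M : ℝ)))))
  have s1 := conv_summable (A s) _ _ _ (h0 s) hn (hs s) hl k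
  have s2 := (hs s).mul_right (convList A l k)
  have key := tsum_of_norm_bounded
    (f := fun p => A s p * convList A l (k - p) - A s p * convList A l k) hb (fun p => by
      rw [Real.norm_eq_abs, ← mul_sub, abs_mul, abs_of_nonneg (h0 s p)]
      have := convList_lip A h0 hs M p (D * (|(p : ℝ)| * 16 ^ (-(M : ℝ)) + 8 ^ (-(M : ℝ))))
        (fun k => by
          have := hIII M (k - p) k
          push_cast at this
          rwa [show (k : ℝ) - p - k = -p by ring, abs_neg] at this) l hM k
      have := mul_le_mul_of_nonneg_left this (h0 s p)
      refine this.trans (le_of_eq ?_)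
      ring)
  rw [s1.tsum_sub s2.summable, s2.tsum_eq, Real.norm_eq_abs] at key
  refine key.trans ?_
  have h16 : (0 : ℝ) < 16 ^ (-(M : ℝ)) := by positivity
  have h8 : (0 : ℝ) < 8 ^ (-(M : ℝ)) := by positivity
  have e1 : 2 * (1 / 2) ^ l.length * D * 16 ^ (-(M : ℝ)) * ∑' p : ℤ, A s p * |(p : ℝ)| ≤
      2 * (1 / 2) ^ l.length * D * 16 ^ (-(M : ℝ)) * ((1 + C) * 4 ^ s) := by
    refine mul_le_mul_of_nonneg_left (hle.trans ?_) (by positivity)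
    gcongr; norm_num
  have e2 : 2 * (1 / 2) ^ l.length * D * 8 ^ (-(M : ℝ)) * (1 / 2) ≤
      2 * (1 / 2) ^ l.length * D * 8 ^ (-(M : ℝ)) * (1 + C) := by
    refine mul_le_mul_of_nonneg_left (by linarith) (by positivity)
  linarith

lemma tail_bound (A : ℕ → ℤ → ℝ) (h0 : ∀ s k, 0 ≤ A s k)
    (hs : ∀ s, HasSum (A s) (1 / 2)) (C : ℝ) (hC : 0 ≤ C)
    (hII : ∀ s : ℕ, ∀ k : ℤ, 0 < k →
      A s k ≤ C * 4 ^ (-(s : ℝ)) * ((4 : ℝ) ^ (s : ℕ) / (k : ℝ)) ^ 4)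
    (S : Finset ℕ) (M n : ℕ) (hM : ∀ t ∈ S, t ≤ M) (k : ℤ) (hk : (4 : ℤ) ^ n ≤ k) :
    AconvS A S k ≤ (1 / 2) ^ S.card * (128 * C) * (64 ^ M / 256 ^ n) := by
  have hnd : (S.sort (· ≤ ·)).Nodup := Finset.sort_nodup _ _
  have hsum : ∀ f : ℕ → ℝ, ((S.sort (· ≤ ·)).map f).sum = ∑ i ∈ S, f i := fun f => by
    rw [← List.sum_toFinset f hnd, Finset.sort_toFinset]
  have g2 : (∑ i ∈ S, (2 : ℝ) ^ i) < 2 ^ (M + 1) := by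
    exact_mod_cast Nat.geomSum_lt (m := 2) (n := M + 1) le_rfl
      (fun t ht => Nat.lt_succ_of_le (hM t ht))
  have g4 : (∑ i ∈ S, (4 : ℝ) ^ i) < 4 ^ (M + 1) := by
    exact_mod_cast Nat.geomSum_lt (m := 4) (n := M + 1) (by norm_num)
      (fun t ht => Nat.lt_succ_of_le (hM t ht))
  have hkr : (4 : ℝ) ^ n ≤ k := by exact_mod_cast hk
  have := convList_tail A h0 hs (fun i => 4 ^ n / 2 ^ (M + 1) * 2 ^ i)
    (fun i => 16 * C * (16 ^ M / 256 ^ n) * 4 ^ i) (fun i => by positivity) (fun i p hp => by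
      have hy : (0 : ℝ) < 4 ^ n / 2 ^ (M + 1) * 2 ^ i := by positivity
      have hp0 : (0 : ℝ) < p := hy.trans_le hp
      refine (hII i p (by exact_mod_cast hp0)).trans ?_
      calc _ ≤ C * 4 ^ (-(i : ℝ)) * ((4 : ℝ) ^ i / (4 ^ n / 2 ^ (M + 1) * 2 ^ i)) ^ 4 := by
            gcongr
        _ = _ := by
            rw [Real.rpow_neg (by norm_num), Real.rpow_natCast]
            have a1 : (256 : ℝ) ^ n = (4 ^ n) ^ 4 := by rw [← pow_mul, mul_comm, pow_mul]; norm_num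
            have a2 : (16 : ℝ) ^ M = (2 ^ M) ^ 4 := by rw [← pow_mul, mul_comm, pow_mul]; norm_num
            have a3 : (4 : ℝ) ^ i = (2 ^ i) ^ 2 := by rw [← pow_mul, mul_comm, pow_mul]; norm_num
            rw [a1, a2, a3, pow_succ]
            field_simp
            ring) (S.sort (· ≤ ·)) k (by
      rw [hsum, ← Finset.mul_sum]
      refine lt_of_lt_of_le ?_ hkr
      calc _ < (4 : ℝ) ^ n / 2 ^ (M + 1) * 2 ^ (M + 1) := by gcongr
        _ = _ := by field_simp)
  rw [hsum, ← Finset.mul_sum, Finset.length_sort] at this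
  refine this.trans ?_
  calc _ ≤ 2 * (1 / 2) ^ S.card * (16 * C * (16 ^ M / 256 ^ n) * 4 ^ (M + 1)) := by gcongr
    _ = _ := by
      have a1 : (64 : ℝ) ^ M = 16 ^ M * 4 ^ M := by rw [← mul_pow]; norm_num
      rw [a1]; ring

theorem blurring (A : ℕ → ℤ → ℝ)
    (hnonneg : ∀ s k, 0 ≤ A s k)
    (hsupp : ∀ s : ℕ, ∀ k : ℤ, k < 0 → A s k = 0)
    (hI : ∀ s, ∑' k : ℤ, A s k = 1 / 2)
    (hII : ∀ r : ℕ, ∃ C : ℝ, ∀ s : ℕ, ∀ k : ℤ, 0 < k →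
      A s k ≤ C * 4 ^ (-(s : ℝ)) * ((4 : ℝ) ^ (s : ℕ) / (k : ℝ)) ^ r)
    (hIII : ∃ C : ℝ, ∀ s : ℕ, ∀ k₁ k₂ : ℤ,
      |A s k₁ - A s k₂| ≤ C * (|(k₁ : ℝ) - (k₂ : ℝ)| * 16 ^ (-(s : ℝ)) + 8 ^ (-(s : ℝ)))) :
    ∃ C' : ℝ, 0 < C' ∧ ∀ s : ℕ, ∀ S : Finset ℕ, ∀ hS : S.Nonempty,
      (∀ t ∈ S, s < t) → ∀ n : ℕ, s ≤ n → ∀ k : ℤ,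
      (4 : ℤ) ^ n ≤ k → k < 4 ^ (n + 1) →
      |AconvS A (insert s S) k - (1 / 2) * AconvS A S k| ≤
        C' * 2 ^ (-(S.card : ℝ)) *
          2 ^ (-((max (S.max' hS + n) (2 * n) : ℝ) + (3 / 5) * ((n : ℝ) - (s : ℝ)))) := by
  have hs : ∀ s, HasSum (A s) (1 / 2) := fun s => by
    have h : Summable (A s) := by
      by_contra h
      have := hI s
      rw [tsum_eq_zero_of_not_summable h] at this
      norm_num at this
    rw [← hI s]; exact h.hasSum
  obtain ⟨C₃, h3⟩ := hII 3
  obtain ⟨C₄, h4⟩ := hII 4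
  obtain ⟨D₀, hD₀⟩ := hIII
  have h3' : ∀ s : ℕ, ∀ k : ℤ, 0 < k →
      A s k ≤ |C₃| * 4 ^ (-(s : ℝ)) * ((4 : ℝ) ^ (s : ℕ) / (k : ℝ)) ^ 3 := fun s k hk => by
    have hk' : (0 : ℝ) < k := by exact_mod_cast hk
    refine (h3 s k hk).trans ?_
    gcongr
    exact le_abs_self _
  have h4' : ∀ s : ℕ, ∀ k : ℤ, 0 < k →
      A s k ≤ |C₄| * 4 ^ (-(s : ℝ)) * ((4 : ℝ) ^ (s : ℕ) / (k : ℝ)) ^ 4 := fun s k hk => by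
    have hk' : (0 : ℝ) < k := by exact_mod_cast hk
    refine (h4 s k hk).trans ?_
    gcongr
    exact le_abs_self _
  have hD' : ∀ s : ℕ, ∀ k₁ k₂ : ℤ, |A s k₁ - A s k₂| ≤
      |D₀| * (|(k₁ : ℝ) - (k₂ : ℝ)| * 16 ^ (-(s : ℝ)) + 8 ^ (-(s : ℝ))) := fun s k₁ k₂ => by
    refine (hD₀ s k₁ k₂).trans ?_
    gcongr
    exact le_abs_self _
  set C := |C₃|
  set E := |C₄|
  set D := |D₀|
  have hC : 0 ≤ C := abs_nonneg _
  have hE : 0 ≤ E := abs_nonneg _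
  have hD : 0 ≤ D := abs_nonneg _
  refine ⟨4 * D * (1 + C) + 128 * E + 1, by positivity, ?_⟩
  intro s S hS hlt n hsn k hk1 hk2
  set M := S.max' hS with hMdef
  have hMS : M ∈ S := S.max'_mem hS
  have hsM : s < M := hlt M hMS
  have hsMr : (s : ℝ) < M := by exact_mod_cast hsM
  have hsnr : (s : ℝ) ≤ n := by exact_mod_cast hsn
  have hle : ∀ t ∈ S, t ≤ M := fun t ht => S.le_max' t ht
  have hsS : s ∉ S := fun h => lt_irrefl _ (hlt s h)
  have hsort : (insert s S).sort (· ≤ ·) = s :: S.sort (· ≤ ·) :=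
    Finset.sort_insert _ (fun b hb => (hlt b hb).le) hsS
  have hcard : (2 : ℝ) ^ (-(S.card : ℝ)) = (1 / 2) ^ S.card := by
    rw [Real.rpow_neg (by norm_num), Real.rpow_natCast, one_div, inv_pow]
  rw [hcard]
  set X : ℝ := (max ((M : ℝ) + n) (2 * n)) + (3 / 5) * ((n : ℝ) - (s : ℝ)) with hX
  have hY : (0 : ℝ) < 2 ^ (-X) := by positivity
  by_cases hc : 10 * n < 10 * M + (n - s)
  · have hcr : (10 : ℝ) * n < 10 * M + (n - s) := by
      have : ((10 * n : ℕ) : ℝ) < ((10 * M + (n - s) : ℕ) : ℝ) := by exact_mod_cast hc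
      push_cast [Nat.cast_sub hsn] at this
      exact this
    have key := smoothing A hnonneg hsupp hs C hC h3' D hD hD' s M (S.sort (· ≤ ·))
      ((Finset.mem_sort _).2 hMS) k
    rw [Finset.length_sort] at key
    unfold AconvS
    rw [hsort]
    have b1 : (4 : ℝ) ^ s * 16 ^ (-(M : ℝ)) ≤ 2 ^ (-X) := by
      rw [← Real.rpow_natCast 4 s, show (4 : ℝ) = 2 ^ (2 : ℝ) by norm_num,
        show (16 : ℝ) = 2 ^ (4 : ℝ) by norm_num, ← Real.rpow_mul (by norm_num),
        ← Real.rpow_mul (by norm_num), ← Real.rpow_add (by norm_num)]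
      refine Real.rpow_le_rpow_of_exponent_le (by norm_num) ?_
      rcases max_cases ((M : ℝ) + n) (2 * n) with h | h <;> rw [hX, h.1] <;> linarith
    have b2 : (8 : ℝ) ^ (-(M : ℝ)) ≤ 2 ^ (-X) := by
      rw [show (8 : ℝ) = 2 ^ (3 : ℝ) by norm_num, ← Real.rpow_mul (by norm_num)]
      refine Real.rpow_le_rpow_of_exponent_le (by norm_num) ?_
      have : (0 : ℝ) ≤ s := by positivity
      rcases max_cases ((M : ℝ) + n) (2 * n) with h | h <;> rw [hX, h.1] <;> linarith
    refine key.trans ?_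
    calc _ ≤ (1 / 2 : ℝ) ^ S.card * (2 * D * (1 + C)) * (2 ^ (-X) + 2 ^ (-X)) := by gcongr
      _ = (4 * D * (1 + C)) * (1 / 2) ^ S.card * 2 ^ (-X) := by ring
      _ ≤ _ := by
        gcongr
        linarith
  · have hcr : 10 * (M : ℝ) + (n - s) ≤ 10 * n := by
      have : ((10 * M + (n - s) : ℕ) : ℝ) ≤ ((10 * n : ℕ) : ℝ) := by
        exact_mod_cast not_lt.1 hc
      push_cast [Nat.cast_sub hsn] at this
      exact this
    have t1 := tail_bound A hnonneg hs E hE h4' S M n hle k hk1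
    have t2 := tail_bound A hnonneg hs E hE h4' (insert s S) M n (fun t ht => by
      rcases Finset.mem_insert.1 ht with rfl | h
      · exact hsM.le
      · exact hle t h) k hk1
    rw [Finset.card_insert_of_notMem hsS, pow_succ] at t2
    have n1 : 0 ≤ AconvS A S k := convList_nonneg A hnonneg _ _
    have n2 : 0 ≤ AconvS A (insert s S) k := convList_nonneg A hnonneg _ _
    have b : (64 : ℝ) ^ M / 256 ^ n ≤ 2 ^ (-X) := by
      rw [div_eq_mul_inv, ← Real.rpow_natCast 64 M, ← Real.rpow_natCast 256 n,
        ← Real.rpow_neg (by norm_num), show (64 : ℝ) = 2 ^ (6 : ℝ) by norm_num,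
        show (256 : ℝ) = 2 ^ (8 : ℝ) by norm_num, ← Real.rpow_mul (by norm_num),
        ← Real.rpow_mul (by norm_num), ← Real.rpow_add (by norm_num)]
      refine Real.rpow_le_rpow_of_exponent_le (by norm_num) ?_
      rcases max_cases ((M : ℝ) + n) (2 * n) with h | h <;> rw [hX, h.1] <;> linarith
    have : |AconvS A (insert s S) k - 1 / 2 * AconvS A S k| ≤
        (1 / 2) ^ S.card * (128 * E) * (64 ^ M / 256 ^ n) := by
      rw [abs_le]; constructor <;> linarith
    refine this.trans ?_
    calc _ ≤ (1 / 2 : ℝ) ^ S.card * (128 * E) * 2 ^ (-X) := by gcongr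
      _ = (128 * E) * (1 / 2 : ℝ) ^ S.card * 2 ^ (-X) := by ring
      _ ≤ _ := by
        gcongr
        have : 0 ≤ 4 * D * (1 + C) := by positivity
        linarith
end

section
/- For every ε > 0 there exists a positive integer r such that for every integer n ≥ r and every integer k with 4^n ≤ k < 4^{n+1}: the sum B_ℝ(k) converges and |(3/2)^{−n}·B_ℝ(k) − (3/2)^{−r}·B_{[n−r, n+r]}(k)| < ε·4^{−n}. -/
/-- coefficients extended by zero to ℤ -/
noncomputable def extz (f : PowerSeries ℝ) (k : ℤ) : ℝ :=
  if 0 ≤ k then PowerSeries.coeff k.toNat f else 0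

theorem extz_natCast (f : PowerSeries ℝ) (k : ℕ) : extz f k = PowerSeries.coeff k f := by
  simp [extz]

theorem extz_neg (f : PowerSeries ℝ) (k : ℤ) (h : k < 0) : extz f k = 0 := by
  simp [extz, not_le.mpr h]

theorem hasSum_extz (f g : PowerSeries ℝ) (n : ℤ) :
    HasSum (fun j : ℕ => PowerSeries.coeff j f * extz g (n - j)) (extz (f * g) n) := by
  rcases lt_or_ge n 0 with h | h
  · rw [extz_neg _ _ h]
    convert hasSum_zero using 2 with j
    rw [extz_neg _ _ (by omega), mul_zero]
  · lift n to ℕ using h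
    rw [extz_natCast, PowerSeries.coeff_mul,
      Finset.Nat.sum_antidiagonal_eq_sum_range_succ
        (fun i j => PowerSeries.coeff i f * PowerSeries.coeff j g)]
    have : ∑ i ∈ Finset.range n.succ, PowerSeries.coeff i f * PowerSeries.coeff (n - i) g
        = ∑ i ∈ Finset.range n.succ, PowerSeries.coeff i f * extz g ((n : ℤ) - i) := by
      apply Finset.sum_congr rfl
      intro i hi
      rw [Finset.mem_range] at hi
      rw [← extz_natCast g, Nat.cast_sub (by omega)]
    rw [this]
    apply hasSum_sum_of_ne_finset_zero
    intro j hj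
    rw [Finset.mem_range] at hj
    rw [extz_neg _ _ (by omega), mul_zero]

theorem hasSum_mul_coeff (f g : PowerSeries ℝ) (hf : ∀ i, 0 ≤ PowerSeries.coeff i f)
    (hg : ∀ i, 0 ≤ PowerSeries.coeff i g) (M M' : ℝ)
    (hfM : HasSum (fun i => PowerSeries.coeff i f) M)
    (hgM : HasSum (fun i => PowerSeries.coeff i g) M') :
    HasSum (fun i => PowerSeries.coeff i (f * g)) (M * M') := by
  have h1 : Summable fun i => ‖PowerSeries.coeff i f‖ := by
    simpa [Real.norm_of_nonneg (hf _)] using hfM.summable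
  have h2 : Summable fun i => ‖PowerSeries.coeff i g‖ := by
    simpa [Real.norm_of_nonneg (hg _)] using hgM.summable
  have h3 := (summable_norm_sum_mul_antidiagonal_of_summable_norm h1 h2).of_norm
  have h4 := tsum_mul_tsum_eq_tsum_sum_antidiagonal_of_summable_norm h1 h2
  simp only [PowerSeries.coeff_mul]
  rw [← hfM.tsum_eq, ← hgM.tsum_eq, h4]
  exact h3.hasSum

structure GoodS (f : PowerSeries ℝ) (M K : ℝ) : Prop where
  nonneg : ∀ i, 0 ≤ PowerSeries.coeff i f
  mass : HasSum (fun i => PowerSeries.coeff i f) M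
  mom : ∃ K' ≤ K, HasSum (fun i : ℕ => (i : ℝ) * PowerSeries.coeff i f) K'

theorem GoodS.mass_nonneg {f : PowerSeries ℝ} {M K : ℝ} (h : GoodS f M K) : 0 ≤ M :=
  h.mass.nonneg h.nonneg

theorem GoodS.mono {f : PowerSeries ℝ} {M K K' : ℝ} (h : GoodS f M K) (hK : K ≤ K') :
    GoodS f M K' := by
  obtain ⟨a, b, x, hx, y⟩ := h
  exact ⟨a, b, x, hx.trans hK, y⟩

theorem GoodS.mul {f g : PowerSeries ℝ} {M K M' K' : ℝ} (hf : GoodS f M K) (hg : GoodS g M' K') :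
    GoodS (f * g) (M * M') (K * M' + M * K') := by
  refine ⟨?_, hasSum_mul_coeff f g hf.nonneg hg.nonneg M M' hf.mass hg.mass, ?_⟩
  · intro i
    rw [PowerSeries.coeff_mul]
    exact Finset.sum_nonneg fun p _ => mul_nonneg (hf.nonneg _) (hg.nonneg _)
  · obtain ⟨k, hk, hk'⟩ := hf.mom
    obtain ⟨l, hl, hl'⟩ := hg.mom
    refine ⟨k * M' + M * l, ?_, ?_⟩
    · have := hf.mass_nonneg
      have := hg.mass_nonneg
      gcongr
    · have h1 := hasSum_mul_coeff (PowerSeries.mk fun i : ℕ => (i : ℝ) * PowerSeries.coeff i f) g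
        (fun i => by rw [PowerSeries.coeff_mk]; exact mul_nonneg (Nat.cast_nonneg _) (hf.nonneg i))
        hg.nonneg k M' (by simpa using hk') hg.mass
      have h2 := hasSum_mul_coeff f (PowerSeries.mk fun i : ℕ => (i : ℝ) * PowerSeries.coeff i g)
        hf.nonneg
        (fun i => by rw [PowerSeries.coeff_mk]; exact mul_nonneg (Nat.cast_nonneg _) (hg.nonneg i))
        M l hf.mass (by simpa using hl')
      convert h1.add h2 using 2 with i
      simp only [PowerSeries.coeff_mul, PowerSeries.coeff_mk]
      rw [Finset.mul_sum, ← Finset.sum_add_distrib]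
      apply Finset.sum_congr rfl
      intro p hp
      have hp := Finset.HasAntidiagonal.mem_antidiagonal.1 hp
      rw [← hp]
      push_cast
      ring

theorem GoodS.one : GoodS 1 1 0 := by
  refine ⟨?_, ?_, 0, le_rfl, ?_⟩
  · intro i
    rw [PowerSeries.coeff_one]
    split_ifs <;> norm_num
  · simp only [PowerSeries.coeff_one]
    exact hasSum_ite_eq 0 1
  · convert hasSum_zero using 2 with i
    rw [PowerSeries.coeff_one]
    split_ifs with h
    · simp [h]
    · simp

theorem GoodS.add {f g : PowerSeries ℝ} {M K M' K' : ℝ} (hf : GoodS f M K) (hg : GoodS g M' K') :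
    GoodS (f + g) (M + M') (K + K') := by
  obtain ⟨k, hk, hk'⟩ := hf.mom
  obtain ⟨l, hl, hl'⟩ := hg.mom
  refine ⟨fun i => ?_, ?_, k + l, add_le_add hk hl, ?_⟩
  · rw [map_add]; exact add_nonneg (hf.nonneg i) (hg.nonneg i)
  · simpa using hf.mass.add hg.mass
  · simpa [mul_add] using hk'.add hl'

theorem GoodS.coeff_mul_le {f g : PowerSeries ℝ} {M K c : ℝ} (hf : GoodS f M K)
    (hc0 : 0 ≤ c) (hc : ∀ i, PowerSeries.coeff i g ≤ c) (k : ℕ) :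
    PowerSeries.coeff k (f * g) ≤ M * c := by
  rw [← extz_natCast]
  refine hasSum_le (fun j => ?_) (hasSum_extz f g k) (hf.mass.mul_right c)
  refine mul_le_mul_of_nonneg_left ?_ (hf.nonneg j)
  unfold extz
  split_ifs
  · exact hc _
  · exact hc0

theorem GoodS.mul_coeff_mul_le {f g : PowerSeries ℝ} {M K c d : ℝ} (hf : GoodS f M K)
    (hc0 : 0 ≤ c) (hd0 : 0 ≤ d) (hc : ∀ i, PowerSeries.coeff i g ≤ c)
    (hd : ∀ i : ℕ, (i : ℝ) * PowerSeries.coeff i g ≤ d) (k : ℕ) :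
    (k : ℝ) * PowerSeries.coeff k (f * g) ≤ K * c + M * d := by
  obtain ⟨k', hk, hk'⟩ := hf.mom
  refine le_trans ?_ (add_le_add_left (mul_le_mul_of_nonneg_right hk hc0) _)
  rw [← extz_natCast]
  refine hasSum_le (fun j => ?_) ((hasSum_extz f g k).mul_left (k : ℝ))
    ((hk'.mul_right c).add (hf.mass.mul_right d))
  have hj := hf.nonneg j
  unfold extz
  split_ifs with h
  · obtain ⟨l, rfl⟩ : ∃ l, k = j + l := Nat.exists_eq_add_of_le (by omega)
    have : ((j + l : ℕ) : ℤ) - j = (l : ℕ) := by push_cast; ring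
    rw [this, Int.toNat_natCast]
    have h1 := mul_le_mul_of_nonneg_left (hc l) (mul_nonneg (Nat.cast_nonneg (α := ℝ) j) hj)
    have h2 := mul_le_mul_of_nonneg_left (hd l) hj
    push_cast
    nlinarith
  · simp only [mul_zero]
    positivity

def LipS (g : PowerSeries ℝ) (c d : ℝ) : Prop :=
  ∀ x y : ℤ, |extz g x - extz g y| ≤ c * |(x : ℝ) - y| + d

theorem GoodS.lip {f g : PowerSeries ℝ} {M K c d : ℝ} (hf : GoodS f M K) (hg : LipS g c d) :
    LipS (f * g) (M * c) (M * d) := by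
  intro x y
  have h := (hasSum_extz f g x).sub (hasSum_extz f g y)
  have hb := hf.mass.mul_right (c * |(x : ℝ) - y| + d)
  have : M * c * |(x : ℝ) - y| + M * d = M * (c * |(x : ℝ) - y| + d) := by ring
  rw [this]
  have key : ∀ j : ℕ, |PowerSeries.coeff j f * extz g (x - j) - PowerSeries.coeff j f * extz g (y - j)|
      ≤ PowerSeries.coeff j f * (c * |(x : ℝ) - y| + d) := by
    intro j
    rw [← mul_sub, abs_mul, abs_of_nonneg (hf.nonneg j)]
    refine mul_le_mul_of_nonneg_left ?_ (hf.nonneg j)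
    have := hg (x - j) (y - j)
    push_cast at this
    simpa using this
  rw [abs_le]
  exact ⟨hasSum_le (fun j => (abs_le.1 (key j)).1) hb.neg h,
    hasSum_le (fun j => (abs_le.1 (key j)).2) h hb⟩

theorem GoodS.smooth {f g : PowerSeries ℝ} {M K c d : ℝ} (hf : GoodS f M K) (hc : 0 ≤ c)
    (hg : LipS g c d) (k : ℕ) :
    |PowerSeries.coeff k (f * g) - M * PowerSeries.coeff k g| ≤ c * K + d * M := by
  obtain ⟨k', hk, hk'⟩ := hf.mom
  refine le_trans ?_ (add_le_add_left (mul_le_mul_of_nonneg_left hk hc) _)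
  rw [← extz_natCast, ← extz_natCast]
  have h := (hasSum_extz f g k).sub (hf.mass.mul_right (extz g k))
  have hb := (hk'.mul_left c).add (hf.mass.mul_left d)
  have key : ∀ j : ℕ, |PowerSeries.coeff j f * extz g (k - j) - PowerSeries.coeff j f * extz g k|
      ≤ c * (j * PowerSeries.coeff j f) + d * PowerSeries.coeff j f := by
    intro j
    rw [← mul_sub, abs_mul, abs_of_nonneg (hf.nonneg j)]
    have := hg (k - j) k
    push_cast at this
    simp only [sub_sub_cancel_left, abs_neg, Nat.abs_cast] at this
    have := mul_le_mul_of_nonneg_left this (hf.nonneg j)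
    linarith
  rw [abs_le]
  exact ⟨hasSum_le (fun j => (abs_le.1 (key j)).1) hb.neg h,
    hasSum_le (fun j => (abs_le.1 (key j)).2) h hb⟩

/-- the main properties of the sequence of power series -/
structure SeqS (a : ℕ → PowerSeries ℝ) (C : ℝ) : Prop where
  pos : 0 ≤ C
  good : ∀ s, GoodS (a s) (1 / 2) (C * 4 ^ s)
  sup : ∀ s i, PowerSeries.coeff i (a s) ≤ C * (1 / 4) ^ s
  dec : ∀ s, ∀ i : ℕ, (i : ℝ) * PowerSeries.coeff i (a s) ≤ C
  lip : ∀ s, LipS (a s) (C * (1 / 16) ^ s) (C * (1 / 8) ^ s)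

noncomputable def QS (a : ℕ → PowerSeries ℝ) (x y : ℕ) : PowerSeries ℝ :=
  ∏ s ∈ Finset.Ico x y, (1 + a s)

theorem QS_self (a : ℕ → PowerSeries ℝ) (x : ℕ) : QS a x x = 1 := by simp [QS]

theorem QS_succ (a : ℕ → PowerSeries ℝ) (x y : ℕ) (h : x ≤ y) :
    QS a x (y + 1) = QS a x y + QS a x y * a y := by
  rw [QS, Finset.prod_Ico_succ_top h, ← QS]; ring

theorem QS_mul (a : ℕ → PowerSeries ℝ) (x y z : ℕ) (h : x ≤ y) (h' : y ≤ z) :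
    QS a x y * QS a y z = QS a x z := Finset.prod_Ico_consecutive _ h h'

theorem SeqS.goodQ {a : ℕ → PowerSeries ℝ} {C : ℝ} (h : SeqS a C) (x t : ℕ) :
    GoodS (QS a x (x + t)) ((3 / 2) ^ t) (C * (3 / 2) ^ t * 4 ^ (x + t)) := by
  have hC := h.pos
  induction t with
  | zero => simp only [add_zero, QS_self, pow_zero]; exact GoodS.one.mono (by positivity)
  | succ t ih =>
    have h1 : QS a x (x + (t + 1)) = QS a x (x + t) * (1 + a (x + t)) := by
      rw [← add_assoc, QS_succ _ _ _ (by omega)]; ring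
    rw [h1]
    have h2 := ih.mul (GoodS.one.add (h.good (x + t)))
    have h3 : (3 / 2 : ℝ) ^ (t + 1) = (3 / 2) ^ t * (1 + 1 / 2) := by rw [pow_succ]; norm_num
    rw [h3]
    refine h2.mono ?_
    rw [← add_assoc x t 1, pow_succ (4 : ℝ)]
    have : 0 ≤ C * (3 / 2) ^ t * 4 ^ (x + t) := by positivity
    nlinarith

theorem SeqS.decQa {a : ℕ → PowerSeries ℝ} {C : ℝ} (h : SeqS a C) (x t k : ℕ) :
    (k : ℝ) * PowerSeries.coeff k (QS a x (x + t) * a (x + t)) ≤ (C ^ 2 + C) * (3 / 2) ^ t := by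
  have hC := h.pos
  have := (h.goodQ x t).mul_coeff_mul_le (by positivity) hC (h.sup (x + t)) (h.dec (x + t)) k
  refine this.trans (le_of_eq ?_)
  have h4 : (4 : ℝ) ^ (x + t) * (1 / 4) ^ (x + t) = 1 := by rw [← mul_pow]; norm_num
  linear_combination (C ^ 2 * (3 / 2) ^ t) * h4

theorem SeqS.decQ {a : ℕ → PowerSeries ℝ} {C : ℝ} (h : SeqS a C) (x t k : ℕ) (hk : 0 < k) :
    (k : ℝ) * PowerSeries.coeff k (QS a x (x + t)) ≤ 2 * (C ^ 2 + C) * (3 / 2) ^ t := by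
  have hC := h.pos
  induction t with
  | zero =>
    simp only [add_zero, QS_self, PowerSeries.coeff_one, hk.ne', if_false]
    simp only [mul_zero]; positivity
  | succ t ih =>
    rw [← add_assoc, QS_succ _ _ _ (by omega), map_add, mul_add, pow_succ (3 / 2 : ℝ)]
    have := h.decQa x t k
    linarith

theorem SeqS.tail {a : ℕ → PowerSeries ℝ} {C : ℝ} (h : SeqS a C) (M t k : ℕ) :
    0 ≤ PowerSeries.coeff k (QS a 0 (M + t)) - PowerSeries.coeff k (QS a 0 M) ∧
    PowerSeries.coeff k (QS a 0 (M + t)) - PowerSeries.coeff k (QS a 0 M) ≤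
      2 * C * ((3 / 8) ^ M - (3 / 8) ^ (M + t)) := by
  have hC := h.pos
  induction t with
  | zero => simp
  | succ t ih =>
    rw [← add_assoc, QS_succ _ _ _ (by omega), map_add, pow_succ]
    have h0 := h.goodQ 0 (M + t)
    rw [zero_add] at h0
    have h1 := h0.coeff_mul_le (by positivity) (h.sup (M + t)) k
    have h2 := (h0.mul (h.good (M + t))).nonneg k
    have h3 : (3 / 2 : ℝ) ^ (M + t) * (C * (1 / 4) ^ (M + t)) = C * (3 / 8) ^ (M + t) := by
      have : (3 / 8 : ℝ) = (3 / 2) * (1 / 4) := by norm_num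
      rw [this, mul_pow]; ring
    rw [h3] at h1
    have h4 : 0 ≤ C * (3 / 8) ^ (M + t) := by positivity
    constructor
    · linarith [ih.1]
    · nlinarith [ih.2]

theorem SeqS.mid {a : ℕ → PowerSeries ℝ} {C : ℝ} (h : SeqS a C) (L u t k : ℕ) :
    |PowerSeries.coeff k (QS a 0 (L + u + t)) - PowerSeries.coeff k (QS a 0 (L + u))
      - (3 / 2) ^ L * (PowerSeries.coeff k (QS a L (L + u + t)) -
        PowerSeries.coeff k (QS a L (L + u)))| ≤
      2 * (C ^ 2 + C) * ((3 / 2) ^ (L + u) * (4 ^ L * (1 / 16) ^ (L + u) + (1 / 8) ^ (L + u))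
        - (3 / 2) ^ (L + u + t) * (4 ^ L * (1 / 16) ^ (L + u + t) + (1 / 8) ^ (L + u + t))) := by
  have hC := h.pos
  induction t with
  | zero => simp
  | succ t ih =>
    rw [← add_assoc, QS_succ _ _ _ (by omega), QS_succ _ _ _ (by omega), map_add, map_add]
    generalize hm : L + u + t = m at *
    have hl := (h.goodQ L (u + t)).lip (h.lip m)
    rw [← add_assoc, hm] at hl
    have h0 := h.goodQ 0 L
    rw [zero_add] at h0
    have h1 := h0.smooth (by positivity) hl k
    rw [← mul_assoc, QS_mul _ _ _ _ (by omega) (by omega)] at h1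
    have e : (3 / 2 : ℝ) ^ m = (3 / 2) ^ (u + t) * (3 / 2) ^ L := by
      rw [← pow_add]; congr 1; omega
    have h2 : (3 / 2 : ℝ) ^ (u + t) * (C * (1 / 16) ^ m) * (C * (3 / 2) ^ L * 4 ^ L) +
        (3 / 2) ^ (u + t) * (C * (1 / 8) ^ m) * (3 / 2) ^ L
        = C ^ 2 * ((3 / 2) ^ m * (4 ^ L * (1 / 16) ^ m)) + C * ((3 / 2) ^ m * (1 / 8) ^ m) := by
      rw [e]; ring
    rw [h2] at h1
    have p1 : 0 ≤ (3 / 2 : ℝ) ^ m * (4 ^ L * (1 / 16) ^ m) := by positivity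
    have p2 : 0 ≤ (3 / 2 : ℝ) ^ m * (1 / 8) ^ m := by positivity
    rw [pow_succ (3 / 2 : ℝ) m, pow_succ (1 / 16 : ℝ) m, pow_succ (1 / 8 : ℝ) m]
    have q1 : 0 ≤ C ^ 2 * ((3 / 2 : ℝ) ^ m * (4 ^ L * (1 / 16) ^ m)) := by positivity
    have q2 : 0 ≤ C ^ 2 * ((3 / 2 : ℝ) ^ m * (1 / 8) ^ m) := by positivity
    have q3 : 0 ≤ C * ((3 / 2 : ℝ) ^ m * (4 ^ L * (1 / 16) ^ m)) := by positivity
    have q4 : 0 ≤ C * ((3 / 2 : ℝ) ^ m * (1 / 8) ^ m) := by positivity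
    rw [abs_le] at ih h1 ⊢
    constructor
    · linarith [ih.1, h1.1]
    · linarith [ih.2, h1.2]

theorem SeqS.estimate {a : ℕ → PowerSeries ℝ} {C : ℝ} (h : SeqS a C) (L t N k : ℕ)
    (hk : 4 ^ (L + 4 * t) ≤ k) :
    |PowerSeries.coeff k (QS a 0 (L + 3 * t + (5 * t + 1) + N)) -
      (3 / 2) ^ L * PowerSeries.coeff k (QS a L (L + 3 * t + (5 * t + 1)))| ≤
      (8 * C ^ 2 + 10 * C) * ((3 / 2) ^ (L + 3 * t) * (1 / 4) ^ (L + 4 * t)) := by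
  have hC := h.pos
  have hk0 : 0 < k := lt_of_lt_of_le (by positivity) hk
  have hkR : (4 : ℝ) ^ (L + 4 * t) ≤ k := by exact_mod_cast hk
  have conv : ∀ x y : ℝ, 0 ≤ y → (k : ℝ) * x ≤ y → x ≤ y * (1 / 4) ^ (L + 4 * t) := by
    intro x y hy hxy
    have e : (1 / 4 : ℝ) ^ (L + 4 * t) = ((4 : ℝ) ^ (L + 4 * t))⁻¹ := by
      rw [one_div, inv_pow]
    rw [e, ← div_eq_mul_inv]
    rw [le_div_iff₀ (by positivity)]
    rcases le_total x 0 with hx | hx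
    · exact le_trans (mul_nonpos_of_nonpos_of_nonneg hx (by positivity)) hy
    · nlinarith
  have b1 := conv _ _ (by positivity) (h.decQ 0 (L + 3 * t) k hk0)
  have b2 := conv _ _ (by positivity) (h.decQ L (3 * t) k hk0)
  have b1' := (h.goodQ 0 (L + 3 * t)).nonneg k
  have b2' := (h.goodQ L (3 * t)).nonneg k
  rw [zero_add] at b1 b1'
  have b3 := mul_le_mul_of_nonneg_left b2 (by positivity : (0 : ℝ) ≤ (3 / 2) ^ L)
  have b3' := mul_nonneg (by positivity : (0 : ℝ) ≤ (3 / 2) ^ L) b2'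
  have e3 : (3 / 2 : ℝ) ^ L * (2 * (C ^ 2 + C) * (3 / 2) ^ (3 * t) * (1 / 4) ^ (L + 4 * t))
      = 2 * (C ^ 2 + C) * (3 / 2) ^ (L + 3 * t) * (1 / 4) ^ (L + 4 * t) := by
    rw [pow_add (3 / 2 : ℝ) L]; ring
  rw [e3] at b3
  have b4 := h.tail (L + 3 * t + (5 * t + 1)) N k
  have b5 := h.mid L (3 * t) (5 * t + 1) k
  have c4 : (3 / 8 : ℝ) ^ (L + 3 * t + (5 * t + 1)) ≤
      (3 / 2) ^ (L + 3 * t) * (1 / 4) ^ (L + 4 * t) := by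
    have : (3 / 8 : ℝ) ^ (L + 3 * t + (5 * t + 1)) ≤ (3 / 8 : ℝ) ^ (L + 8 * t) :=
      pow_le_pow_of_le_one (by norm_num) (by norm_num) (by omega)
    refine this.trans ?_
    rw [pow_add, pow_add, pow_add, pow_mul, pow_mul, pow_mul]
    have e : (3 / 2 : ℝ) ^ L * ((3 / 2) ^ 3) ^ t * ((1 / 4) ^ L * ((1 / 4) ^ 4) ^ t)
      = (3 / 8) ^ L * ((3 / 2) ^ 3 * (1 / 4) ^ 4) ^ t := by
      have : (3 / 8 : ℝ) = (3 / 2) * (1 / 4) := by norm_num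
      rw [this, mul_pow, mul_pow]; ring
    rw [e]
    refine mul_le_mul_of_nonneg_left ?_ (by positivity)
    exact pow_le_pow_left₀ (by positivity) (by norm_num) t
  have c5 : (4 : ℝ) ^ L * (1 / 16) ^ (L + 3 * t) ≤ (1 / 4) ^ (L + 4 * t) := by
    rw [pow_add, pow_add, pow_mul, pow_mul, ← mul_assoc, ← mul_pow]
    norm_num only
    refine mul_le_mul_of_nonneg_left ?_ (by positivity)
    exact pow_le_pow_left₀ (by positivity) (by norm_num) t
  have c6 : (1 / 8 : ℝ) ^ (L + 3 * t) ≤ (1 / 4) ^ (L + 4 * t) := by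
    rw [pow_add, pow_add, pow_mul, pow_mul]
    refine mul_le_mul (pow_le_pow_left₀ (by positivity) (by norm_num) L) 
      (pow_le_pow_left₀ (by positivity) (by norm_num) t) (by positivity) (by positivity)
  have d5 : (3 / 2 : ℝ) ^ (L + 3 * t) * (4 ^ L * (1 / 16) ^ (L + 3 * t) + (1 / 8) ^ (L + 3 * t))
      ≤ 2 * ((3 / 2) ^ (L + 3 * t) * (1 / 4) ^ (L + 4 * t)) := by
    have := mul_le_mul_of_nonneg_left (add_le_add c5 c6)
      (by positivity : (0 : ℝ) ≤ (3 / 2) ^ (L + 3 * t))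
    linarith
  have pm : 0 ≤ (3 / 2 : ℝ) ^ (L + 3 * t + (5 * t + 1)) *
      (4 ^ L * (1 / 16) ^ (L + 3 * t + (5 * t + 1)) + (1 / 8) ^ (L + 3 * t + (5 * t + 1))) := by
    positivity
  have pt : 0 ≤ (3 / 8 : ℝ) ^ (L + 3 * t + (5 * t + 1) + N) := by positivity
  have f5 := mul_le_mul_of_nonneg_left ((sub_le_self _ pm).trans d5)
    (by positivity : 0 ≤ 2 * (C ^ 2 + C))
  have f4 := mul_le_mul_of_nonneg_left ((sub_le_self _ pt).trans c4)
    (by positivity : 0 ≤ 2 * C)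
  replace b5 := abs_le.1 (b5.trans f5)
  have b4' := b4.2.trans f4
  have hz : 0 ≤ C * ((3 / 2) ^ (L + 3 * t) * (1 / 4) ^ (L + 4 * t)) := by positivity
  rw [abs_le]
  constructor
  · linarith [b4.1, b5.1, b5.2]
  · linarith [b4.1, b5.1, b5.2]

theorem convList_eq (A : ℕ → ℤ → ℝ) (a : ℕ → PowerSeries ℝ) (hA : ∀ s k, A s k = extz (a s) k)
    (l : List ℕ) (k : ℤ) : convList A l k = extz (l.map a).prod k := by
  induction l generalizing k with
  | nil =>
    simp only [convList, List.map_nil, List.prod_nil]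
    rcases lt_or_ge k 0 with h | h
    · rw [extz_neg _ _ h, if_neg (by omega)]
    · lift k to ℕ using h
      rw [extz_natCast, PowerSeries.coeff_one]
      simp
  | cons s l ih =>
    simp only [convList, zconv, List.map_cons, List.prod_cons]
    have h := hasSum_extz (a s) (l.map a).prod k
    have hinj : Function.Injective (fun n : ℕ => (n : ℤ)) := Nat.cast_injective
    have h' : HasSum (fun p : ℤ => A s p * convList A l (k - p))
        (extz (a s * (l.map a).prod) k) := by
      rw [← hinj.hasSum_iff]
      · convert h using 2 with j
        simp only [Function.comp, hA, ih, extz_natCast]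
      · intro x hx
        have : x < 0 := by
          by_contra hc
          exact hx ⟨x.toNat, by simp; omega⟩
        rw [hA, extz_neg _ _ this, zero_mul]
    exact h'.tsum_eq

theorem AconvS_eq (A : ℕ → ℤ → ℝ) (a : ℕ → PowerSeries ℝ) (hA : ∀ s k, A s k = extz (a s) k)
    (S : Finset ℕ) (k : ℕ) : AconvS A S k = PowerSeries.coeff k (∏ s ∈ S, a s) := by
  rw [AconvS, convList_eq A a hA, extz_natCast]
  congr 1
  rw [Finset.prod_eq_multiset_prod, ← Multiset.prod_coe, ← Multiset.map_coe, Finset.sort_eq]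

theorem sum_AconvS (A : ℕ → ℤ → ℝ) (a : ℕ → PowerSeries ℝ) (hA : ∀ s k, A s k = extz (a s) k)
    (T : Finset ℕ) (k : ℕ) (hk : 0 < k) :
    ∑ S ∈ T.powerset.filter Finset.Nonempty, AconvS A S k
      = PowerSeries.coeff k (∏ s ∈ T, (1 + a s)) := by
  rw [Finset.prod_one_add, map_sum, Finset.sum_filter]
  apply Finset.sum_congr rfl
  intro S _
  rw [AconvS_eq A a hA]
  split_ifs with h
  · rfl
  · rw [Finset.not_nonempty_iff_eq_empty] at h
    subst h
    simp [PowerSeries.coeff_one, hk.ne']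

theorem moment_bound (A : ℕ → ℝ) (hA : ∀ i, 0 ≤ A i) (hs : HasSum A (1 / 2)) (s : ℕ) (C : ℝ)
    (hC : 0 ≤ C)
    (hb : ∀ i : ℕ, 0 < i → A i ≤ C * (1 / 4) ^ s * ((4 : ℝ) ^ s / i) ^ 3) :
    ∃ K' ≤ (C + 1) * 4 ^ s, HasSum (fun i : ℕ => (i : ℝ) * A i) K' := by
  have key : ∀ n, ∑ i ∈ Finset.range n, (i : ℝ) * A i ≤ (C + 1) * 4 ^ s := by
    intro n
    have h1 : ∑ i ∈ Finset.range n, (i : ℝ) * A i ≤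
        ∑ i ∈ Finset.range n, (4 : ℝ) ^ s * A i +
          ∑ i ∈ Finset.Ioc (4 ^ s) (4 ^ s + n), C * 16 ^ s * ((i : ℝ) ^ 2)⁻¹ := by
      have h2 : ∑ i ∈ (Finset.range n).filter (fun i => 4 ^ s < i), C * 16 ^ s * ((i : ℝ) ^ 2)⁻¹ ≤
          ∑ i ∈ Finset.Ioc (4 ^ s) (4 ^ s + n), C * 16 ^ s * ((i : ℝ) ^ 2)⁻¹ := by
        apply Finset.sum_le_sum_of_subset_of_nonneg
        · intro i hi
          simp only [Finset.mem_filter, Finset.mem_range, Finset.mem_Ioc] at *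
          exact ⟨hi.2, by have := hi.1; exact hi.1.le.trans (Nat.le_add_left _ _)⟩
        · intros; positivity
      refine le_trans ?_ (add_le_add_right h2 _)
      rw [Finset.sum_filter, ← Finset.sum_add_distrib]
      apply Finset.sum_le_sum
      intro i _
      split_ifs with h
      · have hi : 0 < i := lt_of_le_of_lt (Nat.zero_le _) h
        have hiR : (0 : ℝ) < i := by exact_mod_cast hi
        have := mul_le_mul_of_nonneg_left (hb i hi) hiR.le
        have h5 : 0 ≤ (4 : ℝ) ^ s * A i := mul_nonneg (by positivity) (hA i)
        have e : (i : ℝ) * (C * (1 / 4) ^ s * ((4 : ℝ) ^ s / i) ^ 3) =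
            C * 16 ^ s * ((i : ℝ) ^ 2)⁻¹ := by
          have e1 : (16 : ℝ) ^ s = 4 ^ s * 4 ^ s := by rw [← mul_pow]; norm_num
          have e2 : (1 / 4 : ℝ) ^ s = (4 ^ s)⁻¹ := by rw [one_div, inv_pow]
          rw [e1, e2]
          field_simp
        linarith
      · rw [add_zero]
        refine mul_le_mul_of_nonneg_right ?_ (hA i)
        exact_mod_cast not_lt.1 h
    have h3 : ∑ i ∈ Finset.range n, A i ≤ 1 / 2 := sum_le_hasSum _ (fun i _ => hA i) hs
    have h4 := sum_Ioc_inv_sq_le_sub (α := ℝ) (k := 4 ^ s) (n := 4 ^ s + n) (by positivity) (by omega)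
    have h5 : ∑ i ∈ Finset.Ioc (4 ^ s) (4 ^ s + n), ((i : ℝ) ^ 2)⁻¹ ≤ ((4 : ℝ) ^ s)⁻¹ := by
      refine h4.trans ?_
      push_cast
      have : (0 : ℝ) ≤ (4 ^ s + (n : ℝ))⁻¹ := by positivity
      linarith
    rw [← Finset.mul_sum, ← Finset.mul_sum] at h1
    have h6 := mul_le_mul_of_nonneg_left h3 (by positivity : (0 : ℝ) ≤ 4 ^ s)
    have h7 := mul_le_mul_of_nonneg_left h5 (by positivity : (0 : ℝ) ≤ C * 16 ^ s)
    have e : C * 16 ^ s * ((4 : ℝ) ^ s)⁻¹ = C * 4 ^ s := by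
      have e1 : (16 : ℝ) ^ s = 4 ^ s * 4 ^ s := by rw [← mul_pow]; norm_num
      rw [e1]; field_simp
    rw [e] at h7
    have : (0 : ℝ) ≤ 4 ^ s := by positivity
    nlinarith
  have hnn : ∀ i : ℕ, 0 ≤ (i : ℝ) * A i := fun i => mul_nonneg (Nat.cast_nonneg _) (hA i)
  have hsum := summable_of_sum_range_le hnn key
  exact ⟨_, Real.tsum_le_of_sum_range_le hnn key, hsum.hasSum⟩

theorem exists_SeqS (A : ℕ → ℤ → ℝ)
    (hnonneg : ∀ s k, 0 ≤ A s k)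
    (hsupp : ∀ s : ℕ, ∀ k : ℤ, k < 0 → A s k = 0)
    (hI : ∀ s, ∑' k : ℤ, A s k = 1 / 2)
    (hII : ∀ r : ℕ, ∃ C : ℝ, ∀ s : ℕ, ∀ k : ℤ, 0 < k →
      A s k ≤ C * 4 ^ (-(s : ℝ)) * ((4 : ℝ) ^ (s : ℕ) / (k : ℝ)) ^ r)
    (hIII : ∃ C : ℝ, ∀ s : ℕ, ∀ k₁ k₂ : ℤ,
      |A s k₁ - A s k₂| ≤ C * (|(k₁ : ℝ) - (k₂ : ℝ)| * 16 ^ (-(s : ℝ)) + 8 ^ (-(s : ℝ)))) :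
    ∃ (a : ℕ → PowerSeries ℝ) (C : ℝ), (∀ s k, A s k = extz (a s) k) ∧ SeqS a C := by
  have rp : ∀ (x : ℝ) (s : ℕ), 0 < x → x ^ (-(s : ℝ)) = (1 / x) ^ s := by
    intro x s hx
    rw [Real.rpow_neg hx.le, Real.rpow_natCast, one_div, inv_pow]
  simp only [rp 4 _ (by norm_num), rp 16 _ (by norm_num), rp 8 _ (by norm_num)] at hII hIII
  obtain ⟨C0, h0⟩ := hII 0
  obtain ⟨C1, h1⟩ := hII 1
  obtain ⟨C3, h3⟩ := hII 3
  obtain ⟨D, hD⟩ := hIII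
  refine ⟨fun s => PowerSeries.mk fun i => A s i, |C0| + |C1| + |C3| + 1 + 2 * |D|, ?_, ?_⟩
  · intro s k
    rcases lt_or_ge k 0 with h | h
    · rw [extz_neg _ _ h, hsupp s k h]
    · lift k to ℕ using h
      rw [extz_natCast, PowerSeries.coeff_mk]
  have hext : ∀ s k, extz (PowerSeries.mk fun i => A s i) k = A s k := by
    intro s k
    rcases lt_or_ge k 0 with h | h
    · rw [extz_neg _ _ h, hsupp s k h]
    · lift k to ℕ using h
      rw [extz_natCast, PowerSeries.coeff_mk]
  have n0 := abs_nonneg C0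
  have n1 := abs_nonneg C1
  have n3 := abs_nonneg C3
  have nD := abs_nonneg D
  have m0 := le_abs_self C0
  have m1 := le_abs_self C1
  have m3 := le_abs_self C3
  have mD := le_abs_self D
  have hmass : ∀ s, HasSum (fun i : ℕ => A s i) (1 / 2) := by
    intro s
    have hsm : Summable (A s) := by
      by_contra hc
      have := hI s
      rw [tsum_eq_zero_of_not_summable hc] at this
      norm_num at this
    have hh := hsm.hasSum
    rw [hI s] at hh
    have hinj : Function.Injective (fun n : ℕ => (n : ℤ)) := Nat.cast_injective
    rw [← hinj.hasSum_iff] at hh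
    · exact hh
    · intro x hx
      apply hsupp
      by_contra hc
      exact hx ⟨x.toNat, by simp; omega⟩
  refine ⟨by positivity, ?_, ?_, ?_, ?_⟩
  · intro s
    refine ⟨fun i => by rw [PowerSeries.coeff_mk]; exact hnonneg _ _, ?_, ?_⟩
    · simpa using hmass s
    · obtain ⟨K', hK', hh⟩ := moment_bound (fun i : ℕ => A s i) (fun i => hnonneg _ _) (hmass s) s
        |C3| n3 (by
          intro i hi
          have := h3 s i (by exact_mod_cast hi)
          refine this.trans ?_
          push_cast
          gcongr)
      refine ⟨K', hK'.trans ?_, by simpa using hh⟩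
      refine mul_le_mul_of_nonneg_right ?_ (by positivity)
      linarith
  · intro s i
    rw [PowerSeries.coeff_mk]
    have p4 : (0 : ℝ) ≤ (1 / 4) ^ s := by positivity
    have q0 : ∀ i : ℕ, 0 < i → A s i ≤ |C0| * (1 / 4) ^ s := by
      intro i hi
      have := h0 s i (by exact_mod_cast hi)
      rw [pow_zero, mul_one] at this
      exact this.trans (mul_le_mul_of_nonneg_right m0 p4)
    rcases Nat.eq_zero_or_pos i with rfl | hi
    · have h := hD s 0 1
      have h' := q0 1 one_pos
      push_cast at h h' ⊢
      have e : |(0 : ℝ) - 1| = 1 := by norm_num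
      rw [e, one_mul] at h
      have h16 : (1 / 16 : ℝ) ^ s ≤ (1 / 4) ^ s := pow_le_pow_left₀ (by norm_num) (by norm_num) s
      have h8 : (1 / 8 : ℝ) ^ s ≤ (1 / 4) ^ s := pow_le_pow_left₀ (by norm_num) (by norm_num) s
      have hh : D * ((1 / 16 : ℝ) ^ s + (1 / 8) ^ s) ≤ |D| * ((1 / 4) ^ s + (1 / 4) ^ s) := by
        gcongr
      have := (abs_le.1 h).2
      nlinarith [mul_nonneg n1 p4, mul_nonneg n3 p4]
    · refine (q0 i hi).trans (mul_le_mul_of_nonneg_right ?_ p4)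
      linarith
  · intro s i
    rw [PowerSeries.coeff_mk]
    rcases Nat.eq_zero_or_pos i with rfl | hi
    · simp only [Nat.cast_zero, zero_mul]; positivity
    · have hiR : (0 : ℝ) < i := by exact_mod_cast hi
      have := mul_le_mul_of_nonneg_left (h1 s i (by exact_mod_cast hi)) hiR.le
      have e : (i : ℝ) * (C1 * (1 / 4) ^ s * ((4 : ℝ) ^ s / ((i : ℤ) : ℝ)) ^ 1) = C1 := by
        have e2 : (1 / 4 : ℝ) ^ s = (4 ^ s)⁻¹ := by rw [one_div, inv_pow]
        rw [e2, pow_one, Int.cast_natCast]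
        field_simp
      rw [e] at this
      linarith
  · intro s x y
    simp only [hext]
    refine (hD s x y).trans ?_
    have : 0 ≤ |(x : ℝ) - y| * (1 / 16) ^ s + (1 / 8) ^ s := by positivity
    have := mul_le_mul_of_nonneg_right (show D ≤ |C0| + |C1| + |C3| + 1 + 2 * |D| by linarith) this
    linarith

theorem limit_of_B (A : ℕ → ℤ → ℝ)
    (hnonneg : ∀ s k, 0 ≤ A s k)
    (hsupp : ∀ s : ℕ, ∀ k : ℤ, k < 0 → A s k = 0)
    (hI : ∀ s, ∑' k : ℤ, A s k = 1 / 2)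
    (hII : ∀ r : ℕ, ∃ C : ℝ, ∀ s : ℕ, ∀ k : ℤ, 0 < k →
      A s k ≤ C * 4 ^ (-(s : ℝ)) * ((4 : ℝ) ^ (s : ℕ) / (k : ℝ)) ^ r)
    (hIII : ∃ C : ℝ, ∀ s : ℕ, ∀ k₁ k₂ : ℤ,
      |A s k₁ - A s k₂| ≤ C * (|(k₁ : ℝ) - (k₂ : ℝ)| * 16 ^ (-(s : ℝ)) + 8 ^ (-(s : ℝ)))) :
    ∀ ε : ℝ, 0 < ε → ∃ r : ℕ, 0 < r ∧ ∀ n : ℕ, r ≤ n → ∀ k : ℤ,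
      (4 : ℤ) ^ n ≤ k → k < 4 ^ (n + 1) →
      Summable (fun S : {S : Finset ℕ // S.Nonempty} => AconvS A S.1 k) ∧
      |(3 / 2 : ℝ) ^ (-(n : ℤ)) * (∑' S : {S : Finset ℕ // S.Nonempty}, AconvS A S.1 k) -
          (3 / 2 : ℝ) ^ (-(r : ℤ)) *
            ∑ S ∈ (Finset.Icc (n - r) (n + r)).powerset.filter Finset.Nonempty,
              AconvS A S k| <
        ε * (4 : ℝ) ^ (-(n : ℤ)) := by
  obtain ⟨a, C, hA, h⟩ := exists_SeqS A hnonneg hsupp hI hII hIII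
  intro ε hε
  have hC := h.pos
  obtain ⟨t0, ht0⟩ : ∃ t0 : ℕ, (8 * C ^ 2 + 10 * C) * (2 / 3 : ℝ) ^ t0 < ε := by
    obtain ⟨m, hm⟩ := exists_pow_lt_of_lt_one
      (show 0 < ε / (8 * C ^ 2 + 10 * C + 1) by positivity) (show (2 / 3 : ℝ) < 1 by norm_num)
    refine ⟨m, ?_⟩
    rw [lt_div_iff₀ (by positivity)] at hm
    have : (0 : ℝ) < (2 / 3) ^ m := by positivity
    nlinarith
  obtain ⟨t, ht, htpos⟩ : ∃ t : ℕ, (8 * C ^ 2 + 10 * C) * (2 / 3 : ℝ) ^ t < ε ∧ 0 < t := by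
    refine ⟨t0 + 1, lt_of_le_of_lt ?_ ht0, by omega⟩
    refine mul_le_mul_of_nonneg_left ?_ (by positivity)
    exact pow_le_pow_of_le_one (by norm_num) (by norm_num) (by omega)
  refine ⟨4 * t, by omega, ?_⟩
  intro n hn k hk1 hk2
  obtain ⟨L, rfl⟩ : ∃ L, n = L + 4 * t := ⟨n - 4 * t, by omega⟩
  lift k to ℕ using le_trans (by positivity) hk1
  have hk : 4 ^ (L + 4 * t) ≤ k := by exact_mod_cast hk1
  have hk0 : 0 < k := lt_of_lt_of_le (by positivity) hk
  set M := L + 3 * t + (5 * t + 1) with hM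
  set K := (8 * C ^ 2 + 10 * C) * ((3 / 2 : ℝ) ^ (L + 3 * t) * (1 / 4) ^ (L + 4 * t)) with hK
  have est := fun N => h.estimate L t N k hk
  rw [← hM] at est
  have hmid : ∑ S ∈ (Finset.Icc (L + 4 * t - 4 * t) (L + 4 * t + 4 * t)).powerset.filter
      Finset.Nonempty, AconvS A S k = PowerSeries.coeff k (QS a L M) := by
    rw [sum_AconvS A a hA _ k hk0, QS]
    congr 2
    ext i
    simp only [Finset.mem_Icc, Finset.mem_Ico]
    omega
  have hnn : ∀ S : Finset ℕ, 0 ≤ AconvS A S k := by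
    intro S
    rw [AconvS_eq A a hA]
    refine Finset.prod_induction a (fun f => ∀ i, 0 ≤ PowerSeries.coeff i f) ?_ ?_ ?_ k
    · intro f g hf hg i
      rw [PowerSeries.coeff_mul]
      exact Finset.sum_nonneg fun p _ => mul_nonneg (hf _) (hg _)
    · exact GoodS.one.nonneg
    · exact fun s _ => (h.good s).nonneg
  let U : ℕ → Finset {S : Finset ℕ // S.Nonempty} := fun N =>
    Finset.subtype _ (Finset.range (M + N)).powerset
  have hU : ∀ N, ∑ S ∈ U N, AconvS A S.1 k = PowerSeries.coeff k (QS a 0 (M + N)) := by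
    intro N
    rw [QS, ← Finset.range_eq_Ico, ← sum_AconvS A a hA _ k hk0]
    exact Finset.sum_subtype_eq_sum_filter (fun S => AconvS A S k)
  have hUmono : Monotone U := by
    intro x y hxy S hS
    simp only [U, Finset.mem_subtype, Finset.mem_powerset] at *
    exact hS.trans (Finset.range_mono (by omega))
  have hUex : ∀ S : {S : Finset ℕ // S.Nonempty}, ∃ N, S ∈ U N := by
    intro S
    refine ⟨S.1.sup id + 1, ?_⟩
    simp only [U, Finset.mem_subtype, Finset.mem_powerset]
    intro i hi
    have := Finset.le_sup (f := id) hi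
    simp only [id] at this
    rw [Finset.mem_range]
    omega
  have hUt : Filter.Tendsto U Filter.atTop Filter.atTop :=
    Filter.tendsto_atTop_finset_of_monotone hUmono hUex
  have hsummable : Summable (fun S : {S : Finset ℕ // S.Nonempty} => AconvS A S.1 k) := by
    refine summable_of_sum_le (c := (3 / 2) ^ L * PowerSeries.coeff k (QS a L M) + K)
      (fun S => hnn S.1) ?_
    intro F
    obtain ⟨N, hN⟩ := (hUt.eventually (Filter.eventually_ge_atTop F)).exists
    refine (Finset.sum_le_sum_of_subset_of_nonneg hN fun S _ _ => hnn S.1).trans ?_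
    rw [hU]
    linarith [(abs_le.1 (est N)).2]
  refine ⟨hsummable, ?_⟩
  have hlim := (hsummable.hasSum.comp hUt)
  simp only [Function.comp_def, hU] at hlim
  have hle := le_of_tendsto ((hlim.sub_const
    ((3 / 2) ^ L * PowerSeries.coeff k (QS a L M))).abs) (Filter.Eventually.of_forall est)
  rw [hmid]
  set T := ∑' S : {S : Finset ℕ // S.Nonempty}, AconvS A S.1 k
  set Y := PowerSeries.coeff k (QS a L M)
  rw [zpow_neg, zpow_neg, zpow_neg, zpow_natCast, zpow_natCast, zpow_natCast]
  have e1 : ((3 / 2 : ℝ) ^ (L + 4 * t))⁻¹ * T - ((3 / 2 : ℝ) ^ (4 * t))⁻¹ * Y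
      = ((3 / 2 : ℝ) ^ (L + 4 * t))⁻¹ * (T - (3 / 2) ^ L * Y) := by
    rw [pow_add]
    field_simp
  rw [e1, abs_mul, abs_of_nonneg (by positivity)]
  refine lt_of_le_of_lt (mul_le_mul_of_nonneg_left hle (by positivity)) ?_
  have e2 : ((3 / 2 : ℝ) ^ (L + 4 * t))⁻¹ * K
      = ((8 * C ^ 2 + 10 * C) * (2 / 3 : ℝ) ^ t) * ((4 : ℝ) ^ (L + 4 * t))⁻¹ := by
    have e3 : (2 / 3 : ℝ) ^ t = ((3 / 2 : ℝ) ^ t)⁻¹ := by rw [← inv_pow]; norm_num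
    have e4 : (1 / 4 : ℝ) ^ (L + 4 * t) = ((4 : ℝ) ^ (L + 4 * t))⁻¹ := by rw [one_div, inv_pow]
    have e5 : (3 / 2 : ℝ) ^ (L + 4 * t) = (3 / 2) ^ (L + 3 * t) * (3 / 2) ^ t := by
      rw [← pow_add]; congr 1; omega
    rw [hK, e3, e4, e5]
    field_simp
  rw [e2]
  exact mul_lt_mul_of_pos_right ht (by positivity)
end
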